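/- With the notation of the context, let σ ∈ G and let 𝔞 = (α) be an odd principal ideal of 𝓞 with totally positive generator α. Then spin(σ, 𝔞) = spin(σ⁻¹, 𝔞) · μ₂(α, σα), where μ₂(α, σα) = ∏_{𝔭 ∣ 2𝓞} (α, σα / 𝔭) is the product of the Hilbert symbols at the primes of 𝓞 above 2. In particular, spin(σ, 𝔞) = spin(σ⁻¹, 𝔞) whenever α ≡ 1 (mod 4𝓞). -/

import Mathlib

set_option synthInstance.maxHeartbeats 1000000
set_option maxHeartbeats 2000000

open NumberField
open scoped Classical

noncomputable section

variable {K : Type*} [Field K] [NumberField K]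

/-- The quadratic residue symbol `(α/𝔭)` modulo a prime ideal `𝔭` of the ring of
integers: `1` if `α` is a nonzero square modulo `𝔭`, `-1` if it is a nonzero
non-square, and `0` if `α ∈ 𝔭`. -/
def legSym (𝔭 : Ideal (𝓞 K)) (α : 𝓞 K) : ℤ :=
  if Ideal.Quotient.mk 𝔭 α = 0 then 0
  else if IsSquare (Ideal.Quotient.mk 𝔭 α) then 1 else -1

/-- The quadratic residue symbol `(α/𝔟)` for an ideal `𝔟`, extended multiplicatively over
the prime factorization of `𝔟` (with multiplicity). -/
def quadSym (𝔟 : Ideal (𝓞 K)) (α : 𝓞 K) : ℤ :=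
  ((UniqueFactorizationMonoid.normalizedFactors 𝔟).map (fun 𝔭 => legSym 𝔭 α)).prod

/-- An element of `𝓞 K` is totally positive if it is positive under every real embedding. -/
def TotPos (α : 𝓞 K) : Prop := ∀ v : K →+* ℝ, 0 < v (α : K)

/-- The image of an ideal under a field automorphism. -/
def galMap (σ : K ≃ₐ[ℚ] K) (𝔞 : Ideal (𝓞 K)) : Ideal (𝓞 K) :=
  Ideal.map (RingOfIntegers.mapRingHom (σ : K →+* K)) 𝔞

/-- The spin `spin(σ,𝔞) = (α/σ𝔞)` of a principal ideal `𝔞` having a totally positive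
generator `α`; under the standing hypotheses (totally real, totally positive units are
squares) this is independent of the chosen totally positive generator, so the value below,
computed at an arbitrarily chosen such generator, is the spin. For ideals with no totally
positive generator the value is irrelevant (set to `0`). -/
def spin (σ : K ≃ₐ[ℚ] K) (𝔞 : Ideal (𝓞 K)) : ℤ :=
  if h : ∃ α : 𝓞 K, Ideal.span {α} = 𝔞 ∧ TotPos α then
    quadSym (galMap σ 𝔞) h.choose
  else 0

/-- An ideal of the ring of integers is odd if it is coprime to `2`. -/
def OddIdeal (𝔞 : Ideal (𝓞 K)) : Prop := IsCoprime 𝔞 (Ideal.span {(2 : 𝓞 K)})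

open IsDedekindDomain in
/-- The `ℤ`-valued Hilbert symbol `(a, b / v)` at a finite place `v` of `K`: it is `1` if
`a x² + b y² = z²` has a nontrivial solution in the completion `K_v`, and `-1` otherwise. -/
def hilbSym (v : HeightOneSpectrum (𝓞 K)) (a b : K) : ℤ :=
  if ∃ x y z : v.adicCompletion K, ¬(x = 0 ∧ y = 0 ∧ z = 0) ∧
      algebraMap K (v.adicCompletion K) a * x ^ 2 +
        algebraMap K (v.adicCompletion K) b * y ^ 2 = z ^ 2
  then 1 else -1

open IsDedekindDomain in
/-- `μ₂(a,b)`: the product of the Hilbert symbols `(a, b / 𝔭)` over the primes `𝔭 ∣ 2`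
of `𝓞 K`. -/
def mu2 (a b : K) : ℤ :=
  ∏ᶠ v : HeightOneSpectrum (𝓞 K),
    if (2 : 𝓞 K) ∈ v.asIdeal then hilbSym v a b else 1

set_option linter.unusedSectionVars false

open Filter Topology in
lemma tendsto_tsum_exp_neg_sq {l : Filter ℝ} {a : ℝ → ℂ}
    (ha : Tendsto (fun t => (a t).re) l atTop) (c : ℝ) :
    Tendsto (fun t => ∑' n : ℤ, Complex.exp (-Real.pi * a t * n ^ 2 + 2 * Real.pi * (Complex.I * c) * n))
      l (𝓝 1) := by
  have key : Tendsto (fun t => ∑' n : ℤ,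
      Complex.exp (-Real.pi * a t * n ^ 2 + 2 * Real.pi * (Complex.I * c) * n))
      l (𝓝 (∑' n : ℤ, if n = 0 then (1 : ℂ) else 0)) := by
    have hnorm : ∀ t, ∀ n : ℤ,
        ‖Complex.exp (-Real.pi * a t * n ^ 2 + 2 * Real.pi * (Complex.I * c) * n)‖
          = Real.exp (-Real.pi * (a t).re * (n : ℝ) ^ 2) := by
      intro t n
      rw [Complex.norm_exp]
      congr 1
      have h2 : ((n : ℂ) ^ 2) = (((n : ℝ) ^ 2 : ℝ) : ℂ) := by push_cast; rfl
      have h3 : (2 * Real.pi * (Complex.I * c) * n : ℂ) = ((2 * Real.pi * c * n : ℝ) : ℂ) * Complex.I := by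
        push_cast; ring
      have h4 : (-Real.pi * a t * n ^ 2 : ℂ) = ((-Real.pi * (n : ℝ) ^ 2 : ℝ) : ℂ) * a t := by
        push_cast; ring
      rw [h3, h4, Complex.add_re, Complex.re_ofReal_mul, Complex.re_ofReal_mul, Complex.I_re]
      ring
    refine tendsto_tsum_of_dominated_convergence
      (bound := fun n : ℤ => ‖Complex.exp (Real.pi * Complex.I * n ^ 2 * Complex.I)‖) ?_ ?_ ?_
    · have := (summable_jacobiTheta₂_term_iff 0 Complex.I).mpr (by simp)
      simpa [jacobiTheta₂_term] using this.norm
    · intro n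
      by_cases hn : n = 0
      · subst hn; simp [tendsto_const_nhds]
      · rw [if_neg hn, tendsto_zero_iff_norm_tendsto_zero]
        simp_rw [hnorm]
        refine Real.tendsto_exp_atBot.comp ?_
        have hn' : 0 < Real.pi * (n : ℝ) ^ 2 := by
          have : (n : ℝ) ≠ 0 := by exact_mod_cast hn
          positivity
        have := (tendsto_neg_atTop_atBot.comp (ha.const_mul_atTop hn'))
        refine this.congr fun t => ?_
        simp only [Function.comp]; ring
    · filter_upwards [ha.eventually_ge_atTop 1] with t ht n
      rw [hnorm]
      have : (Real.pi * Complex.I * n ^ 2 * Complex.I : ℂ) = ((-Real.pi * (n : ℝ) ^ 2 : ℝ) : ℂ) := by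
        push_cast
        linear_combination (Real.pi * n ^ 2 : ℂ) * Complex.I_mul_I
      rw [this, Complex.norm_exp, Complex.ofReal_re]
      apply Real.exp_le_exp.mpr
      have : 0 ≤ Real.pi * (n : ℝ) ^ 2 := by positivity
      nlinarith
  simpa using key

/-- The primitive eighth root of unity `exp (π i / 4)`. -/
def zeta8 : ℂ := Complex.exp (Real.pi / 4 * Complex.I)

/-- The phase `exp (2 π i x ^ 2 / (4 d))` at an integer `x`. -/
def gaussPhase (d : ℕ) (x : ℤ) : ℂ :=
  Complex.exp (2 * Real.pi * Complex.I * ((x : ℂ) ^ 2 / (4 * d)))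

lemma gaussPhase_add (d : ℕ) (hd : d ≠ 0) (x k : ℤ) :
    gaussPhase d (x + 2 * d * k) = gaussPhase d x := by
  unfold gaussPhase
  rw [Complex.exp_eq_exp_iff_exists_int]
  refine ⟨x * k + d * k ^ 2, ?_⟩
  have : (d : ℂ) ≠ 0 := by exact_mod_cast hd
  push_cast
  field_simp
  ring

open Filter Topology in
lemma tendsto_sqrt_mul_tsum_shift (N : ℕ) (hN : N ≠ 0) (x : ℤ) :
    Tendsto (fun t : ℝ => (t : ℂ) ^ (1 / 2 : ℂ) *
      ∑' k : ℤ, Complex.exp (-Real.pi * t * ((k * N + x : ℤ) : ℂ) ^ 2)) (𝓝[>] 0) (𝓝 (1 / N)) := by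
  have hN' : (0 : ℝ) < N := by positivity
  have hNc : (N : ℂ) ≠ 0 := by exact_mod_cast hN
  have h1 := tendsto_tsum_exp_neg_sq (l := 𝓝[>] (0 : ℝ)) (a := fun t => ((1 / (t * N ^ 2) : ℝ) : ℂ))
    (by
      simp only [Complex.ofReal_re]
      have : Tendsto (fun t : ℝ => (1 / (N : ℝ) ^ 2) * t⁻¹) (𝓝[>] 0) atTop :=
        tendsto_inv_nhdsGT_zero.const_mul_atTop (by positivity)
      refine this.congr fun t => ?_
      field_simp) (-x / N)
  have h2 := h1.const_mul (1 / (N : ℂ))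
  rw [mul_one] at h2
  refine h2.congr' ?_
  filter_upwards [self_mem_nhdsWithin] with t ht
  have ht : (0 : ℝ) < t := ht
  have htc : (t : ℂ) ≠ 0 := by exact_mod_cast ht.ne'
  have e1 := Complex.tsum_exp_neg_quadratic (a := ((1 / (t * N ^ 2) : ℝ) : ℂ))
    (by rw [Complex.ofReal_re]; positivity) (Complex.I * ((-x / N : ℝ) : ℂ))
  rw [e1, ← mul_assoc]
  congr 1
  · have : (1 / (t * N ^ 2) : ℝ) = (t ^ (1 / 2 : ℝ) * N) ^ (-2 : ℝ) := by
      rw [Real.mul_rpow (by positivity) (by positivity), ← Real.rpow_mul ht.le]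
      norm_num
      rw [Real.rpow_neg_one, mul_comm]
    have e2 : (((1 / (t * N ^ 2) : ℝ) : ℂ)) ^ (1 / 2 : ℂ) = (((t ^ (1 / 2 : ℝ) * N)⁻¹ : ℝ) : ℂ) := by
      rw [this]
      have : (1 / 2 : ℂ) = ((1 / 2 : ℝ) : ℂ) := by push_cast; rfl
      rw [this, ← Complex.ofReal_cpow (by positivity), ← Real.rpow_mul (by positivity)]
      norm_num
      rw [Real.rpow_neg_one, mul_inv]; push_cast; ring
    have e3 : (t : ℂ) ^ (1 / 2 : ℂ) = ((t ^ (1 / 2 : ℝ) : ℝ) : ℂ) := by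
      rw [Complex.ofReal_cpow ht.le]; push_cast; rfl
    rw [e2, e3]
    push_cast
    field_simp
  · refine tsum_congr fun k => ?_
    congr 1
    push_cast
    field_simp
    have : (Complex.I ^ 2 : ℂ) = -1 := Complex.I_sq
    ring_nf
    simp only [this, Complex.I_pow_four]
    ring

lemma ofReal_mul_cpow {t : ℝ} (ht : 0 < t) {x : ℂ} (hx : x ≠ 0) (c : ℂ) :
    ((t : ℂ) * x) ^ c = (t : ℂ) ^ c * x ^ c := by
  have htc : (t : ℂ) ≠ 0 := by exact_mod_cast ht.ne'
  rw [Complex.cpow_def_of_ne_zero (mul_ne_zero htc hx), Complex.cpow_def_of_ne_zero htc,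
    Complex.cpow_def_of_ne_zero hx, Complex.log_ofReal_mul ht hx, ← Complex.ofReal_log ht.le,
    add_mul, Complex.exp_add]

lemma summable_exp_neg_sq {a : ℂ} (ha : 0 < a.re) :
    Summable fun n : ℤ => Complex.exp (-Real.pi * a * n ^ 2) := by
  have := (summable_jacobiTheta₂_term_iff 0 (Complex.I * a)).mpr (by simpa using ha)
  refine this.congr fun n => ?_
  unfold jacobiTheta₂_term
  congr 1
  linear_combination (Real.pi * a * n ^ 2 : ℂ) * Complex.I_sq

lemma exp_neg_sq_eq_gaussPhase (d : ℕ) (hd : d ≠ 0) (t : ℝ) (n : ℤ) :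
    Complex.exp (-Real.pi * (t - Complex.I / (2 * d)) * n ^ 2) =
      gaussPhase d n * Complex.exp (-Real.pi * t * n ^ 2) := by
  have : (d : ℂ) ≠ 0 := by exact_mod_cast hd
  rw [gaussPhase, ← Complex.exp_add]
  congr 1
  field_simp
  ring

lemma tsum_exp_neg_sq_eq_sum (d : ℕ) [NeZero (2 * d)] (hd : d ≠ 0) (t : ℝ) (ht : 0 < t) :
    ∑' n : ℤ, Complex.exp (-Real.pi * (t - Complex.I / (2 * d)) * n ^ 2) =
      ∑ x : Fin (2 * d), gaussPhase d (x.val : ℤ) *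
        ∑' k : ℤ, Complex.exp (-Real.pi * t * ((k * (2 * d : ℕ) + (x.val : ℤ) : ℤ) : ℂ) ^ 2) := by
  have hs : Summable fun n : ℤ => Complex.exp (-Real.pi * (t - Complex.I / (2 * d)) * n ^ 2) := by
    apply summable_exp_neg_sq
    have : (Complex.I / (2 * d) : ℂ) = ((1 / (2 * d) : ℝ) : ℂ) * Complex.I := by push_cast; ring
    rw [this]
    simpa using ht
  have hs0 : Summable fun n : ℤ => Complex.exp (-Real.pi * t * n ^ 2) :=
    summable_exp_neg_sq (by simpa using ht)
  rw [← (Int.divModEquiv (2 * d)).symm.tsum_eq]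
  have hs' := ((Int.divModEquiv (2 * d)).symm.summable_iff).mpr hs
  rw [← (Equiv.prodComm _ _).tsum_eq]
  have hs'' := ((Equiv.prodComm (Fin (2 * d)) ℤ).summable_iff).mpr hs'
  refine (Summable.tsum_prod hs'').trans ?_
  rw [tsum_fintype]
  refine Finset.sum_congr rfl fun x _ => ?_
  have hinj : Function.Injective fun k : ℤ => k * ((2 * d : ℕ) : ℤ) + (x.val : ℤ) := by
    intro k l h
    have h2 : ((2 * d : ℕ) : ℤ) ≠ 0 := by exact_mod_cast NeZero.ne (2 * d)
    exact mul_right_cancel₀ h2 (add_right_cancel h)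
  refine Eq.trans (tsum_congr fun k => ?_)
    ((hs0.comp_injective hinj).tsum_mul_left (gaussPhase d (x.val : ℤ)))
  have e : (Int.divModEquiv (2 * d)).symm ((Equiv.prodComm (Fin (2 * d)) ℤ) (x, k)) =
      k * ((2 * d : ℕ) : ℤ) + (x.val : ℤ) := by
    simp [Int.divModEquiv]
  simp only [Function.comp]
  rw [e]
  rw [exp_neg_sq_eq_gaussPhase d hd]
  congr 1
  refine Eq.trans (congrArg _ ?_) (gaussPhase_add d hd _ k)
  push_cast; ring

open Filter Topology in
lemma sum_gaussPhase (d : ℕ) (hd : d ≠ 0) :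
    ∃ r : ℝ, 0 < r ∧ ∑ x : Fin (2 * d), gaussPhase d (x.val : ℤ) = r * zeta8 := by
  have : NeZero (2 * d) := ⟨by omega⟩
  have hdp : (0 : ℝ) < d := by positivity
  have hdc : (d : ℂ) ≠ 0 := by exact_mod_cast hd
  have L : Tendsto (fun t : ℝ => (t : ℂ) ^ (1 / 2 : ℂ) *
      ∑' n : ℤ, Complex.exp (-Real.pi * (t - Complex.I / (2 * d)) * n ^ 2)) (𝓝[>] 0)
      (𝓝 (∑ x : Fin (2 * d), gaussPhase d (x.val : ℤ) * (1 / (2 * d : ℕ)))) := by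
    have := tendsto_finsetSum (Finset.univ : Finset (Fin (2 * d)))
      (fun x _ => (tendsto_sqrt_mul_tsum_shift (2 * d) (by omega) (x.val : ℤ)).const_mul
        (gaussPhase d (x.val : ℤ)))
    refine this.congr' ?_
    filter_upwards [self_mem_nhdsWithin] with t ht
    rw [tsum_exp_neg_sq_eq_sum d hd t ht, Finset.mul_sum]
    refine Finset.sum_congr rfl fun x _ => ?_
    ring
  set A : ℝ → ℂ := fun t => (t : ℂ) - Complex.I / (2 * d) with hA
  set g : ℝ → ℂ := fun t => 1 / (4 * d ^ 2) * (1 + 2 * d * Complex.I * t) with hg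
  have hgre : ∀ t, (g t).re = 1 / (4 * d ^ 2) := by
    intro t
    have : g t = ((1 / (4 * d ^ 2) : ℝ) : ℂ) * (((1 : ℝ) : ℂ) + ((2 * d * t : ℝ) : ℂ) * Complex.I) := by
      simp only [hg]; push_cast; ring
    rw [this, Complex.re_ofReal_mul]
    simp
  have hB : ∀ t : ℝ, 0 < t → ∀ n : ℤ, Complex.exp (-Real.pi / A t * n ^ 2) =
      Complex.exp (-Real.pi / (g t / t) * n ^ 2) := by
    intro t ht n
    have htc : (t : ℂ) ≠ 0 := by exact_mod_cast ht.ne'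
    have hw : (1 + 2 * d * Complex.I * t : ℂ) ≠ 0 := by
      intro h
      have := hgre t
      simp only [hg, h, mul_zero, Complex.zero_re] at this
      have h4 : (0 : ℝ) < 1 / (4 * d ^ 2) := by positivity
      linarith
    have hAe : A t = -Complex.I * (1 + 2 * d * Complex.I * t) / (2 * d) := by
      simp only [hA]
      field_simp
      linear_combination (2 * d * t : ℂ) * Complex.I_sq
    obtain ⟨w, hwd⟩ : ∃ w : ℂ, w = 1 + 2 * d * Complex.I * t := ⟨_, rfl⟩
    have hgw : g t = 1 / (4 * d ^ 2) * w := by rw [hwd]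
    rw [← hwd] at hw hAe
    have hAi : -Real.pi / A t = -Real.pi * (2 * d * Complex.I) / w := by
      rw [hAe]
      field_simp [Complex.I_ne_zero]
      linear_combination Complex.I_sq
    rw [Complex.exp_eq_exp_iff_exists_int]
    refine ⟨-(d * n ^ 2), ?_⟩
    rw [hAi, hgw]
    push_cast
    field_simp
    rw [hwd]
    ring_nf
    simp only [Complex.I_sq]
    ring
  have R : Tendsto (fun t : ℝ => (t : ℂ) ^ (1 / 2 : ℂ) *
      ∑' n : ℤ, Complex.exp (-Real.pi * (t - Complex.I / (2 * d)) * n ^ 2)) (𝓝[>] 0)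
      (𝓝 (1 / (-Complex.I / (2 * d)) ^ (1 / 2 : ℂ) * (1 / (4 * d ^ 2 : ℂ)) ^ (1 / 2 : ℂ))) := by
    have hA0 : Tendsto A (𝓝[>] 0) (𝓝 (-Complex.I / (2 * d))) := by
      have : ContinuousAt A 0 := by fun_prop
      have h := this.tendsto.mono_left (nhdsWithin_le_nhds (s := Set.Ioi 0))
      simpa [hA, neg_div] using h
    have hg0 : Tendsto g (𝓝[>] 0) (𝓝 (1 / (4 * d ^ 2))) := by
      have : ContinuousAt g 0 := by fun_prop
      have h := this.tendsto.mono_left (nhdsWithin_le_nhds (s := Set.Ioi 0))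
      simpa [hg] using h
    have hA1 : Tendsto (fun t => 1 / A t ^ (1 / 2 : ℂ)) (𝓝[>] 0)
        (𝓝 (1 / (-Complex.I / (2 * d)) ^ (1 / 2 : ℂ))) := by
      refine Tendsto.div tendsto_const_nhds (hA0.cpow tendsto_const_nhds ?_) ?_
      · have : (-Complex.I / (2 * d) : ℂ) = ((-1 / (2 * d) : ℝ) : ℂ) * Complex.I := by push_cast; ring
        rw [this, Complex.mem_slitPlane_iff]
        right
        rw [Complex.im_ofReal_mul]
        simp [hd]
      · rw [Complex.cpow_def_of_ne_zero (by simp [hd])]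
        exact Complex.exp_ne_zero _
    have hg1 : Tendsto (fun t => g t ^ (1 / 2 : ℂ)) (𝓝[>] 0)
        (𝓝 ((1 / (4 * d ^ 2 : ℂ)) ^ (1 / 2 : ℂ))) := by
      refine hg0.cpow tendsto_const_nhds ?_
      rw [Complex.mem_slitPlane_iff]
      left
      have : (1 / (4 * d ^ 2) : ℂ) = ((1 / (4 * d ^ 2) : ℝ) : ℂ) := by push_cast; ring
      rw [this, Complex.ofReal_re]
      positivity
    have hth := tendsto_tsum_exp_neg_sq (l := 𝓝[>] (0 : ℝ)) (a := fun t => g t / t) (by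
      have : Tendsto (fun t : ℝ => (1 / (4 * (d : ℝ) ^ 2)) * t⁻¹) (𝓝[>] 0) atTop :=
        tendsto_inv_nhdsGT_zero.const_mul_atTop (by positivity)
      refine this.congr fun t => ?_
      rw [Complex.div_ofReal_re, hgre, div_eq_mul_inv (1 / (4 * (d : ℝ) ^ 2))]) 0
    have := (hA1.mul hg1).mul hth
    rw [mul_one] at this
    refine this.congr' ?_
    filter_upwards [self_mem_nhdsWithin] with t ht
    have ht : (0 : ℝ) < t := ht
    have htc : (t : ℂ) ≠ 0 := by exact_mod_cast ht.ne'
    have hAre : 0 < (A t).re := by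
      have : A t = (t : ℂ) + ((-1 / (2 * d) : ℝ) : ℂ) * Complex.I := by
        simp only [hA]; push_cast; ring
      rw [this, Complex.add_re, Complex.re_ofReal_mul]
      simpa using ht
    have hgt : 0 < (g t / t).re := by
      rw [Complex.div_ofReal_re, hgre]; positivity
    have hgne : g t ≠ 0 := by
      intro h
      have := hgre t
      rw [h, Complex.zero_re] at this
      have h4 : (0 : ℝ) < 1 / (4 * d ^ 2) := by positivity
      linarith
    have e1 := Complex.tsum_exp_neg_mul_int_sq hAre
    have e2 := Complex.tsum_exp_neg_mul_int_sq hgt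
    have e3 : ∑' n : ℤ, Complex.exp (-Real.pi / A t * n ^ 2) =
        ∑' n : ℤ, Complex.exp (-Real.pi / (g t / t) * n ^ 2) := tsum_congr (hB t ht)
    have e4 : g t ^ (1 / 2 : ℂ) = (t : ℂ) ^ (1 / 2 : ℂ) * (g t / t) ^ (1 / 2 : ℂ) := by
      rw [← ofReal_mul_cpow ht (div_ne_zero hgne htc)]
      congr 1
      field_simp
    have e5 : (g t / t) ^ (1 / 2 : ℂ) ≠ 0 := by
      rw [Complex.cpow_def_of_ne_zero (div_ne_zero hgne htc)]
      exact Complex.exp_ne_zero _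
    have e6 : ∑' n : ℤ, Complex.exp (-Real.pi * (g t / t) * n ^ 2 +
        2 * Real.pi * (Complex.I * ((0 : ℝ) : ℂ)) * n) =
        ∑' n : ℤ, Complex.exp (-Real.pi * (g t / t) * n ^ 2) := by
      refine tsum_congr fun n => ?_
      simp
    rw [e6, e1, e3, e2, e4]
    field_simp
  have E := tendsto_nhds_unique L R
  have E2 : ∑ x : Fin (2 * d), gaussPhase d (x.val : ℤ) = (2 * d : ℂ) *
      (1 / (-Complex.I / (2 * d)) ^ (1 / 2 : ℂ) * (1 / (4 * d ^ 2 : ℂ)) ^ (1 / 2 : ℂ)) := by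
    rw [← E, ← Finset.sum_mul]
    push_cast
    field_simp
  have F1 : (1 / (4 * d ^ 2 : ℂ)) ^ (1 / 2 : ℂ) = (((1 / (4 * d ^ 2) : ℝ) ^ (1 / 2 : ℝ) : ℝ) : ℂ) := by
    rw [Complex.ofReal_cpow (by positivity)]
    push_cast; rfl
  have F2 : (-Complex.I / (2 * d)) ^ (1 / 2 : ℂ) =
      (((1 / (2 * d) : ℝ) ^ (1 / 2 : ℝ) : ℝ) : ℂ) * zeta8⁻¹ := by
    have : (-Complex.I / (2 * d) : ℂ) = ((1 / (2 * d) : ℝ) : ℂ) * (-Complex.I) := by push_cast; ring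
    rw [this, ofReal_mul_cpow (by positivity) (by simp), Complex.ofReal_cpow (by positivity)]
    congr 1
    · push_cast; rfl
    · rw [Complex.cpow_def_of_ne_zero (by simp), Complex.log_neg_I, zeta8, ← Complex.exp_neg]
      congr 1
      ring
  have hz : zeta8 ≠ 0 := Complex.exp_ne_zero _
  refine ⟨2 * d * (((1 / (2 * d) : ℝ) ^ (1 / 2 : ℝ))⁻¹ * (1 / (4 * d ^ 2) : ℝ) ^ (1 / 2 : ℝ)), by positivity, ?_⟩
  rw [E2, F1, F2]
  push_cast
  rw [one_div, mul_inv, inv_inv]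
  ring

/-- Two complex numbers are positively proportional. -/
def PosEq (z w : ℂ) : Prop := ∃ r : ℝ, 0 < r ∧ z = r * w

lemma PosEq.refl (z : ℂ) : PosEq z z := ⟨1, one_pos, by simp⟩

lemma PosEq.symm {z w : ℂ} (h : PosEq z w) : PosEq w z := by
  obtain ⟨r, hr, rfl⟩ := h
  refine ⟨r⁻¹, by positivity, ?_⟩
  have : (r : ℂ) ≠ 0 := by exact_mod_cast hr.ne'
  push_cast
  field_simp

lemma PosEq.trans {z w u : ℂ} (h : PosEq z w) (h' : PosEq w u) : PosEq z u := by
  obtain ⟨r, hr, rfl⟩ := h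
  obtain ⟨s, hs, rfl⟩ := h'
  exact ⟨r * s, by positivity, by push_cast; ring⟩

lemma PosEq.mul {z w z' w' : ℂ} (h : PosEq z w) (h' : PosEq z' w') : PosEq (z * z') (w * w') := by
  obtain ⟨r, hr, rfl⟩ := h
  obtain ⟨s, hs, rfl⟩ := h'
  exact ⟨r * s, by positivity, by push_cast; ring⟩

lemma PosEq.prod {ι : Type*} (s : Finset ι) {f g : ι → ℂ} (h : ∀ i ∈ s, PosEq (f i) (g i)) :
    PosEq (∏ i ∈ s, f i) (∏ i ∈ s, g i) := by
  induction s using Finset.induction_on with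
  | empty => exact PosEq.refl _
  | insert a s ha ih =>
    rw [Finset.prod_insert ha, Finset.prod_insert ha]
    exact (h a (Finset.mem_insert_self a s)).mul
      (ih fun i hi => h i (Finset.mem_insert_of_mem hi))

lemma PosEq.of_mul_left {z w c : ℂ} (hc : c ≠ 0) (h : PosEq (c * z) (c * w)) : PosEq z w := by
  obtain ⟨r, hr, h⟩ := h
  exact ⟨r, hr, mul_left_cancel₀ hc (by rw [h]; ring)⟩

lemma posEq_natCast_mul {N : ℕ} (hN : 0 < N) (z : ℂ) : PosEq (N * z) z :=
  ⟨N, by exact_mod_cast hN, by simp⟩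

lemma PosEq.ne_zero {z w : ℂ} (h : PosEq z w) (hw : w ≠ 0) : z ≠ 0 := by
  obtain ⟨r, hr, rfl⟩ := h
  exact mul_ne_zero (by exact_mod_cast hr.ne') hw

lemma sum_eq_sum_filter_trivial {X : Type*} [AddCommGroup X] [Fintype X] (H : AddSubgroup X)
    (Q : X → ℂ) (B : X → AddChar H ℂ) (hQ : ∀ x (h : H), Q (x + h) = Q x * B x h) :
    ∑ x, Q x = ∑ x with B x = 0, Q x := by
  have hH : (Fintype.card H : ℂ) ≠ 0 := by exact_mod_cast Fintype.card_ne_zero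
  apply mul_left_cancel₀ hH
  calc (Fintype.card H : ℂ) * ∑ x, Q x = ∑ h : H, ∑ x, Q (x + h) := by
        have : ∀ h : H, ∑ x, Q (x + h) = ∑ x, Q x := fun h =>
          Equiv.sum_comp (Equiv.addRight (h : X)) Q
        simp [this]
    _ = ∑ x, Q x * ∑ h : H, B x h := by
        rw [Finset.sum_comm]
        simp_rw [hQ, Finset.mul_sum]
    _ = _ := by
        rw [Finset.sum_filter, Finset.mul_sum]
        refine Finset.sum_congr rfl fun x _ => ?_
        rw [AddChar.sum_eq_ite]
        split_ifs <;> ring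

lemma sum_comp_addMonoidHom {A B : Type*} [AddCommGroup A] [AddCommGroup B] [Fintype A] [Fintype B]
    (f : A →+ B) (F : B → ℂ) :
    ∑ a, F (f a) = (Nat.card f.ker : ℂ) * ∑ b with b ∈ f.range, F b := by
  rw [Finset.mul_sum, ← Finset.sum_fiberwise_of_maps_to (s := Finset.univ) (g := f)
    (t := Finset.univ.filter (· ∈ f.range)) (fun a _ => by simp)]
  refine Finset.sum_congr rfl fun b hb => ?_
  obtain ⟨a₀, ha₀⟩ : b ∈ f.range := (Finset.mem_filter.mp hb).2
  rw [Finset.sum_congr rfl (g := fun _ => F b) (fun a ha => by rw [(Finset.mem_filter.mp ha).2]),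
    Finset.sum_const, nsmul_eq_mul]
  congr 2
  rw [Nat.card_eq_fintype_card, ← Finset.card_univ]
  refine Finset.card_bij' (fun a ha => (⟨a - a₀, ?_⟩ : f.ker)) (fun k _ => (k : A) + a₀) ?_ ?_ ?_ ?_
  · rw [AddMonoidHom.mem_ker, map_sub, (Finset.mem_filter.mp ha).2, ha₀, sub_self]
  · intro a ha; exact Finset.mem_univ _
  · intro k hk
    rw [Finset.mem_filter]
    refine ⟨Finset.mem_univ _, ?_⟩
    rw [map_add, AddMonoidHom.mem_ker.mp k.2, zero_add, ha₀]
  · intro a ha; simp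
  · intro k hk; simp

lemma sum_comp_surjective {A B : Type*} [AddCommGroup A] [AddCommGroup B] [Fintype A] [Fintype B]
    (f : A →+ B) (hf : Function.Surjective f) (F : B → ℂ) :
    ∑ a, F (f a) = (Nat.card f.ker : ℂ) * ∑ b, F b := by
  rw [sum_comp_addMonoidHom]
  congr 1
  apply Finset.sum_congr _ fun _ _ => rfl
  rw [Finset.filter_true_of_mem]
  intro b _
  exact hf b

section QuadraticSums

variable {S : Type*} [CommRing S]

/-- The quadratic exponential sum of an additive character. -/
def quadW (ψ : AddChar S ℂ) (c : S) : ℂ := ∑ᶠ y : S, ψ (c * y ^ 2)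

lemma quadW_eq_sum [Fintype S] (ψ : AddChar S ℂ) (c : S) :
    quadW ψ c = ∑ y : S, ψ (c * y ^ 2) := finsum_eq_sum_of_fintype _

variable [Finite S]

lemma quadW_sq_mul (ψ : AddChar S ℂ) (c : S) {s : S} (hs : IsUnit s) :
    quadW ψ (s ^ 2 * c) = quadW ψ c := by
  obtain ⟨u, rfl⟩ := hs
  have := Fintype.ofFinite S
  rw [quadW_eq_sum, quadW_eq_sum]
  rw [← Equiv.sum_comp (Units.mulLeft u) (fun y => ψ (c * y ^ 2))]
  refine Finset.sum_congr rfl fun y _ => ?_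
  simp only [Units.mulLeft_apply]
  congr 1
  ring

lemma sum_mulShift_eq_ite [Fintype S] {ψ : AddChar S ℂ} (hψ : ψ.IsPrimitive) (a : S) :
    ∑ z, ψ (a * z) = if a = 0 then (Fintype.card S : ℂ) else 0 := by
  split_ifs with h
  · simp [h]
  · have := AddChar.sum_eq_zero_of_ne_one (hψ h)
    simpa [AddChar.mulShift_apply] using this

lemma quadW_mul_conj [Fintype S] {ψ : AddChar S ℂ} (hψ : ψ.IsPrimitive) (c : S) :
    quadW ψ c * (starRingEnd ℂ) (quadW ψ c) =
      Fintype.card S * ∑ d with 2 * c * d = 0, ψ (c * d ^ 2) := by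
  have h1 : (starRingEnd ℂ) (quadW ψ c) = ∑ z, ψ (-(c * z ^ 2)) := by
    rw [quadW_eq_sum, map_sum]
    exact Finset.sum_congr rfl fun z _ => (AddChar.map_neg_eq_conj ψ _).symm
  rw [h1, quadW_eq_sum, Finset.sum_mul_sum, Finset.sum_comm]
  have h2 : ∀ z : S, ∑ y, ψ (c * y ^ 2) * ψ (-(c * z ^ 2)) =
      ∑ d, ψ (c * d ^ 2) * ψ (2 * c * d * z) := by
    intro z
    rw [← Equiv.sum_comp (Equiv.addRight z)]
    refine Finset.sum_congr rfl fun d _ => ?_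
    rw [← AddChar.map_add_eq_mul, ← AddChar.map_add_eq_mul, Equiv.coe_addRight]
    congr 1
    ring
  simp_rw [h2]
  rw [Finset.sum_comm, Finset.sum_filter, Finset.mul_sum]
  refine Finset.sum_congr rfl fun d _ => ?_
  rw [← Finset.mul_sum, sum_mulShift_eq_ite hψ]
  split_ifs <;> ring

lemma norm_quadW_sq_le {ψ : AddChar S ℂ} (hψ : ψ.IsPrimitive) {c : S} (hc : IsUnit c) :
    ‖quadW ψ c‖ ^ 2 ≤ Nat.card S * Nat.card {d : S // 2 * d = 0} := by
  have := Fintype.ofFinite S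
  have h := congrArg norm (quadW_mul_conj hψ c)
  rw [norm_mul, RCLike.norm_conj, ← sq, norm_mul, Complex.norm_natCast] at h
  rw [h, Nat.card_eq_fintype_card, Nat.card_eq_fintype_card, Fintype.card_subtype]
  refine mul_le_mul_of_nonneg_left ?_ (Nat.cast_nonneg _)
  refine (norm_sum_le _ _).trans ?_
  have e : (Finset.univ.filter fun d : S => 2 * c * d = 0) =
      Finset.univ.filter fun d : S => 2 * d = 0 := by
    ext d
    simp only [Finset.mem_filter, Finset.mem_univ, true_and]
    rw [mul_comm 2 c, mul_assoc]
    exact hc.mul_right_eq_zero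
  rw [e]
  simp [AddChar.norm_apply]

lemma norm_quadW_sq {ψ : AddChar S ℂ} (hψ : ψ.IsPrimitive) {c : S} (hc : IsUnit c)
    (h2 : ∀ d : S, 2 * d = 0 → d ^ 2 = 0) :
    ‖quadW ψ c‖ ^ 2 = Nat.card S * Nat.card {d : S // 2 * d = 0} := by
  have := Fintype.ofFinite S
  have h := congrArg norm (quadW_mul_conj hψ c)
  rw [norm_mul, RCLike.norm_conj, ← sq, norm_mul, Complex.norm_natCast] at h
  rw [h, Nat.card_eq_fintype_card, Nat.card_eq_fintype_card, Fintype.card_subtype]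
  congr 1
  have e : (Finset.univ.filter fun d : S => 2 * c * d = 0) =
      Finset.univ.filter fun d : S => 2 * d = 0 := by
    ext d
    simp only [Finset.mem_filter, Finset.mem_univ, true_and]
    rw [mul_comm 2 c, mul_assoc]
    exact hc.mul_right_eq_zero
  rw [e, Finset.sum_congr rfl (g := fun _ => (1 : ℂ)) (fun d hd => ?_)]
  · simp
  · rw [h2 d (Finset.mem_filter.mp hd).2, mul_zero, AddChar.map_zero_eq_one]

lemma quadW_ne_zero {ψ : AddChar S ℂ} (hψ : ψ.IsPrimitive) {c : S} (hc : IsUnit c)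
    (h2 : ∀ d : S, 2 * d = 0 → d ^ 2 = 0) : quadW ψ c ≠ 0 := by
  intro h
  have h3 := norm_quadW_sq hψ hc h2
  have : Nonempty {d : S // 2 * d = 0} := ⟨⟨0, mul_zero _⟩⟩
  have h4 : 0 < Nat.card S := Nat.card_pos
  have h5 : 0 < Nat.card {d : S // 2 * d = 0} := Nat.card_pos
  rw [h, norm_zero, zero_pow two_ne_zero] at h3
  have : (0 : ℝ) < Nat.card S * Nat.card {d : S // 2 * d = 0} := by positivity
  linarith

lemma exists_eq_mulShift {ψ : AddChar S ℂ} (hψ : ψ.IsPrimitive) (χ : AddChar S ℂ) :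
    ∃ s, χ = ψ.mulShift s := by
  have := Fintype.ofFinite S
  have hinj := AddChar.to_mulShift_inj_of_isPrimitive hψ
  have := (Fintype.bijective_iff_injective_and_card (AddChar.mulShift ψ)).mpr
    ⟨hinj, (AddChar.card_eq (α := S)).symm⟩
  obtain ⟨s, hs⟩ := this.2 χ
  exact ⟨s, hs.symm⟩

lemma exists_isUnit_eq_mulShift {ψ χ : AddChar S ℂ} (hψ : ψ.IsPrimitive) (hχ : χ.IsPrimitive) :
    ∃ s, IsUnit s ∧ χ = ψ.mulShift s := by
  obtain ⟨s, rfl⟩ := exists_eq_mulShift hψ χ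
  obtain ⟨t, ht⟩ := exists_eq_mulShift hχ ψ
  refine ⟨s, ?_, rfl⟩
  have : ψ.mulShift (s * t) = ψ.mulShift 1 := by
    rw [AddChar.mulShift_one]
    conv_rhs => rw [ht]
    ext x
    simp [AddChar.mulShift_apply, mul_assoc]
  exact IsUnit.of_mul_eq_one t (AddChar.to_mulShift_inj_of_isPrimitive hψ this)

variable {S₁ S₂ : Type*} [CommRing S₁] [Finite S₁] [CommRing S₂] [Finite S₂]

/-- The component of an additive character at the first factor of a product ring. -/
def charFst (e : S ≃+* S₁ × S₂) (ψ : AddChar S ℂ) : AddChar S₁ ℂ :=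
  ψ.compAddMonoidHom (e.symm.toAddEquiv.toAddMonoidHom.comp (AddMonoidHom.inl S₁ S₂))

/-- The component of an additive character at the second factor of a product ring. -/
def charSnd (e : S ≃+* S₁ × S₂) (ψ : AddChar S ℂ) : AddChar S₂ ℂ :=
  ψ.compAddMonoidHom (e.symm.toAddEquiv.toAddMonoidHom.comp (AddMonoidHom.inr S₁ S₂))

lemma charFst_apply (e : S ≃+* S₁ × S₂) (ψ : AddChar S ℂ) (x : S₁) :
    charFst e ψ x = ψ (e.symm (x, 0)) := rfl

lemma charSnd_apply (e : S ≃+* S₁ × S₂) (ψ : AddChar S ℂ) (x : S₂) :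
    charSnd e ψ x = ψ (e.symm (0, x)) := rfl

lemma charFst_mul_charSnd (e : S ≃+* S₁ × S₂) (ψ : AddChar S ℂ) (x : S) :
    ψ x = charFst e ψ (e x).1 * charSnd e ψ (e x).2 := by
  rw [charFst_apply, charSnd_apply, ← AddChar.map_add_eq_mul, ← map_add]
  simp

lemma charFst_isPrimitive (e : S ≃+* S₁ × S₂) {ψ : AddChar S ℂ} (hψ : ψ.IsPrimitive) :
    (charFst e ψ).IsPrimitive := by
  intro a ha h
  refine hψ (a := e.symm (a, 0)) (by simpa using ha) ?_
  ext x
  have := DFunLike.congr_fun h (e x).1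
  rw [AddChar.mulShift_apply, charFst_apply] at this
  rw [AddChar.mulShift_apply]
  have e1 : e.symm (a, 0) * x = e.symm (a * (e x).1, 0) := by
    apply e.injective; ext <;> simp
  rw [e1, this]
  simp

lemma charSnd_isPrimitive (e : S ≃+* S₁ × S₂) {ψ : AddChar S ℂ} (hψ : ψ.IsPrimitive) :
    (charSnd e ψ).IsPrimitive := by
  intro a ha h
  refine hψ (a := e.symm (0, a)) (by simpa using ha) ?_
  ext x
  have := DFunLike.congr_fun h (e x).2
  rw [AddChar.mulShift_apply, charSnd_apply] at this
  rw [AddChar.mulShift_apply]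
  have e1 : e.symm (0, a) * x = e.symm (0, a * (e x).2) := by
    apply e.injective; ext <;> simp
  rw [e1, this]
  simp

lemma quadW_eq_mul (e : S ≃+* S₁ × S₂) (ψ : AddChar S ℂ) (c : S) :
    quadW ψ c = quadW (charFst e ψ) (e c).1 * quadW (charSnd e ψ) (e c).2 := by
  have := Fintype.ofFinite S
  have := Fintype.ofFinite S₁
  have := Fintype.ofFinite S₂
  rw [quadW_eq_sum, quadW_eq_sum, quadW_eq_sum, Finset.sum_mul_sum, ← Fintype.sum_prod_type', ← e.toEquiv.sum_comp]
  refine Finset.sum_congr rfl fun x _ => ?_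
  rw [charFst_mul_charSnd e]
  simp

/-- The additive character of a ring with the given components on a product decomposition. -/
def charPair (e : S ≃+* S₁ × S₂) (χ : AddChar S₁ ℂ) (φ : AddChar S₂ ℂ) : AddChar S ℂ :=
  χ.compAddMonoidHom ((AddMonoidHom.fst S₁ S₂).comp e.toAddEquiv.toAddMonoidHom) *
    φ.compAddMonoidHom ((AddMonoidHom.snd S₁ S₂).comp e.toAddEquiv.toAddMonoidHom)

lemma charPair_apply (e : S ≃+* S₁ × S₂) (χ : AddChar S₁ ℂ) (φ : AddChar S₂ ℂ) (x : S) :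
    charPair e χ φ x = χ (e x).1 * φ (e x).2 := rfl

lemma charFst_charPair (e : S ≃+* S₁ × S₂) (χ : AddChar S₁ ℂ) (φ : AddChar S₂ ℂ) :
    charFst e (charPair e χ φ) = χ := by
  ext x; rw [charFst_apply, charPair_apply]; simp

lemma charSnd_charPair (e : S ≃+* S₁ × S₂) (χ : AddChar S₁ ℂ) (φ : AddChar S₂ ℂ) :
    charSnd e (charPair e χ φ) = φ := by
  ext x; rw [charSnd_apply, charPair_apply]; simp

lemma charPair_isPrimitive (e : S ≃+* S₁ × S₂) {χ : AddChar S₁ ℂ} {φ : AddChar S₂ ℂ}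
    (hχ : χ.IsPrimitive) (hφ : φ.IsPrimitive) : (charPair e χ φ).IsPrimitive := by
  intro a ha h
  have h1 : ∀ x : S, charPair e χ φ (a * x) = 1 := fun x => DFunLike.congr_fun h x
  have ha1 : (e a).1 = 0 := by
    by_contra h0
    refine hχ h0 ?_
    ext x
    have := h1 (e.symm (x, 0))
    rw [charPair_apply] at this
    simpa [AddChar.mulShift_apply] using this
  have ha2 : (e a).2 = 0 := by
    by_contra h0
    refine hφ h0 ?_
    ext x
    have := h1 (e.symm (0, x))
    rw [charPair_apply] at this
    simpa [AddChar.mulShift_apply] using this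
  apply ha
  apply e.injective
  rw [map_zero]
  exact Prod.ext ha1 ha2

end QuadraticSums

lemma trace_pos_of_pos (htot : ∀ φ : K →+* ℂ, ComplexEmbedding.IsReal φ) {x : K}
    (hx : ∀ v : K →+* ℝ, 0 < v x) : 0 < Algebra.trace ℚ K x := by
  have h := trace_eq_sum_embeddings (K := ℚ) (L := K) ℂ (x := x)
  have h2 : ∀ σ : K →ₐ[ℚ] ℂ, σ x = (((htot (σ : K →+* ℂ)).embedding x : ℝ) : ℂ) := fun σ =>
    ((htot (σ : K →+* ℂ)).coe_embedding_apply x).symm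
  rw [Finset.sum_congr rfl fun σ _ => h2 σ, ← Complex.ofReal_sum] at h
  have h3 : ((Algebra.trace ℚ K x : ℚ) : ℝ) =
      ∑ σ : K →ₐ[ℚ] ℂ, (htot (σ : K →+* ℂ)).embedding x := by
    apply Complex.ofReal_injective
    rw [← h]
    simp
  have h4 : (0 : ℝ) < ((Algebra.trace ℚ K x : ℚ) : ℝ) := by
    rw [h3]
    have : Nonempty (K →ₐ[ℚ] ℂ) := ⟨(Classical.arbitrary (K →+* ℂ)).toRatAlgHom⟩
    exact Finset.sum_pos (fun σ _ => hx _) Finset.univ_nonempty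
  exact_mod_cast h4

/-- Membership in the codifferent: `w` pairs integrally with all algebraic integers. -/
def InCodifferent (w : K) : Prop := ∀ z : 𝓞 K, ∃ n : ℤ, Algebra.trace ℚ K (w * z) = n

open nonZeroDivisors in
lemma inCodifferent_iff (w : K) :
    InCodifferent w ↔ w ∈ FractionalIdeal.dual ℤ ℚ (1 : FractionalIdeal (𝓞 K)⁰ K) := by
  rw [FractionalIdeal.mem_dual
    (one_ne_zero : (1 : FractionalIdeal (𝓞 K)⁰ K) ≠ 0)]
  constructor
  · intro h a ha
    obtain ⟨z, rfl⟩ := (FractionalIdeal.mem_one_iff _).mp ha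
    obtain ⟨n, hn⟩ := h z
    refine ⟨n, ?_⟩
    rw [Algebra.traceForm_apply]
    simpa using hn.symm
  · intro h z
    obtain ⟨n, hn⟩ := h (z : K) ((FractionalIdeal.mem_one_iff _).mpr ⟨z, rfl⟩)
    refine ⟨n, ?_⟩
    rw [Algebra.traceForm_apply] at hn
    simpa using hn.symm

open nonZeroDivisors in
lemma exists_integer_of_codifferent {a : K}
    (h : ∀ w : K, InCodifferent w → ∃ n : ℤ, Algebra.trace ℚ K (a * w) = n) :
    ∃ b : 𝓞 K, (b : K) = a := by
  have : a ∈ (1 : FractionalIdeal (𝓞 K)⁰ K) := by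
    rw [← FractionalIdeal.dual_dual ℤ ℚ (1 : FractionalIdeal (𝓞 K)⁰ K), FractionalIdeal.mem_dual
      (FractionalIdeal.dual_ne_zero _ _ (one_ne_zero : (1 : FractionalIdeal (𝓞 K)⁰ K) ≠ 0))]
    intro w hw
    obtain ⟨n, hn⟩ := h w ((inCodifferent_iff w).mpr hw)
    refine ⟨n, ?_⟩
    rw [Algebra.traceForm_apply]
    simpa using hn.symm
  obtain ⟨z, hz⟩ := (FractionalIdeal.mem_one_iff _).mp this
  exact ⟨z, hz⟩

lemma InCodifferent.mul {w : K} (h : InCodifferent w) (z : 𝓞 K) : InCodifferent (w * z) := by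
  intro y
  obtain ⟨n, hn⟩ := h (z * y)
  exact ⟨n, by rw [← hn]; push_cast; ring_nf⟩

/-- The phase `exp (2 π i t)` of a rational number. -/
def ratPhase (t : ℚ) : ℂ := Complex.exp (2 * Real.pi * Complex.I * t)

lemma ratPhase_add (s t : ℚ) : ratPhase (s + t) = ratPhase s * ratPhase t := by
  unfold ratPhase
  rw [← Complex.exp_add]
  congr 1
  push_cast
  ring

lemma ratPhase_eq_one_iff (t : ℚ) : ratPhase t = 1 ↔ ∃ n : ℤ, t = n := by
  unfold ratPhase
  rw [Complex.exp_eq_one_iff]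
  have h : (2 * Real.pi * Complex.I : ℂ) ≠ 0 := by
    simp [Real.pi_ne_zero]
  constructor
  · rintro ⟨n, hn⟩
    refine ⟨n, ?_⟩
    rw [mul_comm] at hn
    have := mul_right_cancel₀ h hn
    exact_mod_cast this
  · rintro ⟨n, rfl⟩
    exact ⟨n, by push_cast; ring⟩

lemma ratPhase_sum {ι : Type*} (s : Finset ι) (f : ι → ℚ) :
    ratPhase (∑ i ∈ s, f i) = ∏ i ∈ s, ratPhase (f i) := by
  induction s using Finset.induction_on with
  | empty => simp [ratPhase]
  | insert a s ha ih => rw [Finset.sum_insert ha, Finset.prod_insert ha, ratPhase_add, ih]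

/-- The additive character `x ↦ exp (2 π i Tr (θ x))` of the ring of integers. -/
def trChar (θ : K) : AddChar (𝓞 K) ℂ where
  toFun x := ratPhase (Algebra.trace ℚ K (θ * x))
  map_zero_eq_one' := by simp [ratPhase]
  map_add_eq_mul' x y := by
    rw [← ratPhase_add, ← map_add]
    push_cast
    ring_nf

lemma trChar_apply (θ : K) (x : 𝓞 K) :
    trChar θ x = ratPhase (Algebra.trace ℚ K (θ * x)) := rfl

lemma trChar_mulShift (θ : K) (c : 𝓞 K) : (trChar θ).mulShift c = trChar (c * θ) := by
  ext x
  rw [AddChar.mulShift_apply, trChar_apply, trChar_apply]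
  push_cast
  ring_nf

section CharIdeal

variable {R : Type*} [CommRing R]

/-- The largest ideal contained in the kernel of an additive character. -/
def charIdeal (f : AddChar R ℂ) : Ideal R where
  carrier := {y | ∀ z, f (y * z) = 1}
  zero_mem' z := by simp
  add_mem' {a b} ha hb z := by rw [add_mul, AddChar.map_add_eq_mul, ha z, hb z, one_mul]
  smul_mem' c x hx z := by
    rw [smul_eq_mul, show c * x * z = x * (c * z) by ring]
    exact hx _

lemma mem_charIdeal {f : AddChar R ℂ} {y : R} : y ∈ charIdeal f ↔ ∀ z, f (y * z) = 1 := Iff.rfl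

lemma eq_one_of_mem_charIdeal {f : AddChar R ℂ} {y : R} (hy : y ∈ charIdeal f) : f y = 1 := by
  simpa using hy 1

/-- The additive character of a quotient ring induced by a character trivial on the ideal. -/
def quotChar (f : AddChar R ℂ) (I : Ideal R) (h : I ≤ charIdeal f) : AddChar (R ⧸ I) ℂ where
  toFun := Quotient.lift f (by
    intro a b hab
    have : a - b ∈ I := (Submodule.quotientRel_def I).mp hab
    rw [← sub_add_cancel a b, AddChar.map_add_eq_mul, eq_one_of_mem_charIdeal (h this), one_mul])
  map_zero_eq_one' := by
    change f 0 = 1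
    simp
  map_add_eq_mul' x y := by
    obtain ⟨x, rfl⟩ := Ideal.Quotient.mk_surjective x
    obtain ⟨y, rfl⟩ := Ideal.Quotient.mk_surjective y
    exact AddChar.map_add_eq_mul f x y

lemma quotChar_mk (f : AddChar R ℂ) (I : Ideal R) (h : I ≤ charIdeal f) (x : R) :
    quotChar f I h (Ideal.Quotient.mk I x) = f x := rfl

lemma quotChar_isPrimitive (f : AddChar R ℂ) (I : Ideal R) (h : I = charIdeal f) :
    (quotChar f I h.le).IsPrimitive := by
  intro a ha h1
  obtain ⟨a, rfl⟩ := Ideal.Quotient.mk_surjective a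
  apply ha
  rw [Ideal.Quotient.eq_zero_iff_mem, h]
  intro z
  have := DFunLike.congr_fun h1 (Ideal.Quotient.mk I z)
  rwa [AddChar.mulShift_apply, ← map_mul, quotChar_mk, AddChar.one_apply] at this

/-- Pull back an additive character along a quotient map. -/
def liftChar {I : Ideal R} (ψ : AddChar (R ⧸ I) ℂ) : AddChar R ℂ :=
  ψ.compAddMonoidHom (Ideal.Quotient.mk I).toAddMonoidHom

lemma liftChar_apply {I : Ideal R} (ψ : AddChar (R ⧸ I) ℂ) (x : R) :
    liftChar ψ x = ψ (Ideal.Quotient.mk I x) := rfl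

lemma le_charIdeal_liftChar {I : Ideal R} (ψ : AddChar (R ⧸ I) ℂ) :
    I ≤ charIdeal (liftChar ψ) := by
  intro x hx z
  rw [liftChar_apply, Ideal.Quotient.eq_zero_iff_mem.mpr (I.mul_mem_right z hx),
    AddChar.map_zero_eq_one]

lemma charIdeal_liftChar {I : Ideal R} {ψ : AddChar (R ⧸ I) ℂ} (hψ : ψ.IsPrimitive) :
    charIdeal (liftChar ψ) = I := by
  refine le_antisymm (fun x hx => ?_) (le_charIdeal_liftChar ψ)
  by_contra hxI
  refine hψ (a := Ideal.Quotient.mk I x) (by rwa [Ne, Ideal.Quotient.eq_zero_iff_mem]) ?_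
  ext y
  obtain ⟨y, rfl⟩ := Ideal.Quotient.mk_surjective y
  rw [AddChar.mulShift_apply, ← map_mul]
  exact hx y

lemma quotChar_liftChar {I : Ideal R} (ψ : AddChar (R ⧸ I) ℂ) :
    quotChar (liftChar ψ) I (le_charIdeal_liftChar ψ) = ψ := by
  ext x
  obtain ⟨x, rfl⟩ := Ideal.Quotient.mk_surjective x
  rfl

lemma mem_charIdeal_mulShift {f : AddChar R ℂ} {c x : R} :
    x ∈ charIdeal (f.mulShift c) ↔ c * x ∈ charIdeal f := by
  simp only [mem_charIdeal, AddChar.mulShift_apply, mul_assoc]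

lemma quadW_quotChar_mulShift (f : AddChar R ℂ) (I J : Ideal R) [Finite (R ⧸ I)] [Finite (R ⧸ J)]
    (hIJ : I ≤ J) (hI : I ≤ charIdeal f) (c : R) (hJ : J ≤ charIdeal (f.mulShift c)) (d : R) :
    ∃ N : ℕ, 0 < N ∧ N * Nat.card (R ⧸ J) = Nat.card (R ⧸ I) ∧
      quadW (quotChar f I hI) (Ideal.Quotient.mk I (c * d)) =
      N * quadW (quotChar (f.mulShift c) J hJ) (Ideal.Quotient.mk J d) := by
  have := Fintype.ofFinite (R ⧸ I)
  have := Fintype.ofFinite (R ⧸ J)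
  set g : R ⧸ I →+ R ⧸ J := (Ideal.Quotient.factor hIJ).toAddMonoidHom with hg
  have hgs : Function.Surjective g := Ideal.Quotient.factor_surjective hIJ
  refine ⟨Nat.card g.ker, Nat.card_pos, ?_, ?_⟩
  · rw [← Nat.card_congr (QuotientAddGroup.quotientKerEquivOfSurjective g hgs).toEquiv, mul_comm]
    exact (AddSubgroup.card_eq_card_quotient_mul_card_addSubgroup _).symm
  rw [quadW_eq_sum, quadW_eq_sum, ← sum_comp_surjective g hgs]
  refine Finset.sum_congr rfl fun y _ => ?_
  obtain ⟨y, rfl⟩ := Ideal.Quotient.mk_surjective y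
  change _ = quotChar (f.mulShift c) J hJ (Ideal.Quotient.mk J d * Ideal.Quotient.mk J y ^ 2)
  rw [← map_pow, ← map_mul, ← map_pow, ← map_mul, quotChar_mk, quotChar_mk,
    AddChar.mulShift_apply, mul_assoc]

end CharIdeal

lemma exists_nat_smul_integer (x : K) : ∃ N : ℤ, N ≠ 0 ∧ ∃ b : 𝓞 K, (b : K) = N * x := by
  have : Algebra.IsAlgebraic ℤ K := (IsFractionRing.comap_isAlgebraic_iff (K := ℚ)).mpr inferInstance
  obtain ⟨N, hN, hbint⟩ := (Algebra.IsAlgebraic.isAlgebraic (R := ℤ) x).exists_integral_multiple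
  exact ⟨N, hN, ⟨N • x, hbint⟩, by simp⟩

lemma exists_orthogonal_family (θ : K) :
    ∃ e g : Fin (Module.finrank ℚ K) → 𝓞 K, (∀ i, (g i : K) = θ * e i) ∧
      (∀ i j, i ≠ j → Algebra.trace ℚ K (g i * e j) = 0) ∧ (∀ i, e i ≠ 0) ∧
      ∀ a : K, ∃ c : Fin (Module.finrank ℚ K) → ℚ, a = ∑ i, (c i : K) * e i := by
  have : Invertible (2 : ℚ) := invertibleOfNonzero two_ne_zero
  obtain ⟨v, hv⟩ := LinearMap.BilinForm.exists_orthogonal_basis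
    (B := (Algebra.traceForm ℚ K).compLeft (LinearMap.mulLeft ℚ θ)) ⟨fun x y => by
      simp [Algebra.traceForm_apply]; ring_nf⟩
  have hN : ∀ i, ∃ N : ℤ, N ≠ 0 ∧ (∃ b : 𝓞 K, (b : K) = N * v i) ∧ ∃ b : 𝓞 K, (b : K) = θ * (N * v i) := by
    intro i
    obtain ⟨N, hN, b, hb⟩ := exists_nat_smul_integer (v i)
    obtain ⟨N', hN', b', hb'⟩ := exists_nat_smul_integer (θ * v i)
    refine ⟨N * N', mul_ne_zero hN hN', ⟨N' * b, ?_⟩, ⟨N * b', ?_⟩⟩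
    · simp only [RingOfIntegers.coe_eq_algebraMap] at hb ⊢
      rw [map_mul, hb, map_intCast]; push_cast; ring
    · simp only [RingOfIntegers.coe_eq_algebraMap] at hb' ⊢
      rw [map_mul, hb', map_intCast]; push_cast; ring
  choose N hN0 he hg using hN
  choose e he using he
  choose g hg using hg
  refine ⟨e, g, fun i => by rw [hg, he], fun i j hij => ?_, fun i h => ?_, fun a => ?_⟩
  · have h : Algebra.trace ℚ K (θ * v i * v j) = 0 := by
      have := hv hij
      exact this
    rw [hg, he]
    have : (θ * (N i * v i) * (N j * v j) : K) = ((N i * N j : ℤ) : ℚ) • (θ * v i * v j) := by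
      rw [Algebra.smul_def, eq_ratCast]; push_cast; ring
    rw [this, map_smul, h, smul_zero]
  · have := he i
    rw [h] at this
    have hvi := v.ne_zero i
    have hNi : (N i : K) ≠ 0 := by exact_mod_cast hN0 i
    simp [hNi, hvi] at this
  · refine ⟨fun i => v.repr a i / N i, ?_⟩
    conv_lhs => rw [← v.sum_repr a]
    refine Finset.sum_congr rfl fun i _ => ?_
    have hNi : (N i : K) ≠ 0 := by exact_mod_cast hN0 i
    rw [he, Algebra.smul_def, eq_ratCast]
    push_cast
    field_simp

lemma sum_zmod_val (N : ℕ) [NeZero N] (f : ℕ → ℂ) : ∑ x : ZMod N, f x.val = ∑ x : Fin N, f x := by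
  cases N with
  | zero => exact absurd rfl (NeZero.ne 0)
  | succ N =>
    exact Finset.sum_congr (Finset.ext fun _ => iff_of_true (Finset.mem_univ _) (Finset.mem_univ _))
      fun _ _ => rfl

open Module in
lemma quadW_trChar (htot : ∀ φ : K →+* ℂ, ComplexEmbedding.IsReal φ) (θ : K)
    (hθ : ∀ v : K →+* ℝ, 0 < v θ)
    (hη : ∀ w : K, InCodifferent w → ∃ b : 𝓞 K, (b : K) = w / (4 * θ))
    [Finite (𝓞 K ⧸ charIdeal (trChar θ))] :
    PosEq (quadW (quotChar (trChar θ) (charIdeal (trChar θ)) le_rfl) 1) (zeta8 ^ finrank ℚ K) := by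
  have hθ0 : θ ≠ 0 := by
    rintro rfl
    have := hθ ((htot (Classical.arbitrary _)).embedding)
    simp at this
  obtain ⟨e, g, hg, horth, he0, hspan⟩ := exists_orthogonal_family θ
  have hd : ∀ i, ∃ d : ℕ, d ≠ 0 ∧ Algebra.trace ℚ K (g i * e i) = d := by
    intro i
    have h1 : 0 < Algebra.trace ℚ K (g i * e i) := by
      refine trace_pos_of_pos htot fun v => ?_
      rw [hg, mul_assoc, ← sq, map_mul, map_pow]
      have : v (e i) ≠ 0 := by
        rw [map_ne_zero]
        simpa using he0 i
      have := hθ v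
      positivity
    have h2 := Algebra.coe_trace_int (K := K) (g i * e i)
    push_cast at h2
    rw [← h2] at h1 ⊢
    have h3 : 0 < Algebra.trace ℤ (𝓞 K) (g i * e i) := by exact_mod_cast h1
    refine ⟨(Algebra.trace ℤ (𝓞 K) (g i * e i)).toNat, by omega, ?_⟩
    have h4 := Int.toNat_of_nonneg h3.le
    rw [← Int.cast_natCast, h4]
  choose d hd0 hd using hd
  have hne : ∀ i, NeZero (2 * d i) := fun i => ⟨by have := hd0 i; omega⟩
  have hdq : ∀ i, (d i : ℚ) ≠ 0 := fun i => by exact_mod_cast hd0 i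
  -- coordinates
  have hco : ∀ a : K, a = ∑ i, ((Algebra.trace ℚ K (g i * a) / d i : ℚ) : K) * e i := by
    intro a
    obtain ⟨c, hc⟩ := hspan a
    have : ∀ i, Algebra.trace ℚ K (g i * a) / d i = c i := by
      intro i
      rw [div_eq_iff (hdq i)]
      conv_lhs => rw [hc]
      rw [Finset.mul_sum, map_sum, Finset.sum_eq_single i]
      · have : (g i * (c i * e i) : K) = c i • (g i * e i : K) := by
          rw [Algebra.smul_def]
          simp only [eq_ratCast]
          ring
        rw [this, map_smul, hd, smul_eq_mul]
      · intro j _ hji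
        have : (g i * (c j * e j) : K) = c j • (g i * e j : K) := by
          rw [Algebra.smul_def]
          simp only [eq_ratCast]
          ring
        rw [this, map_smul, horth i j hji.symm, smul_zero]
      · simp
    simp_rw [this]
    exact hc
  have hbil : ∀ a b : K, Algebra.trace ℚ K (θ * a * b) =
      ∑ i, Algebra.trace ℚ K (g i * a) * Algebra.trace ℚ K (g i * b) / d i := by
    intro a b
    conv_lhs => rw [hco a]
    rw [Finset.mul_sum, Finset.sum_mul, map_sum]
    refine Finset.sum_congr rfl fun i _ => ?_
    have : (θ * (((Algebra.trace ℚ K (g i * a) / d i : ℚ) : K) * e i) * b : K) =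
        (Algebra.trace ℚ K (g i * a) / d i : ℚ) • (g i * b : K) := by
      rw [Algebra.smul_def, hg]
      simp only [eq_ratCast]
      ring
    rw [this, map_smul, smul_eq_mul]
    ring
  let t : Fin (finrank ℚ K) → 𝓞 K →+ ℤ := fun i =>
    (Algebra.trace ℤ (𝓞 K)).toAddMonoidHom.comp (AddMonoidHom.mulLeft (2 * g i))
  have ht : ∀ i (a : 𝓞 K), (t i a : ℚ) = 2 * Algebra.trace ℚ K (g i * a) := by
    intro i a
    have h1 : (t i a : ℚ) = Algebra.trace ℚ K ((2 * g i * a : 𝓞 K) : K) :=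
      Algebra.coe_trace_int (K := K) (2 * g i * a)
    rw [h1]
    have : ((2 * g i * a : 𝓞 K) : K) = (2 : ℚ) • (g i * a : K) := by
      rw [Algebra.smul_def]
      push_cast
      simp only [map_ofNat]
      ring
    rw [this, map_smul, smul_eq_mul]
  let X := (i : Fin (finrank ℚ K)) → ZMod (2 * d i)
  let ρ : 𝓞 K →+ X := AddMonoidHom.pi fun i => (Int.castAddHom (ZMod (2 * d i))).comp (t i)
  have hρ : ∀ a i, ρ a i = ((t i a : ℤ) : ZMod (2 * d i)) := fun a i => rfl
  let q : (i : Fin (finrank ℚ K)) → ZMod (2 * d i) → ℂ := fun i x => gaussPhase (d i) (x.val : ℤ)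
  have hq : ∀ i (x : ℤ), q i (x : ZMod (2 * d i)) = gaussPhase (d i) x := by
    intro i x
    simp only [q]
    rw [ZMod.val_intCast]
    have := Int.emod_add_mul_ediv x ((2 * d i : ℕ) : ℤ)
    conv_rhs => rw [← this]
    push_cast
    rw [gaussPhase_add _ (hd0 i)]
  have hqadd : ∀ i (x h : ZMod (2 * d i)), q i (x + h) = q i x * q i h * ZMod.stdAddChar (x * h) := by
    intro i x h
    obtain ⟨x, rfl⟩ := ZMod.intCast_surjective x
    obtain ⟨h, rfl⟩ := ZMod.intCast_surjective h
    rw [← Int.cast_add, ← Int.cast_mul, hq, hq, hq, ZMod.stdAddChar_coe, gaussPhase, gaussPhase,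
      gaussPhase, ← Complex.exp_add, ← Complex.exp_add]
    congr 1
    have : (d i : ℂ) ≠ 0 := by exact_mod_cast hd0 i
    push_cast
    field_simp
    ring
  let Q : X → ℂ := fun x => ∏ i, q i (x i)
  have hQρ : ∀ a : 𝓞 K, Q (ρ a) = trChar θ (a ^ 2) := by
    intro a
    rw [trChar_apply]
    have h1 : (θ * ((a ^ 2 : 𝓞 K) : K)) = θ * a * a := by push_cast; ring
    rw [h1, hbil, ratPhase_sum]
    refine Finset.prod_congr rfl fun i _ => ?_
    rw [hρ, hq, gaussPhase, ratPhase]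
    congr 2
    have := ht i a
    have h2 : ((t i a : ℤ) : ℂ) = ((2 * Algebra.trace ℚ K (g i * a) : ℚ) : ℂ) := by
      rw [← this]; simp
    rw [h2]
    push_cast
    ring
  let B : X → AddChar X ℂ := fun x =>
    { toFun := fun h => ∏ i, ZMod.stdAddChar (x i * h i)
      map_zero_eq_one' := Finset.prod_eq_one fun i _ => by
        rw [Pi.zero_apply, mul_zero, AddChar.map_zero_eq_one]
      map_add_eq_mul' := fun a b => by
        rw [← Finset.prod_mul_distrib]
        refine Finset.prod_congr rfl fun i _ => ?_
        rw [Pi.add_apply, mul_add, AddChar.map_add_eq_mul] }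
  have hBapp : ∀ x h, B x h = ∏ i, ZMod.stdAddChar (x i * h i) := fun x h => rfl
  -- phase of B against ρ p
  have hBρ : ∀ (x : X) (p : 𝓞 K), B x (ρ p) = ratPhase (Algebra.trace ℚ K
      (2 * θ * (∑ i, (((x i).val / (2 * d i) : ℚ) : K) * e i) * p)) := by
    intro x p
    rw [Finset.mul_sum, Finset.sum_mul, map_sum, ratPhase_sum, hBapp]
    refine Finset.prod_congr rfl fun i _ => ?_
    have h1 : (2 * θ * ((((x i).val / (2 * d i) : ℚ) : K) * e i) * p : K) =
        ((x i).val / d i : ℚ) • (g i * p : K) := by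
      rw [Algebra.smul_def, hg]
      simp only [eq_ratCast]
      push_cast
      have : (d i : K) ≠ 0 := by exact_mod_cast hd0 i
      field_simp
    rw [h1, map_smul, smul_eq_mul]
    have h2 : x i * ρ p i = (((x i).val * t i p : ℤ) : ZMod (2 * d i)) := by
      rw [hρ]; push_cast; simp
    have h3 : ((t i p : ℤ) : ℂ) = ((2 * Algebra.trace ℚ K (g i * p) : ℚ) : ℂ) := by
      rw [← ht]; simp
    rw [h2, ZMod.stdAddChar_coe, ratPhase]
    congr 1
    push_cast
    rw [h3]
    push_cast
    have : (d i : ℂ) ≠ 0 := by exact_mod_cast hd0 i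
    field_simp
  -- the isotropic subgroup
  let P : AddSubgroup (𝓞 K) :=
    { carrier := {p | InCodifferent (2 * θ * p)}
      zero_mem' := fun z => ⟨0, by simp⟩
      add_mem' := fun {a b} ha hb z => by
        obtain ⟨k, hk⟩ := ha z
        obtain ⟨l, hl⟩ := hb z
        refine ⟨k + l, ?_⟩
        push_cast
        rw [← hk, ← hl, ← map_add (Algebra.trace ℚ K)]
        simp only [RingOfIntegers.coe_eq_algebraMap]
        congr 1
        ring
      neg_mem' := fun {a} ha z => by
        obtain ⟨k, hk⟩ := ha z
        refine ⟨-k, ?_⟩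
        push_cast
        rw [← hk, ← map_neg (Algebra.trace ℚ K)]
        simp only [RingOfIntegers.coe_eq_algebraMap]
        congr 1
        ring }
  have hPQ : ∀ p ∈ P, Q (ρ p) = 1 := by
    intro p hp
    rw [hQρ, trChar_apply, ratPhase_eq_one_iff]
    obtain ⟨b, hb⟩ := hη _ hp
    obtain ⟨k, hk⟩ := hp b
    refine ⟨k, ?_⟩
    rw [← hk, hb]
    congr 1
    push_cast
    field_simp
    ring
  have hc2 : ∀ b : 𝓞 K, ((2 * b : 𝓞 K) : K) = 2 * b := fun b => by
    simp only [RingOfIntegers.coe_eq_algebraMap, map_mul, map_ofNat]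
  let H : AddSubgroup X := P.map ρ
  have hA := sum_eq_sum_filter_trivial H Q (fun x => (B x).compAddMonoidHom H.subtype) (by
    rintro x ⟨h, p, hp, rfl⟩
    have h1 : Q (ρ p) = 1 := hPQ p hp
    change ∏ i, q i (x i + ρ p i) = (∏ i, q i (x i)) * ∏ i, ZMod.stdAddChar (x i * ρ p i)
    simp_rw [hqadd]
    rw [Finset.prod_mul_distrib, Finset.prod_mul_distrib]
    change _ * Q (ρ p) * _ = _
    rw [h1, mul_one])
  have hrange : (Finset.univ.filter fun x => (B x).compAddMonoidHom H.subtype = 0) =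
      Finset.univ.filter (· ∈ ρ.range) := by
    ext x
    simp only [Finset.mem_filter, Finset.mem_univ, true_and]
    constructor
    · intro h
      set v : K := ∑ i, (((x i).val / (2 * d i) : ℚ) : K) * e i with hv
      obtain ⟨a, ha⟩ := exists_integer_of_codifferent (a := v) (fun w hw => by
        obtain ⟨b, hb⟩ := hη w hw
        have hp : InCodifferent (2 * θ * ((2 * b : 𝓞 K) : K)) := by
          have : (2 * θ * ((2 * b : 𝓞 K) : K)) = w := by
            rw [hc2, hb]; field_simp; ring
          rwa [this]
        have h1 := DFunLike.congr_fun h ⟨ρ (2 * b), 2 * b, hp, rfl⟩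
        change B x (ρ (2 * b)) = 1 at h1
        rw [hBρ, ratPhase_eq_one_iff] at h1
        obtain ⟨k, hk⟩ := h1
        refine ⟨k, ?_⟩
        rw [← hk]
        congr 1
        rw [hc2, hb]
        field_simp
        ring)
      refine ⟨a, ?_⟩
      ext i
      rw [hρ]
      have h2 : (t i a : ℚ) = (x i).val := by
        rw [ht, ha, hv, Finset.mul_sum, map_sum, Finset.sum_eq_single i]
        · have : (g i * ((((x i).val / (2 * d i) : ℚ) : K) * e i) : K) =
              ((x i).val / (2 * d i) : ℚ) • (g i * e i : K) := by
            rw [Algebra.smul_def]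
            simp only [eq_ratCast]
            ring
          rw [this, map_smul, hd, smul_eq_mul]
          have := hdq i
          field_simp
        · intro j _ hji
          have : (g i * ((((x j).val / (2 * d j) : ℚ) : K) * e j) : K) =
              ((x j).val / (2 * d j) : ℚ) • (g i * e j : K) := by
            rw [Algebra.smul_def]
            simp only [eq_ratCast]
            ring
          rw [this, map_smul, horth i j hji.symm, smul_zero]
        · simp
      have h3 : t i a = (x i).val := by exact_mod_cast h2
      rw [h3]
      simp
    · rintro ⟨a, rfl⟩
      ext ⟨h, p, hp, rfl⟩
      change B (ρ a) (ρ p) = 1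
      have h1 : B (ρ a) (ρ p) = Q (ρ (a + p)) / (Q (ρ a) * Q (ρ p)) := by
        have hne : ∀ x, Q x ≠ 0 := fun x =>
          Finset.prod_ne_zero_iff.mpr fun i _ => Complex.exp_ne_zero _
        rw [eq_div_iff (mul_ne_zero (hne _) (hne _)), map_add]
        change _ = ∏ i, q i (ρ a i + ρ p i)
        simp_rw [hqadd]
        rw [Finset.prod_mul_distrib, Finset.prod_mul_distrib, hBapp]
        ring
      rw [h1, hPQ p hp, mul_one, hQρ, hQρ]
      have h2 : trChar θ ((a + p) ^ 2) = trChar θ (a ^ 2) * trChar θ (2 * a * p) * trChar θ (p ^ 2) := by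
        rw [← AddChar.map_add_eq_mul, ← AddChar.map_add_eq_mul]
        congr 1; ring
      have h3 : trChar θ (2 * a * p) = 1 := by
        rw [trChar_apply, ratPhase_eq_one_iff]
        obtain ⟨k, hk⟩ := hp a
        refine ⟨k, ?_⟩
        rw [← hk]
        congr 1
        simp only [RingOfIntegers.coe_eq_algebraMap, map_mul, map_ofNat]
        ring
      rw [h2, h3, ← hQρ p, hPQ p hp, mul_one, mul_one]
      refine div_self ?_
      rw [trChar_apply]
      exact Complex.exp_ne_zero _
  rw [hrange] at hA
  -- fibre over the quotient
  set I := charIdeal (trChar θ) with hI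
  have := Fintype.ofFinite (𝓞 K ⧸ I)
  have hker : ρ.rangeRestrict.ker ≤ (Ideal.Quotient.mk I).toAddMonoidHom.ker := by
    intro a ha
    rw [AddMonoidHom.ker_rangeRestrict, AddMonoidHom.mem_ker] at ha
    rw [AddMonoidHom.mem_ker]
    change Ideal.Quotient.mk I a = 0
    rw [Ideal.Quotient.eq_zero_iff_mem]
    intro z
    rw [trChar_apply, ratPhase_eq_one_iff]
    have h1 : ∀ i, ∃ k : ℤ, Algebra.trace ℚ K (g i * a) / d i = k := by
      intro i
      have := congrFun ha i
      rw [hρ, Pi.zero_apply, ZMod.intCast_zmod_eq_zero_iff_dvd] at this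
      obtain ⟨k, hk⟩ := this
      refine ⟨k, ?_⟩
      have h2 := ht i a
      rw [hk] at h2
      push_cast at h2
      rw [div_eq_iff (hdq i)]
      linarith
    choose k hk using h1
    have h2 : (θ * ((a * z : 𝓞 K) : K)) = ((∑ i, k i * g i * z : 𝓞 K) : K) := by
      simp only [map_mul, map_sum, map_intCast]
      simp only [← RingOfIntegers.coe_eq_algebraMap]
      conv_lhs => rw [hco a]
      rw [Finset.sum_mul, Finset.mul_sum]
      refine Finset.sum_congr rfl fun i _ => ?_
      rw [hk, hg]
      push_cast
      ring
    rw [h2, ← Algebra.coe_trace_int]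
    exact ⟨_, rfl⟩
  let φ := AddMonoidHom.liftOfRightInverse ρ.rangeRestrict _
    (Function.rightInverse_surjInv ρ.rangeRestrict_surjective) ⟨_, hker⟩
  have hφ : ∀ a, φ (ρ.rangeRestrict a) = Ideal.Quotient.mk I a := fun a =>
    AddMonoidHom.liftOfRightInverse_comp_apply _ _ _ _ a
  have hφs : Function.Surjective φ := by
    intro y
    obtain ⟨a, rfl⟩ := Ideal.Quotient.mk_surjective y
    exact ⟨_, hφ a⟩
  have hF := sum_comp_surjective φ hφs (fun y => quotChar (trChar θ) I le_rfl (1 * y ^ 2))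
  rw [← quadW_eq_sum] at hF
  have hF2 : ∑ a, quotChar (trChar θ) I le_rfl (1 * (φ a) ^ 2) = ∑ x with x ∈ ρ.range, Q x := by
    rw [Finset.sum_subtype (p := fun x => x ∈ ρ.range) (Finset.univ.filter (· ∈ ρ.range))
      (fun x => by simp) Q]
    refine Finset.sum_congr rfl fun x _ => ?_
    obtain ⟨a, rfl⟩ := ρ.rangeRestrict_surjective x
    rw [hφ, one_mul, ← map_pow, quotChar_mk]
    exact (hQρ a).symm
  have hprod : ∑ x, Q x = ∏ i, ∑ x, q i x := by
    rw [Finset.prod_univ_sum, Fintype.piFinset_univ]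
  have hgauss : ∀ i, PosEq (∑ x, q i x) zeta8 := by
    intro i
    obtain ⟨r, hr, h⟩ := sum_gaussPhase (d i) (hd0 i)
    refine ⟨r, hr, ?_⟩
    rw [← h]
    exact sum_zmod_val _ fun x => gaussPhase (d i) x
  have htotal : PosEq (∑ x, Q x) (zeta8 ^ finrank ℚ K) := by
    rw [hprod]
    have := PosEq.prod Finset.univ (f := fun i => ∑ x, q i x) (g := fun _ => zeta8)
      fun i _ => hgauss i
    simpa using this
  have hpos : PosEq (∑ a, quotChar (trChar θ) I le_rfl (1 * (φ a) ^ 2))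
      (quadW (quotChar (trChar θ) I le_rfl) 1) := by
    rw [hF]
    exact posEq_natCast_mul Nat.card_pos _
  rw [hF2, ← hA] at hpos
  exact hpos.symm.trans htotal

lemma quadSym_mul_left {𝔞 𝔟 : Ideal (𝓞 K)} (ha : 𝔞 ≠ ⊥) (hb : 𝔟 ≠ ⊥) (c : 𝓞 K) :
    quadSym (𝔞 * 𝔟) c = quadSym 𝔞 c * quadSym 𝔟 c := by
  rw [quadSym, UniqueFactorizationMonoid.normalizedFactors_mul ha hb, Multiset.map_add,
    Multiset.prod_add]
  rfl

lemma quadSym_one (c : 𝓞 K) : quadSym (1 : Ideal (𝓞 K)) c = 1 := by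
  rw [quadSym, UniqueFactorizationMonoid.normalizedFactors_one, Multiset.map_zero, Multiset.prod_zero]

lemma quadSym_of_prime {𝔭 : Ideal (𝓞 K)} (hp : Prime 𝔭) (c : 𝓞 K) : quadSym 𝔭 c = legSym 𝔭 c := by
  rw [quadSym, UniqueFactorizationMonoid.normalizedFactors_irreducible hp.irreducible,
    Multiset.map_singleton, Multiset.prod_singleton, normalize_eq]

lemma legSym_mul {𝔭 : Ideal (𝓞 K)} (hp : Prime 𝔭) (a b : 𝓞 K) :
    legSym 𝔭 (a * b) = legSym 𝔭 a * legSym 𝔭 b := by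
  have hprime := Ideal.isPrime_of_prime hp
  have hmax : 𝔭.IsMaximal := hprime.isMaximal hp.ne_zero
  let _ := Ideal.Quotient.field 𝔭
  have := Ideal.finiteQuotientOfFreeOfNeBot 𝔭 hp.ne_zero
  have := Fintype.ofFinite (𝓞 K ⧸ 𝔭)
  have h : ∀ c, legSym 𝔭 c = quadraticChar (𝓞 K ⧸ 𝔭) (Ideal.Quotient.mk 𝔭 c) := fun c => by
    rw [quadraticChar_apply, legSym, quadraticCharFun]
    congr
  rw [h, h, h, map_mul, map_mul]

lemma quadSym_mul_right {𝔞 : Ideal (𝓞 K)} (a b : 𝓞 K) :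
    quadSym 𝔞 (a * b) = quadSym 𝔞 a * quadSym 𝔞 b := by
  rw [quadSym, quadSym, quadSym, ← Multiset.prod_map_mul]
  congr 1
  refine Multiset.map_congr rfl fun 𝔭 h𝔭 => ?_
  exact legSym_mul (UniqueFactorizationMonoid.prime_of_normalized_factor 𝔭 h𝔭) a b

lemma ideal_coprime_iff_forall_prime {𝔞 𝔟 : Ideal (𝓞 K)} :
    IsCoprime 𝔞 𝔟 ↔ ∀ 𝔭 : Ideal (𝓞 K), 𝔭.IsPrime → 𝔞 ≤ 𝔭 → ¬ 𝔟 ≤ 𝔭 := by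
  rw [Ideal.isCoprime_iff_sup_eq]
  constructor
  · intro h 𝔭 hp ha hb
    exact hp.ne_top (top_le_iff.mp (h ▸ sup_le ha hb))
  · intro h
    by_contra hne
    obtain ⟨M, hM, hle⟩ := Ideal.exists_le_maximal _ hne
    exact h M hM.isPrime (le_sup_left.trans hle) (le_sup_right.trans hle)

lemma legSym_sq_of_notMem {𝔭 : Ideal (𝓞 K)} {c : 𝓞 K} (hc : c ∉ 𝔭) : legSym 𝔭 c * legSym 𝔭 c = 1 := by
  have : Ideal.Quotient.mk 𝔭 c ≠ 0 := by rwa [Ne, Ideal.Quotient.eq_zero_iff_mem]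
  rw [legSym, if_neg this]
  split_ifs <;> rfl

lemma quadW_field {F : Type*} [Field F] [Finite F] (h2 : (2 : F) ≠ 0) {ψ : AddChar F ℂ}
    (hψ : ψ.IsPrimitive) {c : F} (hc : c ≠ 0) :
    quadW ψ c = (if IsSquare c then 1 else -1) * quadW ψ 1 := by
  have := Fintype.ofFinite F
  have hchar : ringChar F ≠ 2 := by
    intro h
    have := ringChar.Nat.cast_ringChar (R := F)
    rw [h] at this
    exact h2 (by exact_mod_cast this)
  have key : ∀ c : F, c ≠ 0 → quadW ψ c = ∑ t, (quadraticChar F t : ℂ) * ψ (c * t) := by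
    intro c hc
    have h1 : ∑ y : F, ψ (c * y ^ 2) = ∑ t : F, (((quadraticChar F t + 1 : ℤ)) : ℂ) * ψ (c * t) := by
      rw [← Finset.sum_fiberwise (s := Finset.univ) (g := fun y : F => y ^ 2)]
      refine Finset.sum_congr rfl fun t _ => ?_
      rw [← quadraticChar_card_sqrts hchar t]
      rw [Finset.sum_congr rfl (g := fun _ => ψ (c * t))]
      · rw [Finset.sum_const, nsmul_eq_mul]
        congr 2
        congr 1
        ext y
        simp
      · intro y hy
        rw [(Finset.mem_filter.mp hy).2]
    have h2 : ∑ t : F, ψ (c * t) = 0 := by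
      have := AddChar.sum_eq_zero_of_ne_one (hψ hc)
      simpa [AddChar.mulShift_apply] using this
    rw [quadW_eq_sum, h1]
    push_cast
    simp_rw [add_mul, one_mul]
    rw [Finset.sum_add_distrib, h2, add_zero]
  rw [key c hc, key 1 one_ne_zero]
  have hsq : (quadraticChar F c : ℂ) = if IsSquare c then 1 else -1 := by
    rw [quadraticChar_apply, quadraticCharFun, if_neg hc]
    split_ifs <;> simp
  have hcc : (quadraticChar F c : ℂ) * quadraticChar F c = 1 := by
    rw [hsq]; split_ifs <;> simp
  trans (quadraticChar F c : ℂ) * ∑ t, (quadraticChar F t : ℂ) * ψ (1 * t)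
  swap
  · rw [hsq]
    congr
  rw [Finset.mul_sum, ← Equiv.sum_comp (Equiv.mulLeft₀ c hc) (fun t => _ * (_ * _))]
  refine Finset.sum_congr rfl fun t _ => ?_
  change (quadraticChar F t : ℂ) * ψ (c * t) =
    quadraticChar F c * (quadraticChar F (c * t) * ψ (1 * (c * t)))
  rw [one_mul, map_mul (quadraticChar F), Int.cast_mul, ← mul_assoc, ← mul_assoc, hcc, one_mul]

/-- Completing the square along an isotropic ideal `H` whose annihilator is generated by `ϖ`. -/
lemma card_mul_quadW {S : Type*} [CommRing S] [Finite S] {ψ : AddChar S ℂ} (hψ : ψ.IsPrimitive)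
    (H : Ideal S) (hH : ∀ h ∈ H, h ^ 2 = 0) (ϖ c : S)
    (hann : ∀ x, (∀ h ∈ H, 2 * c * x * h = 0) ↔ x ∈ Ideal.span {ϖ}) :
    (Nat.card (AddMonoidHom.mulLeft ϖ).ker : ℂ) * quadW ψ c = quadW ψ (c * ϖ ^ 2) := by
  have := Fintype.ofFinite S
  have h1 := sum_eq_sum_filter_trivial H.toAddSubgroup (fun x => ψ (c * x ^ 2))
    (fun x => (ψ.mulShift (2 * c * x)).compAddMonoidHom H.toAddSubgroup.subtype) (by
      rintro x ⟨h, hh⟩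
      change ψ (c * (x + h) ^ 2) = ψ (c * x ^ 2) * ψ (2 * c * x * h)
      rw [← AddChar.map_add_eq_mul]
      congr 1
      linear_combination c * hH h hh)
  have h2 := sum_comp_addMonoidHom (AddMonoidHom.mulLeft ϖ) (fun x => ψ (c * x ^ 2))
  rw [quadW_eq_sum, quadW_eq_sum, h1]
  have h3 : ∑ y, ψ (c * ϖ ^ 2 * y ^ 2) = ∑ y, ψ (c * (AddMonoidHom.mulLeft ϖ y) ^ 2) := by
    refine Finset.sum_congr rfl fun y _ => ?_
    rw [AddMonoidHom.coe_mulLeft]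
    congr 1
    ring
  rw [h3, h2]
  congr 1
  refine Finset.sum_congr ?_ fun _ _ => rfl
  ext x
  simp only [Finset.mem_filter, Finset.mem_univ, true_and]
  have h4 : x ∈ (AddMonoidHom.mulLeft ϖ).range ↔ x ∈ Ideal.span {ϖ} := by
    rw [Ideal.mem_span_singleton', AddMonoidHom.mem_range]
    simp only [AddMonoidHom.coe_mulLeft, mul_comm ϖ]
  rw [h4, ← hann]
  constructor
  · intro h y hy
    by_contra hne
    refine hψ hne ?_
    ext z
    have := DFunLike.congr_fun h ⟨y * z, H.mul_mem_right z hy⟩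
    change ψ (2 * c * x * (y * z)) = 1 at this
    rw [AddChar.mulShift_apply, mul_assoc, this, AddChar.one_apply]
  · intro h
    ext ⟨y, hy⟩
    change ψ (2 * c * x * y) = 1
    rw [h y hy, AddChar.map_zero_eq_one]

lemma quadW_sq_prime_mul {𝔭 𝔫 : Ideal (𝓞 K)} (hp : Prime 𝔭) (hn : 𝔫 ≠ ⊥)
    (ψ : AddChar (𝓞 K ⧸ 𝔭 ^ 2 * 𝔫) ℂ) (hψ : ψ.IsPrimitive) (h2 : (2 : 𝓞 K) ∉ 𝔭) :
    ∃ ψ' : AddChar (𝓞 K ⧸ 𝔫) ℂ, ψ'.IsPrimitive ∧ ∃ r : ℂ, r ≠ 0 ∧ ∀ c ∉ 𝔭,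
      quadW ψ (Ideal.Quotient.mk _ c) = r * quadW ψ' (Ideal.Quotient.mk _ c) := by
  have hprime := Ideal.isPrime_of_prime hp
  have hp0 : 𝔭 ≠ 0 := hp.ne_zero
  have hn0 : 𝔫 ≠ 0 := hn
  have hm0 : 𝔭 ^ 2 * 𝔫 ≠ 0 := mul_ne_zero (pow_ne_zero _ hp0) hn0
  have := Ideal.finiteQuotientOfFreeOfNeBot 𝔫 hn
  have := Ideal.finiteQuotientOfFreeOfNeBot _ hm0
  obtain ⟨ϖ, hϖ⟩ := IsDedekindDomain.exists_sup_span_eq (I := 𝔭 ^ 2 * 𝔫) (J := 𝔭)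
    (Ideal.mul_le_left.trans (Ideal.pow_le_self two_ne_zero)) hm0
  obtain ⟨𝔲, h𝔲⟩ : 𝔭 ∣ Ideal.span {ϖ} := Ideal.dvd_iff_le.mpr (hϖ ▸ le_sup_right)
  have hcop : IsCoprime 𝔲 (𝔭 * 𝔫) := by
    rw [Ideal.isCoprime_iff_sup_eq]
    have : 𝔭 * (𝔲 ⊔ 𝔭 * 𝔫) = 𝔭 * ⊤ := by
      rw [Ideal.mul_sup, ← h𝔲, Ideal.mul_top, ← mul_assoc, ← sq, sup_comm, hϖ]
    exact mul_left_cancel₀ hp0 this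
  have hJ : charIdeal ((liftChar ψ).mulShift (ϖ ^ 2)) = 𝔫 := by
    ext x
    rw [mem_charIdeal_mulShift, charIdeal_liftChar hψ, ← Ideal.span_singleton_le_iff_mem,
      ← Ideal.span_singleton_mul_span_singleton, ← Ideal.span_singleton_pow, h𝔲,
      ← Ideal.dvd_iff_le, mul_pow, mul_assoc, mul_dvd_mul_iff_left (pow_ne_zero _ hp0),
      ← Ideal.span_singleton_le_iff_mem (I := 𝔫), ← Ideal.dvd_iff_le]
    exact ⟨((hcop.of_mul_right_right).pow_left (m := 2)).symm.dvd_of_dvd_mul_left,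
      fun h => h.mul_left _⟩
  refine ⟨quotChar ((liftChar ψ).mulShift (ϖ ^ 2)) 𝔫 hJ.ge, quotChar_isPrimitive _ _ hJ.symm, ?_⟩
  let mk := Ideal.Quotient.mk (𝔭 ^ 2 * 𝔫)
  have hker : (Nat.card (AddMonoidHom.mulLeft (mk ϖ)).ker : ℂ) ≠ 0 := by
    exact_mod_cast Nat.card_pos.ne'
  have hcard : (Nat.card (𝓞 K ⧸ 𝔫) : ℂ) ≠ 0 := by exact_mod_cast Nat.card_pos.ne'
  have hcard' : (Nat.card (𝓞 K ⧸ 𝔭 ^ 2 * 𝔫) : ℂ) ≠ 0 := by exact_mod_cast Nat.card_pos.ne'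
  refine ⟨(Nat.card (AddMonoidHom.mulLeft (mk ϖ)).ker : ℂ)⁻¹ *
    (Nat.card (𝓞 K ⧸ 𝔭 ^ 2 * 𝔫) / Nat.card (𝓞 K ⧸ 𝔫)), by positivity, fun c hc => ?_⟩
  obtain ⟨N, hN, hNc, hW⟩ := quadW_quotChar_mulShift (liftChar ψ) (𝔭 ^ 2 * 𝔫) 𝔫 Ideal.mul_le_right
    (le_charIdeal_liftChar ψ) (ϖ ^ 2) hJ.ge c
  rw [quotChar_liftChar] at hW
  have h1 := card_mul_quadW hψ (Ideal.map mk (𝔭 * 𝔫)) ?_ (mk ϖ) (mk c) ?_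
  · rw [← map_pow, ← map_mul, mul_comm c, hW] at h1
    have : (N : ℂ) = Nat.card (𝓞 K ⧸ 𝔭 ^ 2 * 𝔫) / Nat.card (𝓞 K ⧸ 𝔫) := by
      rw [eq_div_iff hcard]
      exact_mod_cast hNc
    rw [← this, mul_assoc, ← h1, inv_mul_cancel_left₀ hker]
  · intro h hh
    rw [Ideal.mem_map_iff_of_surjective _ Ideal.Quotient.mk_surjective] at hh
    obtain ⟨y, hy, rfl⟩ := hh
    rw [← map_pow, Ideal.Quotient.eq_zero_iff_mem]
    have := Ideal.pow_mem_pow hy 2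
    rw [mul_pow, sq 𝔫, ← mul_assoc] at this
    exact Ideal.mul_le_left this
  · intro x
    obtain ⟨x, rfl⟩ := Ideal.Quotient.mk_surjective x
    have hx : mk x ∈ Ideal.span {mk ϖ} ↔ x ∈ 𝔭 := by
      rw [← Set.image_singleton, ← Ideal.map_span, Ideal.mem_quotient_iff_mem_sup, sup_comm, hϖ]
    rw [hx]
    constructor
    · intro h
      have hle : Ideal.span {2 * c * x} * (𝔭 * 𝔫) ≤ 𝔭 ^ 2 * 𝔫 := by
        rw [Ideal.span_singleton_mul_le_iff]
        intro y hy
        have := h (mk y) (Ideal.mem_map_of_mem _ hy)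
        rw [← Ideal.Quotient.eq_zero_iff_mem]
        exact_mod_cast this
      rw [← Ideal.dvd_iff_le, sq, mul_assoc, mul_dvd_mul_iff_right (mul_ne_zero hp0 hn0),
        Ideal.dvd_iff_le, Ideal.span_singleton_le_iff_mem] at hle
      rcases hprime.mem_or_mem hle with h | h
      · rcases hprime.mem_or_mem h with h | h
        · exact absurd h h2
        · exact absurd h hc
      · exact h
    · intro hx h hh
      rw [Ideal.mem_map_iff_of_surjective _ Ideal.Quotient.mk_surjective] at hh
      obtain ⟨y, hy, rfl⟩ := hh
      have h3 : x * y ∈ 𝔭 ^ 2 * 𝔫 := by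
        rw [sq, mul_assoc]
        exact Ideal.mul_mem_mul hx hy
      have h4 : 2 * c * x * y ∈ 𝔭 ^ 2 * 𝔫 := by
        rw [mul_assoc]; exact Ideal.mul_mem_left _ _ h3
      rw [← Ideal.Quotient.eq_zero_iff_mem] at h4
      exact_mod_cast h4

lemma quadW_crt {I J : Ideal (𝓞 K)} (hI : I ≠ ⊥) (hJ : J ≠ ⊥) (h : IsCoprime I J)
    (ψ : AddChar (𝓞 K ⧸ I * J) ℂ) (hψ : ψ.IsPrimitive) :
    ∃ ψ₁ : AddChar (𝓞 K ⧸ I) ℂ, ψ₁.IsPrimitive ∧ ∃ ψ₂ : AddChar (𝓞 K ⧸ J) ℂ, ψ₂.IsPrimitive ∧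
      (∀ x ∈ J, ψ₁ (Ideal.Quotient.mk _ x) = ψ (Ideal.Quotient.mk _ x)) ∧
      ∀ c, quadW ψ (Ideal.Quotient.mk _ c) =
        quadW ψ₁ (Ideal.Quotient.mk _ c) * quadW ψ₂ (Ideal.Quotient.mk _ c) := by
  have := Ideal.finiteQuotientOfFreeOfNeBot _ hI
  have := Ideal.finiteQuotientOfFreeOfNeBot _ hJ
  have := Ideal.finiteQuotientOfFreeOfNeBot (I * J) (mul_ne_zero hI hJ)
  let e := Ideal.quotientMulEquivQuotientProd I J h
  refine ⟨charFst e ψ, charFst_isPrimitive e hψ, charSnd e ψ, charSnd_isPrimitive e hψ,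
    fun x hx => ?_, fun c => ?_⟩
  · rw [charFst_apply]
    congr 1
    rw [RingEquiv.symm_apply_eq]
    refine Prod.ext ?_ ?_
    · rw [Ideal.quotientMulEquivQuotientProd_fst, Ideal.Quotient.factor_mk]
    · rw [Ideal.quotientMulEquivQuotientProd_snd, Ideal.Quotient.factor_mk]
      exact (Ideal.Quotient.eq_zero_iff_mem.mpr hx).symm
  rw [quadW_eq_mul e, Ideal.quotientMulEquivQuotientProd_fst,
    Ideal.quotientMulEquivQuotientProd_snd, Ideal.Quotient.factor_mk, Ideal.Quotient.factor_mk]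

lemma quadW_odd {𝔪 : Ideal (𝓞 K)} (h0 : 𝔪 ≠ ⊥) (hodd : OddIdeal 𝔪) (ψ : AddChar (𝓞 K ⧸ 𝔪) ℂ)
    (hψ : ψ.IsPrimitive) {c : 𝓞 K} (hc : IsCoprime (Ideal.span {c}) 𝔪) :
    quadW ψ (Ideal.Quotient.mk 𝔪 c) = quadSym 𝔪 c * quadW ψ 1 := by
  induction h : Ideal.absNorm 𝔪 using Nat.strong_induction_on generalizing 𝔪 with
  | _ N ih =>
  subst h
  by_cases hu : IsUnit 𝔪
  · rw [Ideal.isUnit_iff] at hu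
    subst hu
    have : quadSym (⊤ : Ideal (𝓞 K)) c = 1 := by rw [← Ideal.one_eq_top, quadSym_one]
    rw [this, Int.cast_one, one_mul]
    congr 1
    exact (Ideal.Quotient.eq).mpr (by simp)
  obtain ⟨𝔭, hirr, 𝔫, rfl⟩ := WfDvdMonoid.exists_irreducible_factor hu h0
  have hp : Prime 𝔭 := hirr.prime
  have hp0 : 𝔭 ≠ 0 := hp.ne_zero
  have hprime := Ideal.isPrime_of_prime hp
  have hn0 : 𝔫 ≠ 0 := right_ne_zero_of_mul h0
  have hmax : 𝔭.IsMaximal := hprime.isMaximal hp.ne_zero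
  have h2 : (2 : 𝓞 K) ∉ 𝔭 := fun h => by
    refine ideal_coprime_iff_forall_prime.mp hodd 𝔭 hprime Ideal.mul_le_left ?_
    rwa [Ideal.span_singleton_le_iff_mem]
  have hcp : c ∉ 𝔭 := fun h => by
    refine ideal_coprime_iff_forall_prime.mp hc 𝔭 hprime ?_ Ideal.mul_le_left
    rwa [Ideal.span_singleton_le_iff_mem]
  have hnorm : 1 < Ideal.absNorm 𝔭 := by
    have h1 : Ideal.absNorm 𝔭 ≠ 0 := by rwa [Ne, Ideal.absNorm_eq_zero_iff]
    have h2 : Ideal.absNorm 𝔭 ≠ 1 := by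
      rw [Ne, Ideal.absNorm_eq_one_iff]
      exact hprime.ne_top
    omega
  by_cases hdvd : 𝔭 ∣ 𝔫
  · obtain ⟨𝔫, rfl⟩ := hdvd
    have hn0' : 𝔫 ≠ 0 := right_ne_zero_of_mul hn0
    have hlt : Ideal.absNorm 𝔫 < Ideal.absNorm (𝔭 * (𝔭 * 𝔫)) := by
      rw [map_mul, map_mul]
      have : 0 < Ideal.absNorm 𝔫 := Nat.pos_of_ne_zero (by rwa [Ne, Ideal.absNorm_eq_zero_iff])
      nlinarith [Nat.mul_lt_mul'' hnorm hnorm]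
    have e : 𝔭 * (𝔭 * 𝔫) = 𝔭 ^ 2 * 𝔫 := by rw [sq, mul_assoc]
    obtain ⟨ψ', hψ', r, hr, H⟩ : ∃ ψ' : AddChar (𝓞 K ⧸ 𝔫) ℂ, ψ'.IsPrimitive ∧ ∃ r : ℂ, r ≠ 0 ∧
        ∀ c ∉ 𝔭, quadW ψ (Ideal.Quotient.mk _ c) = r * quadW ψ' (Ideal.Quotient.mk _ c) := by
      have := @quadW_sq_prime_mul K _ _ 𝔭 𝔫 hp hn0'
      rw [← e] at this
      exact this ψ hψ h2
    have h1 := ih _ hlt hn0' (hodd.of_mul_left_right.of_mul_left_right) ψ' hψ'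
      (hc.of_mul_right_right.of_mul_right_right) rfl
    rw [H c hcp, h1, quadSym_mul_left hp0 hn0, quadSym_mul_left hp0 hn0', quadSym_of_prime hp,
      ← mul_assoc (legSym 𝔭 c), legSym_sq_of_notMem hcp, one_mul]
    have h3 := H 1 hprime.one_notMem
    rw [map_one, map_one] at h3
    rw [h3]
    ring
  · have hcop : IsCoprime 𝔭 𝔫 := by
      refine ideal_coprime_iff_forall_prime.mpr fun 𝔮 h𝔮 h1 h2 => hdvd (Ideal.dvd_iff_le.mpr ?_)
      rwa [hmax.eq_of_le h𝔮.ne_top h1]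
    obtain ⟨ψ₁, hψ₁, ψ₂, hψ₂, -, H⟩ := quadW_crt hp0 hn0 hcop ψ hψ
    have hlt : Ideal.absNorm 𝔫 < Ideal.absNorm (𝔭 * 𝔫) := by
      rw [map_mul]
      have : 0 < Ideal.absNorm 𝔫 := Nat.pos_of_ne_zero (by rwa [Ne, Ideal.absNorm_eq_zero_iff])
      nlinarith
    have h1 := ih _ hlt hn0 hodd.of_mul_left_right ψ₂ hψ₂ hc.of_mul_right_right rfl
    have h3 := H 1
    rw [map_one, map_one, map_one] at h3
    let _ := Ideal.Quotient.field 𝔭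
    have := Ideal.finiteQuotientOfFreeOfNeBot 𝔭 hp0
    have hc0 : Ideal.Quotient.mk 𝔭 c ≠ 0 := by rwa [Ne, Ideal.Quotient.eq_zero_iff_mem]
    have h20 : (2 : 𝓞 K ⧸ 𝔭) ≠ 0 := by
      rwa [← map_ofNat (Ideal.Quotient.mk 𝔭), Ne, Ideal.Quotient.eq_zero_iff_mem]
    have h4 := quadW_field h20 hψ₁ hc0
    rw [H, h1, h3, quadSym_mul_left hp0 hn0, quadSym_of_prime hp, h4, legSym, if_neg hc0]
    push_cast
    ring

open nonZeroDivisors in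
lemma inCodifferent_iff_forall_different (w : K) :
    InCodifferent w ↔ ∀ d ∈ differentIdeal ℤ (𝓞 K), ∃ b : 𝓞 K, (b : K) = w * d := by
  have hD : (differentIdeal ℤ (𝓞 K) : FractionalIdeal (𝓞 K)⁰ K) =
      (FractionalIdeal.dual ℤ ℚ (1 : FractionalIdeal (𝓞 K)⁰ K))⁻¹ :=
    coeIdeal_differentIdeal ℤ ℚ K (𝓞 K)
  have h0 : FractionalIdeal.dual ℤ ℚ (1 : FractionalIdeal (𝓞 K)⁰ K) ≠ 0 :=
    FractionalIdeal.dual_ne_zero _ _ one_ne_zero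
  rw [inCodifferent_iff, ← inv_inv (FractionalIdeal.dual ℤ ℚ (1 : FractionalIdeal (𝓞 K)⁰ K)), ← hD,
    FractionalIdeal.mem_inv_iff (by rw [hD]; exact inv_ne_zero h0)]
  constructor
  · intro h d hd
    obtain ⟨b, hb⟩ := (FractionalIdeal.mem_one_iff _).mp
      (h d (FractionalIdeal.mem_coeIdeal_of_mem _ hd))
    exact ⟨b, hb⟩
  · intro h y hy
    obtain ⟨d, hd, rfl⟩ := (FractionalIdeal.mem_coeIdeal _).mp hy
    obtain ⟨b, hb⟩ := h d hd
    exact (FractionalIdeal.mem_one_iff _).mpr ⟨b, hb⟩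

lemma different_ne_bot : differentIdeal ℤ (𝓞 K) ≠ ⊥ := differentIdeal_ne_bot

lemma mem_charIdeal_trChar {θ : K} {y : 𝓞 K} :
    y ∈ charIdeal (trChar θ) ↔ InCodifferent (θ * y) := by
  rw [mem_charIdeal]
  refine forall_congr' fun z => ?_
  rw [trChar_apply, ratPhase_eq_one_iff]
  simp only [RingOfIntegers.coe_eq_algebraMap, map_mul, mul_assoc]

lemma charIdeal_trChar {a δ : 𝓞 K} {𝔣 : Ideal (𝓞 K)} (ha : a ≠ 0) (hδ : δ ≠ 0)
    (hf : Ideal.span {δ} = differentIdeal ℤ (𝓞 K) * 𝔣) :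
    charIdeal (trChar (1 / ((a : K) * δ))) = Ideal.span {a} * 𝔣 := by
  have ha' : (a : K) ≠ 0 := by simpa using ha
  have hδ' : (δ : K) ≠ 0 := by simpa using hδ
  ext y
  rw [mem_charIdeal_trChar, inCodifferent_iff_forall_different]
  have key : (∀ d ∈ differentIdeal ℤ (𝓞 K), ∃ b : 𝓞 K, (b : K) = 1 / ((a : K) * δ) * y * d) ↔
      Ideal.span {y} * differentIdeal ℤ (𝓞 K) ≤ Ideal.span {a * δ} := by
    rw [Ideal.span_singleton_mul_le_iff]
    refine forall₂_congr fun d _ => ?_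
    rw [Ideal.mem_span_singleton]
    constructor
    · rintro ⟨b, hb⟩
      refine ⟨b, RingOfIntegers.ext ?_⟩
      simp only [RingOfIntegers.coe_eq_algebraMap, map_mul] at *
      rw [hb]
      field_simp
    · rintro ⟨b, hb⟩
      refine ⟨b, ?_⟩
      have hb' := congrArg (algebraMap (𝓞 K) K) hb
      simp only [RingOfIntegers.coe_eq_algebraMap, map_mul] at *
      field_simp
      rw [hb']
      ring
  rw [key, ← Ideal.span_singleton_mul_span_singleton, hf, ← Ideal.dvd_iff_le,
    show Ideal.span {a} * (differentIdeal ℤ (𝓞 K) * 𝔣) =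
      (Ideal.span {a} * 𝔣) * differentIdeal ℤ (𝓞 K) by ring,
    mul_dvd_mul_iff_right (show differentIdeal ℤ (𝓞 K) ≠ 0 from different_ne_bot),
    Ideal.dvd_iff_le, Ideal.span_singleton_le_iff_mem]

lemma exists_nat_forall_lt (x : 𝓞 K) : ∃ N : ℕ, ∀ v : K →+* ℝ, ∀ M : ℕ, N ≤ M →
    0 < v (x : K) + M := by
  have : Finite (K →+* ℝ) := Finite.of_injective
    (fun v : K →+* ℝ => (Complex.ofRealHom.comp v : K →+* ℂ)) fun v w h => by
      ext x
      exact Complex.ofReal_injective (DFunLike.congr_fun h x)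
  have := Fintype.ofFinite (K →+* ℝ)
  choose N hN using fun v : K →+* ℝ => exists_nat_gt (-(v (x : K)))
  refine ⟨∑ v, N v, fun v M hM => ?_⟩
  have h1 : N v ≤ M := (Finset.single_le_sum (fun _ _ => Nat.zero_le _) (Finset.mem_univ v)).trans hM
  have h2 : (N v : ℝ) ≤ M := by exact_mod_cast h1
  linarith [hN v]

lemma exists_totPos_sub_mem (x : 𝓞 K) {I : Ideal (𝓞 K)} (hI : I ≠ ⊥) :
    ∃ y, TotPos y ∧ y - x ∈ I := by
  obtain ⟨N, hN⟩ := exists_nat_forall_lt x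
  have hpos : 0 < Ideal.absNorm I := Nat.pos_of_ne_zero (by rwa [Ne, Ideal.absNorm_eq_zero_iff])
  refine ⟨x + (N * Ideal.absNorm I : ℕ), fun v => ?_, ?_⟩
  · have := hN v (N * Ideal.absNorm I) (Nat.le_mul_of_pos_right _ hpos)
    simpa only [RingOfIntegers.coe_eq_algebraMap, map_add, map_natCast] using this
  · rw [add_sub_cancel_left, Nat.cast_mul]
    exact I.mul_mem_left _ (Ideal.absNorm_mem I)

lemma TotPos.ne_zero (htot : ∀ φ : K →+* ℂ, ComplexEmbedding.IsReal φ) {x : 𝓞 K} (h : TotPos x) :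
    x ≠ 0 := by
  rintro rfl
  have := h ((htot (Classical.arbitrary _)).embedding)
  simp at this

lemma TotPos.mul {x y : 𝓞 K} (hx : TotPos x) (hy : TotPos y) : TotPos (x * y) := fun v => by
  simpa only [RingOfIntegers.coe_eq_algebraMap, map_mul] using mul_pos (hx v) (hy v)

lemma totPos_pow_nat (m l : ℕ) (hm : m ≠ 0) : TotPos ((m : 𝓞 K) ^ l) := fun v => by
  simp only [map_pow, map_natCast]
  positivity

lemma exists_different_mul (htot : ∀ φ : K →+* ℂ, ComplexEmbedding.IsReal φ) {𝔪 : Ideal (𝓞 K)}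
    (h𝔪 : 𝔪 ≠ ⊥) : ∃ (δ : 𝓞 K) (𝔣 : Ideal (𝓞 K)), TotPos δ ∧ 𝔣 ≠ ⊥ ∧
      Ideal.span {δ} = differentIdeal ℤ (𝓞 K) * 𝔣 ∧ IsCoprime 𝔣 𝔪 := by
  have hD := different_ne_bot (K := K)
  have hDm : differentIdeal ℤ (𝓞 K) * 𝔪 ≠ ⊥ := mul_ne_zero hD h𝔪
  obtain ⟨x, hx⟩ := IsDedekindDomain.exists_sup_span_eq
    (Ideal.mul_le_left : differentIdeal ℤ (𝓞 K) * 𝔪 ≤ _) hDm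
  obtain ⟨δ, hδ, hδx⟩ := exists_totPos_sub_mem x hDm
  have hxD : x ∈ differentIdeal ℤ (𝓞 K) := by
    rw [← hx]; exact Ideal.mem_sup_right (Ideal.mem_span_singleton_self x)
  have hδD : δ ∈ differentIdeal ℤ (𝓞 K) := by
    have := add_mem (Ideal.mul_le_left hδx) hxD
    rwa [sub_add_cancel] at this
  obtain ⟨𝔣, hf⟩ := Ideal.dvd_iff_le.mpr ((Ideal.span_singleton_le_iff_mem _).mpr hδD)
  refine ⟨δ, 𝔣, hδ, ?_, hf, ?_⟩
  · rintro rfl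
    rw [Ideal.mul_bot, Ideal.span_singleton_eq_bot] at hf
    exact hδ.ne_zero htot hf
  · rw [Ideal.isCoprime_iff_sup_eq]
    have h1 : differentIdeal ℤ (𝓞 K) ≤ differentIdeal ℤ (𝓞 K) * (𝔣 ⊔ 𝔪) := by
      rw [Ideal.mul_sup, ← hf]
      nth_rw 1 [← hx]
      refine sup_le le_sup_right ?_
      rw [Ideal.span_singleton_le_iff_mem]
      have : x = δ - (δ - x) := by ring
      rw [this]
      exact sub_mem (Ideal.mem_sup_left (Ideal.mem_span_singleton_self δ))
        (Ideal.mem_sup_right hδx)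
    have h2 : differentIdeal ℤ (𝓞 K) * (𝔣 ⊔ 𝔪) ∣ differentIdeal ℤ (𝓞 K) * 1 := by
      rw [mul_one]; exact Ideal.dvd_iff_le.mpr h1
    rw [mul_dvd_mul_iff_left (show differentIdeal ℤ (𝓞 K) ≠ 0 from hD)] at h2
    exact Ideal.isUnit_iff.mp (isUnit_of_dvd_one h2)

lemma quadSym_sq {𝔪 : Ideal (𝓞 K)} {c : 𝓞 K} (hc : IsCoprime (Ideal.span {c}) 𝔪) :
    quadSym 𝔪 c ^ 2 = 1 := by
  rw [quadSym, ← Multiset.prod_map_pow]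
  refine Multiset.prod_eq_one fun x hx => ?_
  obtain ⟨𝔭, h𝔭, rfl⟩ := Multiset.mem_map.mp hx
  have hp := UniqueFactorizationMonoid.prime_of_normalized_factor 𝔭 h𝔭
  have hle : 𝔪 ≤ 𝔭 := Ideal.dvd_iff_le.mp (UniqueFactorizationMonoid.dvd_of_mem_normalizedFactors h𝔭)
  have hmem : c ∉ 𝔭 := fun h => ideal_coprime_iff_forall_prime.mp hc 𝔭 (Ideal.isPrime_of_prime hp)
    ((Ideal.span_singleton_le_iff_mem _).mpr h) hle
  rw [legSym, if_neg (by rwa [Ideal.Quotient.eq_zero_iff_mem])]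
  split_ifs <;> norm_num

lemma quadSym_eq_zero {𝔪 : Ideal (𝓞 K)} (h0 : 𝔪 ≠ ⊥) {c : 𝓞 K}
    (hc : ¬ IsCoprime (Ideal.span {c}) 𝔪) : quadSym 𝔪 c = 0 := by
  rw [ideal_coprime_iff_forall_prime] at hc
  push Not at hc
  obtain ⟨𝔭, hp, hc𝔭, h𝔪⟩ := hc
  have hp0 : 𝔭 ≠ ⊥ := by
    rintro rfl
    exact h0 (le_bot_iff.mp h𝔪)
  have hprime : Prime 𝔭 := (Ideal.prime_iff_isPrime hp0).mpr hp
  rw [quadSym, Multiset.prod_eq_zero_iff, Multiset.mem_map]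
  refine ⟨𝔭, ?_, ?_⟩
  · obtain ⟨q, hq, hassoc⟩ := UniqueFactorizationMonoid.exists_mem_normalizedFactors_of_dvd h0
      hprime.irreducible (Ideal.dvd_iff_le.mpr h𝔪)
    rwa [associated_iff_eq.mp hassoc]
  · rw [legSym, if_pos]
    rw [Ideal.Quotient.eq_zero_iff_mem]
    exact (Ideal.span_singleton_le_iff_mem _).mp hc𝔭

lemma quadW_zero {S : Type*} [CommRing S] [Finite S] (ψ : AddChar S ℂ) : quadW ψ 0 = Nat.card S := by
  have := Fintype.ofFinite S
  simp [quadW_eq_sum]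

lemma quadW_quotChar_trChar (htot : ∀ φ : K →+* ℂ, ComplexEmbedding.IsReal φ) {δ c a : 𝓞 K}
    (hδ : TotPos δ) (hc : c ≠ 0) (ha : TotPos a) (h4 : 4 ∣ a) {𝔣 : Ideal (𝓞 K)} (hf0 : 𝔣 ≠ ⊥)
    (hf : Ideal.span {δ} = differentIdeal ℤ (𝓞 K) * 𝔣) {I : Ideal (𝓞 K)}
    (hI : I = charIdeal (trChar (1 / (((c * a : 𝓞 K) : K) * δ)))) :
    PosEq (quadW (quotChar _ I hI.le) (Ideal.Quotient.mk I c)) (zeta8 ^ Module.finrank ℚ K) := by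
  have ha0 := ha.ne_zero htot
  have hδ0 := hδ.ne_zero htot
  have hmul : (trChar (1 / (((c * a : 𝓞 K) : K) * δ))).mulShift c =
      trChar (1 / ((a : K) * δ)) := by
    rw [trChar_mulShift]
    congr 1
    have h1 : algebraMap (𝓞 K) K c ≠ 0 := by simpa using hc
    simp only [RingOfIntegers.coe_eq_algebraMap, map_mul]
    have h2 : algebraMap (𝓞 K) K a ≠ 0 := by simpa using ha0
    have h3 : algebraMap (𝓞 K) K δ ≠ 0 := by simpa using hδ0
    field_simp
  have hI0 : I ≠ ⊥ := by
    rw [hI, charIdeal_trChar (mul_ne_zero hc ha0) hδ0 hf]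
    exact mul_ne_zero (by simpa using mul_ne_zero hc ha0) hf0
  have hJ0 : charIdeal (trChar (1 / ((a : K) * δ))) ≠ ⊥ := by
    rw [charIdeal_trChar ha0 hδ0 hf]
    exact mul_ne_zero (by simpa using ha0) hf0
  have hIJ : I ≤ charIdeal ((trChar (1 / (((c * a : 𝓞 K) : K) * δ))).mulShift c) := by
    intro x hx
    rw [mem_charIdeal_mulShift, ← hI]
    exact I.mul_mem_left _ hx
  have := Ideal.finiteQuotientOfFreeOfNeBot _ hI0
  have hfin := Ideal.finiteQuotientOfFreeOfNeBot _ hJ0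
  have hfin' : Finite (𝓞 K ⧸ charIdeal ((trChar (1 / (((c * a : 𝓞 K) : K) * δ))).mulShift c)) := by
    rw [hmul]; exact hfin
  obtain ⟨N, hN, -, h⟩ := quadW_quotChar_mulShift _ I _ hIJ hI.le c le_rfl 1
  rw [mul_one] at h
  rw [h]
  refine (posEq_natCast_mul hN _).trans ?_
  rw [map_one]
  have key := quadW_trChar htot (1 / ((a : K) * δ)) (fun v => by
      rw [map_div₀, map_one, map_mul]
      exact one_div_pos.mpr (mul_pos (ha v) (hδ v))) (fun w hw => by
      obtain ⟨a', rfl⟩ := h4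
      have hδD : δ ∈ differentIdeal ℤ (𝓞 K) := by
        have := Ideal.mem_span_singleton_self δ
        rw [hf] at this
        exact Ideal.mul_le_left this
      obtain ⟨b, hb⟩ := (inCodifferent_iff_forall_different w).mp hw δ hδD
      refine ⟨a' * b, ?_⟩
      have h1 : algebraMap (𝓞 K) K a' ≠ 0 := by
        have : a' ≠ 0 := right_ne_zero_of_mul ha0
        simpa using this
      have h3 : algebraMap (𝓞 K) K δ ≠ 0 := by simpa using hδ0
      simp only [RingOfIntegers.coe_eq_algebraMap, map_mul, map_ofNat] at hb ⊢
      rw [hb]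
      field_simp)
  clear h
  revert hfin'
  rw [hmul]
  intro hfin'
  exact key

lemma quadW_crt₄ {A P Q F : Ideal (𝓞 K)} (hA : A ≠ ⊥) (hP : P ≠ ⊥) (hQ : Q ≠ ⊥) (hF : F ≠ ⊥)
    (hA' : IsCoprime A (P * (Q * F))) (hP' : IsCoprime P (Q * F)) (hQ' : IsCoprime Q F)
    (ψ : AddChar (𝓞 K ⧸ A * (P * (Q * F))) ℂ) (hψ : ψ.IsPrimitive) :
    ∃ ψA : AddChar (𝓞 K ⧸ A) ℂ, ∃ ψP : AddChar (𝓞 K ⧸ P) ℂ, ∃ ψQ : AddChar (𝓞 K ⧸ Q) ℂ,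
      ∃ ψF : AddChar (𝓞 K ⧸ F) ℂ,
      ψA.IsPrimitive ∧ ψP.IsPrimitive ∧ ψQ.IsPrimitive ∧ ψF.IsPrimitive ∧
      (∀ x ∈ P * (Q * F), ψA (Ideal.Quotient.mk _ x) = ψ (Ideal.Quotient.mk _ x)) ∧
      ∀ c, quadW ψ (Ideal.Quotient.mk _ c) =
        quadW ψA (Ideal.Quotient.mk _ c) * (quadW ψP (Ideal.Quotient.mk _ c) *
          (quadW ψQ (Ideal.Quotient.mk _ c) * quadW ψF (Ideal.Quotient.mk _ c))) := by
  obtain ⟨ψA, hψA, ψ₁, hψ₁, h1, H1⟩ := quadW_crt hA (mul_ne_zero hP (mul_ne_zero hQ hF)) hA' ψ hψ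
  obtain ⟨ψP, hψP, ψ₂, hψ₂, -, H2⟩ := quadW_crt hP (mul_ne_zero hQ hF) hP' ψ₁ hψ₁
  obtain ⟨ψQ, hψQ, ψF, hψF, -, H3⟩ := quadW_crt hQ hF hQ' ψ₂ hψ₂
  exact ⟨ψA, ψP, ψQ, ψF, hψA, hψP, hψQ, hψF, h1, fun c => by rw [H1, H2, H3]⟩

/-- The defect `(α/β)(β/α)` of quadratic reciprocity. -/
def recSym (a b : 𝓞 K) : ℤ := quadSym (Ideal.span {b}) a * quadSym (Ideal.span {a}) b

lemma posEq_of_four_relations {T₁ Tα Tβ Tαβ w₁ w₂ w₃ Z : ℂ} {n₁ n₂ : ℕ} {x y u v : ℤ}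
    (hx : x ^ 2 = 1) (hy : y ^ 2 = 1) (hZ : Z ≠ 0)
    (h₁ : PosEq (T₁ * (w₁ * (w₂ * w₃))) Z)
    (hα : PosEq (Tα * (n₁ * ((x * w₂) * (u * w₃)))) Z)
    (hβ : PosEq (Tβ * ((y * w₁) * (n₂ * (v * w₃)))) Z)
    (hαβ : PosEq (Tαβ * (n₁ * (n₂ * (u * v * w₃)))) Z) :
    PosEq ((x * y) * (T₁ * Tαβ)) (Tα * Tβ) := by
  have hx' : (x : ℂ) ^ 2 = 1 := by exact_mod_cast hx
  have hy' : (y : ℂ) ^ 2 = 1 := by exact_mod_cast hy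
  have e1 := (h₁.mul hαβ).trans (hα.mul hβ).symm
  have hne := (h₁.mul hαβ).ne_zero (mul_ne_zero hZ hZ)
  have hM : (n₁ * n₂ * (u * v) * w₁ * w₂ * w₃ ^ 2 : ℂ) ≠ 0 := by
    intro h
    apply hne
    linear_combination (T₁ * Tαβ) * h
  have hxy : (x * y : ℂ) ≠ 0 := by
    intro h
    have : (1 : ℂ) = 0 := by linear_combination (x * y : ℂ) * h - y ^ 2 * hx' - hy'
    exact one_ne_zero this
  refine PosEq.of_mul_left (mul_ne_zero hM hxy) ?_
  convert e1 using 1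
  · linear_combination (n₁ * n₂ * (u * v) * w₁ * w₂ * w₃ ^ 2 * T₁ * Tαβ : ℂ) * (y ^ 2 * hx' + hy')
  · ring

lemma exists_char_recSym_aux (htot : ∀ φ : K →+* ℂ, ComplexEmbedding.IsReal φ) {l : ℕ} (hl : 2 ≤ l)
    {α β δ : 𝓞 K} (hα : TotPos α) (hβ : TotPos β) (hδ : TotPos δ)
    (hαo : OddIdeal (Ideal.span {α})) (hβo : OddIdeal (Ideal.span {β}))
    (hαβ : IsCoprime (Ideal.span {α}) (Ideal.span {β})) {𝔣 : Ideal (𝓞 K)} (hf0 : 𝔣 ≠ ⊥)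
    (hf : Ideal.span {δ} = differentIdeal ℤ (𝓞 K) * 𝔣)
    (hf2 : IsCoprime 𝔣 (Ideal.span {(2 : 𝓞 K)})) (hfα : IsCoprime 𝔣 (Ideal.span {α}))
    (hfβ : IsCoprime 𝔣 (Ideal.span {β})) :
    ∃ ψ : AddChar (𝓞 K ⧸ Ideal.span {(2 : 𝓞 K) ^ l}) ℂ, ψ.IsPrimitive ∧
      (∀ x ∈ Ideal.span {α} * (Ideal.span {β} * 𝔣), ψ (Ideal.Quotient.mk _ x) =
        trChar (1 / (((2 ^ l * (α * β) : 𝓞 K) : K) * δ)) x) ∧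
      PosEq (recSym α β * (quadW ψ 1 * quadW ψ (Ideal.Quotient.mk _ (α * β))))
        (quadW ψ (Ideal.Quotient.mk _ α) * quadW ψ (Ideal.Quotient.mk _ β)) := by
  have hα0 := hα.ne_zero htot
  have hβ0 := hβ.ne_zero htot
  have hδ0 := hδ.ne_zero htot
  have h20 : (2 : 𝓞 K) ^ l ≠ 0 := pow_ne_zero _ two_ne_zero
  have hP : Ideal.span {α} ≠ ⊥ := by simpa using hα0
  have hQ : Ideal.span {β} ≠ ⊥ := by simpa using hβ0
  have hA : Ideal.span {(2 : 𝓞 K) ^ l} ≠ ⊥ := by simp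
  have h2pos : TotPos ((2 : 𝓞 K) ^ l) := by exact_mod_cast totPos_pow_nat 2 l two_ne_zero
  have h4 : (4 : 𝓞 K) ∣ 2 ^ l := by
    have : (4 : 𝓞 K) = 2 ^ 2 := by norm_num
    rw [this]; exact pow_dvd_pow _ hl
  set θ : K := 1 / (((2 ^ l * (α * β) : 𝓞 K) : K) * δ) with hθ
  have hI : Ideal.span {(2 : 𝓞 K) ^ l} * (Ideal.span {α} * (Ideal.span {β} * 𝔣)) =
      charIdeal (trChar θ) := by
    rw [hθ, charIdeal_trChar (mul_ne_zero h20 (mul_ne_zero hα0 hβ0)) hδ0 hf,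
      ← Ideal.span_singleton_mul_span_singleton, ← Ideal.span_singleton_mul_span_singleton]
    ring
  have hcA : IsCoprime (Ideal.span {(2 : 𝓞 K) ^ l}) (Ideal.span {α} * (Ideal.span {β} * 𝔣)) := by
    rw [← Ideal.span_singleton_pow]
    exact IsCoprime.pow_left (hαo.symm.mul_right (hβo.symm.mul_right hf2.symm))
  have hprim := quotChar_isPrimitive (trChar θ) _ hI
  obtain ⟨ψ, w₁, w₂, w₃, hψ, hw₁, hw₂, hw₃, hres, H⟩ := quadW_crt₄ hA hP hQ hf0 hcA
    (hαβ.mul_right hfα.symm) hfβ.symm _ hprim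
  refine ⟨ψ, hψ, hres, ?_⟩
  have phase : ∀ c a : 𝓞 K, 2 ^ l * (α * β) = c * a → c ≠ 0 → TotPos a → 4 ∣ a →
      PosEq (quadW (quotChar (trChar θ) _ hI.le) (Ideal.Quotient.mk _ c))
        (zeta8 ^ Module.finrank ℚ K) := by
    intro c a hca hc ha h4
    have hθ' : θ = 1 / (((c * a : 𝓞 K) : K) * δ) := by rw [← hca]
    clear_value θ
    subst hθ'
    exact quadW_quotChar_trChar htot hδ hc ha h4 hf0 hf hI
  have hZ : zeta8 ^ Module.finrank ℚ K ≠ 0 := pow_ne_zero _ (Complex.exp_ne_zero _)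
  have p1 := phase 1 _ (one_mul _).symm one_ne_zero (h2pos.mul (hα.mul hβ)) (h4.mul_right _)
  have pα := phase α (2 ^ l * β) (by ring) hα0 (h2pos.mul hβ) (h4.mul_right _)
  have pβ := phase β (2 ^ l * α) (by ring) hβ0 (h2pos.mul hα) (h4.mul_right _)
  have pαβ := phase (α * β) (2 ^ l) (by ring) (mul_ne_zero hα0 hβ0) h2pos h4
  have cop : ∀ {𝔪 : Ideal (𝓞 K)}, IsCoprime (Ideal.span {α}) 𝔪 → IsCoprime (Ideal.span {β}) 𝔪 →
      IsCoprime (Ideal.span {α * β}) 𝔪 := by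
    intro 𝔪 h1 h2
    rw [← Ideal.span_singleton_mul_span_singleton]
    exact h1.mul_left h2
  have hmem : ∀ {c d : 𝓞 K}, c ∣ d → Ideal.Quotient.mk (Ideal.span {c}) d = 0 := fun h =>
    Ideal.Quotient.eq_zero_iff_mem.mpr (Ideal.mem_span_singleton.mpr h)
  have hfinP := Ideal.finiteQuotientOfFreeOfNeBot _ hP
  have hfinQ := Ideal.finiteQuotientOfFreeOfNeBot _ hQ
  rw [H] at p1 pα pβ pαβ
  rw [map_one, map_one, map_one, map_one] at p1
  rw [hmem dvd_rfl, quadW_zero, quadW_odd hQ hβo w₂ hw₂ hαβ, quadW_odd hf0 hf2 w₃ hw₃ hfα.symm] at pα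
  rw [hmem dvd_rfl, quadW_zero, quadW_odd hP hαo w₁ hw₁ hαβ.symm,
    quadW_odd hf0 hf2 w₃ hw₃ hfβ.symm] at pβ
  rw [hmem (dvd_mul_right _ _), hmem (dvd_mul_left _ _), quadW_zero, quadW_zero,
    quadW_odd hf0 hf2 w₃ hw₃ (cop hfα.symm hfβ.symm), quadSym_mul_right, Int.cast_mul] at pαβ
  rw [recSym, Int.cast_mul]
  exact posEq_of_four_relations (quadSym_sq hαβ) (quadSym_sq hαβ.symm) hZ p1 pα pβ pαβ

lemma isCoprime_span_of_mul_sub_mem {I : Ideal (𝓞 K)} {g t : 𝓞 K} (h : g * t - 1 ∈ I) :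
    IsCoprime (Ideal.span {g}) I := by
  rw [Ideal.isCoprime_iff_exists]
  exact ⟨g * t, Ideal.mem_span_singleton.mpr (dvd_mul_right g t), -(g * t - 1), neg_mem h, by ring⟩

lemma isCoprime_span_of_sub_mem {I : Ideal (𝓞 K)} {g t : 𝓞 K} (h : g - t ∈ I)
    (ht : IsCoprime (Ideal.span {t}) I) : IsCoprime (Ideal.span {g}) I := by
  obtain ⟨i, hi, j, hj, hij⟩ := Ideal.isCoprime_iff_exists.mp ht
  obtain ⟨a, rfl⟩ := Ideal.mem_span_singleton.mp hi
  refine isCoprime_span_of_mul_sub_mem (t := a) ?_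
  have : g * a - 1 = (g - t) * a - j := by linear_combination hij
  rw [this]
  exact sub_mem (I.mul_mem_right _ h) hj

lemma exists_crt {I J : Ideal (𝓞 K)} (h : IsCoprime I J) (x y : 𝓞 K) :
    ∃ g, g - x ∈ I ∧ g - y ∈ J := by
  obtain ⟨i, hi, j, hj, hij⟩ := Ideal.isCoprime_iff_exists.mp h
  refine ⟨x * j + y * i, ?_, ?_⟩
  · have : x * j + y * i - x = (y - x) * i := by linear_combination x * hij
    rw [this]
    exact I.mul_mem_left _ hi
  · have : x * j + y * i - y = (x - y) * j := by linear_combination y * hij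
    rw [this]
    exact J.mul_mem_left _ hj

lemma exists_totPos_crt {I J : Ideal (𝓞 K)} (hI : I ≠ ⊥) (hJ : J ≠ ⊥) (h : IsCoprime I J)
    (x y : 𝓞 K) : ∃ g, TotPos g ∧ g - x ∈ I ∧ g - y ∈ J := by
  obtain ⟨g, h1, h2⟩ := exists_crt h x y
  obtain ⟨g', hg', h3⟩ := exists_totPos_sub_mem g (mul_ne_zero hI hJ : I * J ≠ ⊥)
  refine ⟨g', hg', ?_, ?_⟩
  · have := add_mem (Ideal.mul_le_left h3) h1
    rwa [sub_add_sub_cancel] at this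
  · have := add_mem (Ideal.mul_le_right h3) h2
    rwa [sub_add_sub_cancel] at this

lemma isCoprime_two_pow_iff {𝔪 : Ideal (𝓞 K)} {l : ℕ} (hl : l ≠ 0) :
    IsCoprime 𝔪 (Ideal.span {(2 : 𝓞 K) ^ l}) ↔ OddIdeal 𝔪 := by
  rw [← Ideal.span_singleton_pow, OddIdeal, IsCoprime.pow_right_iff (Nat.pos_of_ne_zero hl)]

/-- Gauss sums at the prime two compute the reciprocity defect. -/
lemma posEq_recSym_quadW (htot : ∀ φ : K →+* ℂ, ComplexEmbedding.IsReal φ) {l : ℕ} (hl : 2 ≤ l)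
    {α β : 𝓞 K} (hα : TotPos α) (hβ : TotPos β)
    (hαo : OddIdeal (Ideal.span {α})) (hβo : OddIdeal (Ideal.span {β}))
    (hαβ : IsCoprime (Ideal.span {α}) (Ideal.span {β}))
    (ψ : AddChar (𝓞 K ⧸ Ideal.span {(2 : 𝓞 K) ^ l}) ℂ) (hψ : ψ.IsPrimitive) :
    PosEq (recSym α β * (quadW ψ 1 * quadW ψ (Ideal.Quotient.mk _ (α * β))))
      (quadW ψ (Ideal.Quotient.mk _ α) * quadW ψ (Ideal.Quotient.mk _ β)) := by
  have hl0 : l ≠ 0 := by omega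
  have hα0 := hα.ne_zero htot
  have hβ0 := hβ.ne_zero htot
  have hP : Ideal.span {α} ≠ ⊥ := by simpa using hα0
  have hQ : Ideal.span {β} ≠ ⊥ := by simpa using hβ0
  have hA : Ideal.span {(2 : 𝓞 K) ^ l} ≠ ⊥ := by simp
  have h2 : Ideal.span {(2 : 𝓞 K)} ≠ ⊥ := by simp
  have := Ideal.finiteQuotientOfFreeOfNeBot _ hA
  obtain ⟨δ, 𝔣, hδ, hf0, hf, hfc⟩ := exists_different_mul htot
    (mul_ne_zero h2 (mul_ne_zero hP hQ) : Ideal.span {(2 : 𝓞 K)} * (Ideal.span {α} * Ideal.span {β}) ≠ ⊥)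
  have hf2 := hfc.of_mul_right_left
  have hfα := hfc.of_mul_right_right.of_mul_right_left
  have hfβ := hfc.of_mul_right_right.of_mul_right_right
  have hδ0 := hδ.ne_zero htot
  obtain ⟨ψ₁, hψ₁, hres, -⟩ :=
    exists_char_recSym_aux htot hl hα hβ hδ hαo hβo hαβ hf0 hf hf2 hfα hfβ
  obtain ⟨s, hs, rfl⟩ := exists_isUnit_eq_mulShift hψ₁ hψ
  obtain ⟨t, hst⟩ := hs.exists_right_inv
  obtain ⟨t, rfl⟩ := Ideal.Quotient.mk_surjective t
  obtain ⟨s, rfl⟩ := Ideal.Quotient.mk_surjective s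
  have hcop : IsCoprime (Ideal.span {(2 : 𝓞 K) ^ l}) (Ideal.span {α} * Ideal.span {β}) :=
    ((isCoprime_two_pow_iff hl0).mpr hαo).symm.mul_right ((isCoprime_two_pow_iff hl0).mpr hβo).symm
  obtain ⟨g, hg, hg1, hg2⟩ := exists_totPos_crt hA (mul_ne_zero hP hQ) hcop t 1
  have hg0 := hg.ne_zero htot
  have hmk : Ideal.Quotient.mk (Ideal.span {(2 : 𝓞 K) ^ l}) g = Ideal.Quotient.mk _ t :=
    Ideal.Quotient.eq.mpr hg1
  have hgα : IsCoprime (Ideal.span {g}) (Ideal.span {α}) :=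
    isCoprime_span_of_mul_sub_mem (t := 1) (by rw [mul_one]; exact Ideal.mul_le_left hg2)
  have hgβ : IsCoprime (Ideal.span {g}) (Ideal.span {β}) :=
    isCoprime_span_of_mul_sub_mem (t := 1) (by rw [mul_one]; exact Ideal.mul_le_right hg2)
  have hgo : OddIdeal (Ideal.span {g}) := by
    rw [← isCoprime_two_pow_iff hl0]
    refine isCoprime_span_of_mul_sub_mem (t := s) ?_
    rw [← Ideal.Quotient.eq, map_mul, hmk, map_one, mul_comm, hst]
  have hg' : Ideal.span {g} ≠ ⊥ := by simpa using hg0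
  obtain ⟨ψ', hψ', hres', H⟩ := exists_char_recSym_aux (𝔣 := Ideal.span {g} * 𝔣) (δ := g * δ) htot hl
    hα hβ (hg.mul hδ) hαo hβo hαβ (mul_ne_zero hg' hf0)
    (by rw [← Ideal.span_singleton_mul_span_singleton, hf]; ring)
    (hgo.mul_left hf2) (hgα.mul_left hfα) (hgβ.mul_left hfβ)
  have hcop' : IsCoprime (Ideal.span {(2 : 𝓞 K) ^ l}) (Ideal.span {α} * (Ideal.span {β} * 𝔣)) := by
    rw [← mul_assoc]
    exact hcop.mul_right ((isCoprime_two_pow_iff hl0).mpr hf2).symm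
  have hshift : ∀ x : 𝓞 K, ψ' (Ideal.Quotient.mk _ (g * x)) = ψ₁ (Ideal.Quotient.mk _ x) := by
    intro x
    obtain ⟨y, hy1, hy2⟩ := exists_crt hcop' x 0
    rw [sub_zero] at hy2
    have e : Ideal.Quotient.mk (Ideal.span {(2 : 𝓞 K) ^ l}) y = Ideal.Quotient.mk _ x :=
      Ideal.Quotient.eq.mpr hy1
    rw [map_mul, ← e, ← map_mul, hres y hy2, hres' (g * y), trChar_apply, trChar_apply]
    · congr 2
      have h1 : algebraMap (𝓞 K) K g ≠ 0 := by simpa using hg0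
      have h2 : algebraMap (𝓞 K) K α ≠ 0 := by simpa using hα0
      have h3 : algebraMap (𝓞 K) K β ≠ 0 := by simpa using hβ0
      have h4 : algebraMap (𝓞 K) K δ ≠ 0 := by simpa using hδ0
      simp only [RingOfIntegers.coe_eq_algebraMap, map_mul, map_pow, map_ofNat]
      field_simp
    · have : Ideal.span {α} * (Ideal.span {β} * (Ideal.span {g} * 𝔣)) =
          Ideal.span {g} * (Ideal.span {α} * (Ideal.span {β} * 𝔣)) := by ring
      rw [this]
      exact Ideal.mul_mem_mul (Ideal.mem_span_singleton_self g) hy2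
  have hfinal : ψ' = ψ₁.mulShift (Ideal.Quotient.mk _ s) := by
    ext x
    obtain ⟨x, rfl⟩ := Ideal.Quotient.mk_surjective x
    have e : Ideal.Quotient.mk (Ideal.span {(2 : 𝓞 K) ^ l}) (g * (s * x)) =
        Ideal.Quotient.mk _ x := by
      rw [map_mul, map_mul, hmk, ← mul_assoc, mul_comm (Ideal.Quotient.mk _ t), hst, one_mul]
    rw [AddChar.mulShift_apply, ← map_mul, ← hshift, e]
  rw [← hfinal]
  exact H

lemma exists_isPrimitive_quotient {I : Ideal (𝓞 K)} (hI : I ≠ ⊥)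
    (htot : ∀ φ : K →+* ℂ, ComplexEmbedding.IsReal φ) :
    ∃ ψ : AddChar (𝓞 K ⧸ I) ℂ, ψ.IsPrimitive := by
  obtain ⟨a, ha, ha0⟩ := Submodule.exists_mem_ne_zero_of_ne_bot hI
  have hspan : Ideal.span {a} ≠ ⊥ := by simpa using ha0
  obtain ⟨δ, 𝔣, hδ, hf0, hf, hfc⟩ := exists_different_mul htot hspan
  obtain ⟨ψ, hψ, -⟩ := quadW_crt hspan hf0 hfc.symm _
    (quotChar_isPrimitive _ _ (charIdeal_trChar ha0 (hδ.ne_zero htot) hf).symm)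
  obtain ⟨J, hJ⟩ := Ideal.dvd_iff_le.mpr ((Ideal.span_singleton_le_iff_mem _).mpr ha)
  have hle : Ideal.span {a} ≤ J := by rw [hJ]; exact Ideal.mul_le_right
  have hJ0 : J ≠ ⊥ := by
    rintro rfl
    exact hspan (le_bot_iff.mp hle)
  obtain ⟨c, hc⟩ := IsDedekindDomain.exists_sup_span_eq hle hspan
  have hchar : I = charIdeal ((liftChar ψ).mulShift c) := by
    ext x
    rw [mem_charIdeal_mulShift, charIdeal_liftChar hψ]
    constructor
    · intro hx
      rw [hJ, mul_comm I J]
      refine Ideal.mul_mem_mul ?_ hx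
      rw [← hc]
      exact Ideal.mem_sup_right (Ideal.mem_span_singleton_self c)
    · intro hx
      have h1 : Ideal.span {x} * J ≤ Ideal.span {a} := by
        rw [← hc, Ideal.mul_sup, Ideal.span_singleton_mul_span_singleton]
        refine sup_le ?_ ?_
        · exact (Ideal.span_singleton_le_iff_mem _).mpr (Ideal.mem_span_singleton.mpr (dvd_mul_left a x))
        · rw [Ideal.span_singleton_mul_span_singleton, mul_comm x c]
          exact (Ideal.span_singleton_le_iff_mem _).mpr hx
      rw [hJ, ← Ideal.dvd_iff_le, mul_dvd_mul_iff_right (show J ≠ 0 from hJ0), Ideal.dvd_iff_le,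
        Ideal.span_singleton_le_iff_mem] at h1
      exact h1
  exact ⟨_, quotChar_isPrimitive _ I hchar⟩

lemma exists_quadW_mul {I J : Ideal (𝓞 K)} (hI : I ≠ ⊥) (hJ : J ≠ ⊥) (h : IsCoprime I J)
    {ψ₁ : AddChar (𝓞 K ⧸ I) ℂ} (hψ₁ : ψ₁.IsPrimitive) {ψ₂ : AddChar (𝓞 K ⧸ J) ℂ}
    (hψ₂ : ψ₂.IsPrimitive) : ∃ ψ : AddChar (𝓞 K ⧸ I * J) ℂ, ψ.IsPrimitive ∧
      ∀ c, quadW ψ (Ideal.Quotient.mk _ c) =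
        quadW ψ₁ (Ideal.Quotient.mk _ c) * quadW ψ₂ (Ideal.Quotient.mk _ c) := by
  have := Ideal.finiteQuotientOfFreeOfNeBot _ hI
  have := Ideal.finiteQuotientOfFreeOfNeBot _ hJ
  have := Ideal.finiteQuotientOfFreeOfNeBot (I * J) (mul_ne_zero hI hJ)
  let e := Ideal.quotientMulEquivQuotientProd I J h
  refine ⟨charPair e ψ₁ ψ₂, charPair_isPrimitive e hψ₁ hψ₂, fun c => ?_⟩
  rw [quadW_eq_mul e, charFst_charPair, charSnd_charPair, Ideal.quotientMulEquivQuotientProd_fst,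
    Ideal.quotientMulEquivQuotientProd_snd, Ideal.Quotient.factor_mk, Ideal.Quotient.factor_mk]

lemma isUnit_mk_iff {I : Ideal (𝓞 K)} {c : 𝓞 K} :
    IsUnit (Ideal.Quotient.mk I c) ↔ IsCoprime (Ideal.span {c}) I := by
  constructor
  · intro h
    obtain ⟨t, ht⟩ := h.exists_right_inv
    obtain ⟨t, rfl⟩ := Ideal.Quotient.mk_surjective t
    refine isCoprime_span_of_mul_sub_mem (t := t) ?_
    rw [← Ideal.Quotient.eq, map_mul, ht, map_one]
  · intro h
    obtain ⟨i, hi, j, hj, hij⟩ := Ideal.isCoprime_iff_exists.mp h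
    obtain ⟨t, rfl⟩ := Ideal.mem_span_singleton.mp hi
    refine IsUnit.of_mul_eq_one (Ideal.Quotient.mk I t) ?_
    rw [← map_mul, ← map_one (Ideal.Quotient.mk I), Ideal.Quotient.eq]
    have : c * t - 1 = -j := by linear_combination hij
    rw [this]
    exact neg_mem hj

lemma sq_eq_zero_of_two_mul_eq_zero {l : ℕ} (hl : 2 ≤ l) {P 𝔟 : Ideal (𝓞 K)}
    (hA : Ideal.span {(2 : 𝓞 K) ^ l} = P * 𝔟) (hc : IsCoprime P 𝔟) (d : 𝓞 K ⧸ P)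
    (hd : 2 * d = 0) : d ^ 2 = 0 := by
  obtain ⟨d, rfl⟩ := Ideal.Quotient.mk_surjective d
  have hd' : 2 * d ∈ P := by
    rw [← Ideal.Quotient.eq_zero_iff_mem, map_mul, map_ofNat, hd]
  obtain ⟨x, hx1, hx2⟩ := exists_crt hc d 0
  rw [sub_zero] at hx2
  have h2x : 2 * x ∈ Ideal.span {(2 : 𝓞 K) ^ l} := by
    rw [hA, Ideal.mul_eq_inf_of_isCoprime hc]
    refine ⟨?_, Ideal.mul_mem_left _ _ hx2⟩
    have : 2 * x = 2 * (x - d) + 2 * d := by ring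
    rw [this]
    exact add_mem (Ideal.mul_mem_left _ _ hx1) hd'
  obtain ⟨y, hy⟩ := Ideal.mem_span_singleton.mp h2x
  obtain ⟨m, rfl⟩ : ∃ m, l = m + 2 := ⟨l - 2, by omega⟩
  have hxy : x = 2 ^ (m + 1) * y := by
    apply mul_left_cancel₀ (two_ne_zero (α := 𝓞 K))
    rw [hy]; ring
  have hmk : Ideal.Quotient.mk P d = Ideal.Quotient.mk P x := (Ideal.Quotient.eq.mpr hx1).symm
  rw [hmk, ← map_pow, Ideal.Quotient.eq_zero_iff_mem]
  have : x ^ 2 ∈ Ideal.span {(2 : 𝓞 K) ^ (m + 2)} := by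
    rw [Ideal.mem_span_singleton, hxy]
    exact ⟨2 ^ m * y ^ 2, by ring⟩
  rw [hA] at this
  exact Ideal.mul_le_left this

lemma recSym_mul_left {a b c : 𝓞 K} (ha : a ≠ 0) (hb : b ≠ 0) :
    recSym (a * b) c = recSym a c * recSym b c := by
  have ha' : Ideal.span {a} ≠ ⊥ := by simpa using ha
  have hb' : Ideal.span {b} ≠ ⊥ := by simpa using hb
  rw [recSym, recSym, recSym, quadSym_mul_right, ← Ideal.span_singleton_mul_span_singleton,
    quadSym_mul_left ha' hb']
  ring

lemma recSym_sq {a b : 𝓞 K} (h : IsCoprime (Ideal.span {a}) (Ideal.span {b})) :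
    recSym a b ^ 2 = 1 := by
  rw [recSym, mul_pow, quadSym_sq h, quadSym_sq h.symm, one_mul]

lemma recSym_eq_one_of_posEq {a b : 𝓞 K} (h : IsCoprime (Ideal.span {a}) (Ideal.span {b})) {z : ℂ}
    (hz : z ≠ 0) (hp : PosEq (recSym a b * z) z) : recSym a b = 1 := by
  rcases sq_eq_one_iff.mp (recSym_sq h) with h1 | h1
  · exact h1
  · obtain ⟨r, hr, hrz⟩ := hp
    have h2 : (r : ℂ) + 1 = 0 := by
      refine (mul_eq_zero.mp (?_ : ((r : ℂ) + 1) * z = 0)).resolve_right hz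
      rw [h1] at hrz
      push_cast at hrz
      linear_combination -hrz
    have h3 : r + 1 = 0 := by exact_mod_cast h2
    linarith

section
variable (htot : ∀ φ : K →+* ℂ, ComplexEmbedding.IsReal φ) {l : ℕ} (hl : 2 ≤ l)
  {α β : 𝓞 K} (hα : TotPos α) (hβ : TotPos β)
  (hαo : OddIdeal (Ideal.span {α})) (hβo : OddIdeal (Ideal.span {β}))
  (hαβ : IsCoprime (Ideal.span {α}) (Ideal.span {β}))
include htot hl hα hβ hαo hβo hαβ

lemma recSym_eq_one_of_sq {s : 𝓞 K} (hs : α - s ^ 2 ∈ Ideal.span {(2 : 𝓞 K) ^ l}) :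
    recSym α β = 1 := by
  have hl0 : l ≠ 0 := by omega
  have hA : Ideal.span {(2 : 𝓞 K) ^ l} ≠ ⊥ := by simp
  have := Ideal.finiteQuotientOfFreeOfNeBot _ hA
  obtain ⟨ψ, hψ⟩ := exists_isPrimitive_quotient hA htot
  have H := posEq_recSym_quadW htot hl hα hβ hαo hβo hαβ ψ hψ
  have e : Ideal.Quotient.mk (Ideal.span {(2 : 𝓞 K) ^ l}) α = Ideal.Quotient.mk _ s ^ 2 := by
    rw [← map_pow]; exact Ideal.Quotient.eq.mpr hs
  have hu := isUnit_mk_iff.mpr ((isCoprime_two_pow_iff hl0).mpr hαo)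
  have hu' := isUnit_mk_iff.mpr ((isCoprime_two_pow_iff hl0).mpr hβo)
  have hus : IsUnit (Ideal.Quotient.mk (Ideal.span {(2 : 𝓞 K) ^ l}) s) := by
    rw [e] at hu
    exact (isUnit_pow_iff two_ne_zero).mp hu
  rw [map_mul, e, quadW_sq_mul _ _ hus, ← mul_one (Ideal.Quotient.mk _ s ^ 2),
    quadW_sq_mul _ _ hus] at H
  have h2 := sq_eq_zero_of_two_mul_eq_zero (K := K) hl (mul_one _).symm isCoprime_one_right
  exact recSym_eq_one_of_posEq hαβ
    (mul_ne_zero (quadW_ne_zero hψ isUnit_one h2) (quadW_ne_zero hψ hu' h2)) H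

lemma posEq_recSym_quadW_local {P 𝔟 : Ideal (𝓞 K)} (hA : Ideal.span {(2 : 𝓞 K) ^ l} = P * 𝔟)
    (hc : IsCoprime P 𝔟) (hα1 : α - 1 ∈ 𝔟) {ψ : AddChar (𝓞 K ⧸ P) ℂ} (hψ : ψ.IsPrimitive) :
    PosEq (recSym α β * (quadW ψ 1 * quadW ψ (Ideal.Quotient.mk _ (α * β))))
      (quadW ψ (Ideal.Quotient.mk _ α) * quadW ψ (Ideal.Quotient.mk _ β)) := by
  have hl0 : l ≠ 0 := by omega
  have hA0 : Ideal.span {(2 : 𝓞 K) ^ l} ≠ ⊥ := by simp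
  have hP0 : P ≠ ⊥ := by rintro rfl; exact hA0 (by rw [hA, Ideal.bot_mul])
  have hb0 : 𝔟 ≠ ⊥ := by rintro rfl; exact hA0 (by rw [hA, Ideal.mul_bot])
  obtain ⟨ψ₂, hψ₂⟩ := exists_isPrimitive_quotient hb0 htot
  have hcop : IsCoprime (Ideal.span {β}) (P * 𝔟) := hA ▸ (isCoprime_two_pow_iff hl0).mpr hβo
  have := Ideal.finiteQuotientOfFreeOfNeBot _ hb0
  have h2 := sq_eq_zero_of_two_mul_eq_zero hl (hA.trans (mul_comm P 𝔟)) hc.symm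
  obtain ⟨ψ', hψ', H⟩ := exists_quadW_mul hP0 hb0 hc hψ hψ₂
  have key : ∀ (A : Ideal (𝓞 K)) (_ : Ideal.span {(2 : 𝓞 K) ^ l} = A) (ψ : AddChar (𝓞 K ⧸ A) ℂ)
      (_ : ψ.IsPrimitive),
      PosEq (recSym α β * (quadW ψ 1 * quadW ψ (Ideal.Quotient.mk _ (α * β))))
        (quadW ψ (Ideal.Quotient.mk _ α) * quadW ψ (Ideal.Quotient.mk _ β)) := by
    rintro A rfl ψ hψ
    exact posEq_recSym_quadW htot hl hα hβ hαo hβo hαβ ψ hψ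
  have h := key _ hA ψ' hψ'
  have e : Ideal.Quotient.mk 𝔟 α = 1 := by rw [← map_one (Ideal.Quotient.mk 𝔟)]; exact Ideal.Quotient.eq.mpr hα1
  have eβ : Ideal.Quotient.mk 𝔟 (α * β) = Ideal.Quotient.mk 𝔟 β := by rw [map_mul, e, one_mul]
  have H1 := H 1
  rw [map_one, map_one, map_one] at H1
  rw [H1, H, H, H, e, eβ] at h
  refine PosEq.of_mul_left (c := quadW ψ₂ 1 * quadW ψ₂ (Ideal.Quotient.mk 𝔟 β)) (mul_ne_zero
    (quadW_ne_zero hψ₂ isUnit_one h2)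
    (quadW_ne_zero hψ₂ (isUnit_mk_iff.mpr hcop.of_mul_right_right) h2)) ?_
  convert h using 1 <;> ring

end

section
open IsDedekindDomain WithZero Topology

variable (v : HeightOneSpectrum (𝓞 K))

lemma algebraMap_adicCompletion_val (k : K) :
    Valued.v (algebraMap K (v.adicCompletion K) k) = v.valuation K k := by
  rw [HeightOneSpectrum.algebraMap_adicCompletion]
  exact HeightOneSpectrum.valuedAdicCompletion_eq_valuation' v k

lemma adicVal_le_iff (a : 𝓞 K) (N : ℕ) :
    Valued.v (algebraMap K (v.adicCompletion K) (algebraMap (𝓞 K) K a)) ≤ exp (-(N : ℤ)) ↔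
      a ∈ v.asIdeal ^ N := by
  rw [algebraMap_adicCompletion_val, HeightOneSpectrum.valuation_of_algebraMap]
  exact v.intValuation_le_pow_iff_mem a N

lemma adicVal_integer_le_one (a : 𝓞 K) :
    Valued.v (algebraMap K (v.adicCompletion K) (algebraMap (𝓞 K) K a)) ≤ 1 := by
  have := (adicVal_le_iff v a 0).mpr (by simp)
  simpa using this

lemma exists_exp_neg_le_of_ne_zero {g : ℤᵐ⁰} (hg : g ≠ 0) : ∃ N : ℕ, exp (-(N : ℤ)) < g := by
  refine ⟨(1 - log g).toNat, ?_⟩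
  conv_rhs => rw [← exp_log hg]
  rw [exp_lt_exp]
  omega

lemma exists_le_exp (g : ℤᵐ⁰) : ∃ j : ℕ, g ≤ exp (j : ℤ) := by
  rcases eq_or_ne g 0 with rfl | hg
  · exact ⟨0, zero_le⟩
  · refine ⟨(log g).toNat, ?_⟩
    conv_lhs => rw [← exp_log hg]
    rw [exp_le_exp]
    omega

lemma eq_zero_of_forall_adicVal_le {x : v.adicCompletion K}
    (h : ∀ N : ℕ, Valued.v x ≤ exp (-(N : ℤ))) : x = 0 := by
  by_contra hx
  obtain ⟨N, hN⟩ := exists_exp_neg_le_of_ne_zero ((Valuation.ne_zero_iff Valued.v).mpr hx)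
  exact (h N).not_gt hN

lemma exists_two_pow_mul_adicVal_le_one (h2 : (2 : 𝓞 K) ∈ v.asIdeal) (x : v.adicCompletion K) :
    ∃ j : ℕ, ∀ i, j ≤ i → Valued.v (2 ^ i * x) ≤ 1 := by
  obtain ⟨j, hj⟩ := exists_le_exp (Valued.v x)
  refine ⟨j, fun i hi => ?_⟩
  have h := (adicVal_le_iff v (2 ^ i) i).mpr (Ideal.pow_mem_pow h2 i)
  simp only [map_pow, map_ofNat] at h
  rw [map_mul, map_pow]
  calc _ ≤ exp (-(i : ℤ)) * exp (j : ℤ) := mul_le_mul' h hj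
    _ ≤ 1 := by
      rw [← exp_add, ← exp_zero, exp_le_exp]
      omega

lemma adicVal_ball_mem_nhds (x : v.adicCompletion K) (N : ℕ) :
    {y | Valued.v (y - x) ≤ exp (-(N : ℤ))} ∈ 𝓝 x := by
  obtain ⟨π, hπ⟩ := v.intValuation_exists_uniformizer
  have hv : Valued.v (algebraMap K (v.adicCompletion K) (algebraMap (𝓞 K) K (π ^ N))) =
      exp (-(N : ℤ)) := by
    rw [algebraMap_adicCompletion_val, HeightOneSpectrum.valuation_of_algebraMap, map_pow, hπ,
      ← exp_nsmul]
    simp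
  rw [Valued.mem_nhds]
  have h0 : (Valued.v : Valuation (v.adicCompletion K) ℤᵐ⁰).restrict
      (algebraMap K (v.adicCompletion K) (algebraMap (𝓞 K) K (π ^ N))) ≠ 0 := by
    rw [Ne, Valuation.restrict_eq_zero_iff, hv]
    exact exp_ne_zero
  refine ⟨Units.mk0 _ h0, fun y hy => ?_⟩
  have : Valued.v.restrict (y - x) < Valued.v.restrict
      (algebraMap K (v.adicCompletion K) (algebraMap (𝓞 K) K (π ^ N))) := hy
  rw [Valuation.restrict_lt_iff, hv] at this
  exact this.le

lemma exists_integer_adicVal_sub_le {x : v.adicCompletion K} (hx : Valued.v x ≤ 1) (N : ℕ) :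
    ∃ a : 𝓞 K, Valued.v (x - algebraMap K (v.adicCompletion K) (algebraMap (𝓞 K) K a)) ≤
      exp (-(N : ℤ)) := by
  obtain ⟨_, ⟨k, rfl⟩, hy⟩ := (HeightOneSpectrum.denseRange_algebraMap (K := K) (v := v)).inter_nhds_nonempty
    (adicVal_ball_mem_nhds v x N)
  have hk : v.valuation K k ≤ 1 := by
    rw [← algebraMap_adicCompletion_val,
      ← sub_add_cancel (algebraMap K (v.adicCompletion K) k) x]
    refine (Valuation.map_add _ _ _).trans (max_le (hy.trans ?_) hx)
    rw [← exp_zero, exp_le_exp]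
    omega
  obtain ⟨a, ha⟩ := v.exists_valuation_sub_lt_of_integer hk
    (Units.mk0 (exp (-(N : ℤ))) exp_ne_zero)
  refine ⟨a, ?_⟩
  rw [← sub_add_sub_cancel x (algebraMap K (v.adicCompletion K) k)]
  refine (Valuation.map_add _ _ _).trans (max_le ?_ ?_)
  · rw [Valuation.map_sub_swap]; exact hy
  · rw [← map_sub, algebraMap_adicCompletion_val, Valuation.map_sub_swap]
    exact ha.le

lemma exists_adicCompletion_limit {r : ℕ → 𝓞 K} (hr : ∀ N, r (N + 1) - r N ∈ v.asIdeal ^ N) :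
    ∃ x : v.adicCompletion K, ∀ N : ℕ,
      Valued.v (x - algebraMap K (v.adicCompletion K) (algebraMap (𝓞 K) K (r N))) ≤
        exp (-(N : ℤ)) := by
  have hr' : ∀ N M, N ≤ M → r M - r N ∈ v.asIdeal ^ N := by
    intro N M h
    induction M, h using Nat.le_induction with
    | base => simp
    | succ M h ih =>
      rw [← sub_add_sub_cancel _ (r M)]
      exact add_mem (Ideal.pow_le_pow_right h (hr M)) ih
  set u : ℕ → v.adicCompletion K :=
    fun N => algebraMap K (v.adicCompletion K) (algebraMap (𝓞 K) K (r N)) with hu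
  have hd : ∀ N M, N ≤ M → Valued.v (u M - u N) ≤ exp (-(N : ℤ)) := by
    intro N M h
    simp only [hu, ← map_sub]
    exact (adicVal_le_iff v _ N).mpr (hr' N M h)
  have hc : CauchySeq u := by
    rw [CauchySeq, Valued.cauchy_iff]
    refine ⟨inferInstance, fun γ => ?_⟩
    obtain ⟨N, hN⟩ := exists_exp_neg_le_of_ne_zero
      (g := MonoidWithZeroHom.ValueGroup₀.embedding γ.1) (by simp)
    refine ⟨u '' Set.Ici N, Filter.image_mem_map (Filter.mem_atTop N), ?_⟩
    rintro _ ⟨i, hi, rfl⟩ _ ⟨j, hj, rfl⟩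
    rw [Valuation.restrict_lt_iff_lt_embedding]
    refine lt_of_le_of_lt ?_ hN
    rw [← sub_add_sub_cancel (u j) (u N)]
    refine (Valuation.map_add _ _ _).trans (max_le (hd _ _ hj) ?_)
    rw [Valuation.map_sub_swap]
    exact hd _ _ hi
  obtain ⟨x, hx⟩ := cauchySeq_tendsto_of_complete hc
  refine ⟨x, fun N => ?_⟩
  obtain ⟨M, hM, hNM⟩ := ((hx.eventually (adicVal_ball_mem_nhds v x N)).and
    (Filter.eventually_ge_atTop N)).exists
  change Valued.v (x - u N) ≤ _
  rw [← sub_add_sub_cancel x (u M)]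
  refine (Valuation.map_add _ _ _).trans (max_le ?_ (hd _ _ hNM))
  rw [Valuation.map_sub_swap]
  exact hM

end

lemma quadSym_eq_one_of_forall_prime {𝔪 : Ideal (𝓞 K)} {c : 𝓞 K}
    (h : ∀ 𝔭 : Ideal (𝓞 K), 𝔭.IsPrime → 𝔪 ≤ 𝔭 →
      ∃ s u : 𝓞 K, s ∉ 𝔭 ∧ u ∉ 𝔭 ∧ c * u ^ 2 - s ^ 2 ∈ 𝔭) : quadSym 𝔪 c = 1 := by
  rw [quadSym]
  refine Multiset.prod_eq_one fun x hx => ?_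
  obtain ⟨𝔭, h𝔭, rfl⟩ := Multiset.mem_map.mp hx
  have hp := UniqueFactorizationMonoid.prime_of_normalized_factor _ h𝔭
  have hprime := Ideal.isPrime_of_prime hp
  obtain ⟨s, u, hs, hu, hc⟩ := h 𝔭 hprime
    (Ideal.le_of_dvd (UniqueFactorizationMonoid.dvd_of_mem_normalizedFactors h𝔭))
  have hmod : legSym 𝔭 (c * u ^ 2) = legSym 𝔭 (s ^ 2) := by
    rw [legSym, legSym, Ideal.Quotient.eq.mpr hc]
  rw [legSym_mul hp, sq, sq, legSym_mul hp, legSym_mul hp, legSym_sq_of_notMem hs,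
    legSym_sq_of_notMem hu, mul_one] at hmod
  exact hmod

lemma exists_pow_sub_one_mul_mem (x : 𝓞 K) (hx : x ≠ 0) :
    ∃ i d : ℕ, 0 < d ∧ (2 : 𝓞 K) ^ i * (2 ^ d - 1) ∈ Ideal.span {x} := by
  have hx' : Ideal.span {x} ≠ ⊥ := by simpa using hx
  have := Ideal.finiteQuotientOfFreeOfNeBot _ hx'
  obtain ⟨i, j, hij, h⟩ : ∃ i j : ℕ, i < j ∧
      Ideal.Quotient.mk (Ideal.span {x}) 2 ^ i = Ideal.Quotient.mk (Ideal.span {x}) 2 ^ j := by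
    obtain ⟨i, j, hij, h⟩ := Finite.exists_ne_map_eq_of_infinite
      (fun n : ℕ => Ideal.Quotient.mk (Ideal.span {x}) 2 ^ n)
    rcases hij.lt_or_gt with hlt | hlt
    · exact ⟨i, j, hlt, h⟩
    · exact ⟨j, i, hlt, h.symm⟩
  refine ⟨i, j - i, by omega, ?_⟩
  rw [mul_sub, ← pow_add, Nat.add_sub_cancel' hij.le, mul_one, ← Ideal.Quotient.eq]
  simpa using h.symm

lemma recSym_eq_one_of_norm (htot : ∀ φ : K →+* ℂ, ComplexEmbedding.IsReal φ) {l : ℕ} (hl : 2 ≤ l)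
    {a β : 𝓞 K} (ha : TotPos a) (hβ : TotPos β)
    (hao : OddIdeal (Ideal.span {a})) (hβo : OddIdeal (Ideal.span {β}))
    (haβ : IsCoprime (Ideal.span {a}) (Ideal.span {β})) {j : ℕ} {z y : 𝓞 K}
    (h : z ^ 2 - β * y ^ 2 - 4 ^ j * a ∈ Ideal.span {(2 : 𝓞 K) ^ (l + 2 * j)}) :
    recSym a β = 1 := by
  set L := l + 2 * j with hL
  have hβ0 := hβ.ne_zero htot
  have ha0 := ha.ne_zero htot
  obtain ⟨y₁, hy0, hy⟩ : ∃ y₁ : 𝓞 K, y₁ ≠ 0 ∧ (2 : 𝓞 K) ^ L ∣ y₁ - y := by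
    rcases eq_or_ne y 0 with rfl | hy
    · exact ⟨2 ^ L, by simp, by simp⟩
    · exact ⟨y, hy, by simp⟩
  obtain ⟨i, d, hd, hid⟩ := exists_pow_sub_one_mul_mem (y₁ * β) (mul_ne_zero hy0 hβ0)
  set D : ℕ := 2 ^ d - 1 with hD
  have hDc : (D : 𝓞 K) = 2 ^ d - 1 := by
    rw [hD, Nat.cast_sub Nat.one_le_two_pow]; simp
  have hDpos : 0 < D := by
    have := Nat.one_lt_two_pow hd.ne'
    omega
  have hcop : IsCoprime (Ideal.span {(2 : 𝓞 K) ^ L}) (Ideal.span {(D : 𝓞 K)}) := by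
    rw [← Ideal.span_singleton_pow]
    refine IsCoprime.pow_left (isCoprime_span_of_mul_sub_mem (t := 2 ^ (d - 1)) ?_)
    rw [← pow_succ', Nat.sub_add_cancel hd, hDc]
    exact Ideal.mem_span_singleton_self _
  obtain ⟨z₀, hz₀, hz₀'⟩ := exists_crt hcop z 1
  obtain ⟨N, hN⟩ := exists_nat_forall_lt (z₀ - β * y₁ ^ 2 - 1)
  set M : ℕ := N * (2 ^ L * D) with hM
  have hNM : N ≤ M := Nat.le_mul_of_pos_right _ (by positivity)
  set z₁ := z₀ + (M : 𝓞 K) with hz₁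
  have hMc : (M : 𝓞 K) = N * (2 ^ L * D) := by rw [hM]; push_cast; ring
  have hz2 : (2 : 𝓞 K) ^ L ∣ z₁ - z := by
    have h1 := Ideal.mem_span_singleton.mp hz₀
    have : z₁ - z = (z₀ - z) + 2 ^ L * (N * D) := by rw [hz₁, hMc]; ring
    rw [this]
    exact dvd_add h1 (dvd_mul_right _ _)
  have hzD : (D : 𝓞 K) ∣ z₁ - 1 := by
    have h1 := Ideal.mem_span_singleton.mp hz₀'
    have : z₁ - 1 = (z₀ - 1) + D * (N * 2 ^ L) := by rw [hz₁, hMc]; ring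
    rw [this]
    exact dvd_add h1 (dvd_mul_right _ _)
  have h1 : (2 : 𝓞 K) ^ L ∣ z₁ ^ 2 - β * y₁ ^ 2 - 4 ^ j * a := by
    have : z₁ ^ 2 - β * y₁ ^ 2 - 4 ^ j * a = (z ^ 2 - β * y ^ 2 - 4 ^ j * a) +
        (z₁ - z) * (z₁ + z) - (y₁ - y) * (β * (y₁ + y)) := by ring
    rw [this]
    exact dvd_sub (dvd_add (Ideal.mem_span_singleton.mp h) (hz2.mul_right _)) (hy.mul_right _)
  obtain ⟨t, ht⟩ := h1
  have h4 : (2 : 𝓞 K) ^ L = 4 ^ j * 2 ^ l := by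
    rw [hL, pow_add, pow_mul]; norm_num; ring
  set a' := a + 2 ^ l * t with ha'
  have hnorm : z₁ ^ 2 - β * y₁ ^ 2 = 4 ^ j * a' := by
    rw [ha', mul_add, ← mul_assoc, ← h4, ← ht]; ring
  have hpos : TotPos a' := by
    intro v
    have e := congrArg (fun x : 𝓞 K => v (x : K)) hnorm
    have hN' := hN v M hNM
    have hb := hβ v
    simp only [hz₁, RingOfIntegers.coe_eq_algebraMap, map_mul, map_pow, map_ofNat, map_natCast,
      map_add, map_sub, map_one] at e hN' hb ⊢
    have hy2 : 0 ≤ v (algebraMap (𝓞 K) K β) * v (algebraMap (𝓞 K) K y₁) ^ 2 := by positivity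
    have : (0 : ℝ) < 4 ^ j * v (algebraMap (𝓞 K) K a') := by
      rw [← e]; nlinarith
    exact pos_of_mul_pos_right this (by positivity)
  have hw : ∀ w : Ideal (𝓞 K), w.IsPrime → (2 : 𝓞 K) ∉ w → (y₁ ∈ w ∨ β ∈ w) → z₁ ∉ w := by
    intro w hw h2 hor hz
    have h3 : y₁ * β ∈ w := hor.elim (fun h => w.mul_mem_right _ h) (fun h => w.mul_mem_left _ h)
    have h5 : (2 : 𝓞 K) ^ i * (2 ^ d - 1) ∈ w :=
      (Ideal.span_singleton_le_iff_mem _).mpr h3 hid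
    have h6 : (D : 𝓞 K) ∈ w := hDc ▸
      ((hw.mem_or_mem h5).resolve_left fun h => h2 (hw.mem_of_pow_mem _ h))
    have h7 : z₁ - 1 ∈ w := Ideal.mem_of_dvd _ hzD h6
    exact hw.ne_top ((Ideal.eq_top_iff_one _).mpr (by simpa using sub_mem hz h7))
  have hodd : ∀ {b : 𝓞 K}, OddIdeal (Ideal.span {b}) → ∀ w : Ideal (𝓞 K), w.IsPrime → b ∈ w →
      (2 : 𝓞 K) ∉ w := by
    intro b hb w hw hbw h2
    exact ideal_coprime_iff_forall_prime.mp hb w hw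
      ((Ideal.span_singleton_le_iff_mem _).mpr hbw) ((Ideal.span_singleton_le_iff_mem _).mpr h2)
  have hl0 : l ≠ 0 := by omega
  have ha'o : OddIdeal (Ideal.span {a'}) := by
    rw [← isCoprime_two_pow_iff hl0] at hao ⊢
    refine isCoprime_span_of_sub_mem (t := a) ?_ hao
    rw [Ideal.mem_span_singleton, ha', add_sub_cancel_left]
    exact dvd_mul_right _ _
  have ha'β : IsCoprime (Ideal.span {a'}) (Ideal.span {β}) := by
    rw [ideal_coprime_iff_forall_prime]
    intro w hp h1 h2
    rw [Ideal.span_singleton_le_iff_mem] at h1 h2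
    have h3 : z₁ ^ 2 ∈ w := by
      rw [sub_eq_iff_eq_add.mp hnorm]
      exact add_mem (w.mul_mem_left _ h1) (w.mul_mem_right _ h2)
    exact hw w hp (hodd hβo w hp h2) (Or.inr h2) (hp.mem_of_pow_mem _ h3)
  have hR' : recSym a' β = 1 := by
    rw [recSym, quadSym_eq_one_of_forall_prime (c := a'),
      quadSym_eq_one_of_forall_prime (c := β), one_mul]
    · intro w hp h1
      rw [Ideal.span_singleton_le_iff_mem] at h1
      have h2 := hodd ha'o w hp h1
      have hmem : z₁ ^ 2 - β * y₁ ^ 2 ∈ w := hnorm ▸ w.mul_mem_left _ h1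
      have hyw : y₁ ∉ w := by
        intro hy1
        refine hw w hp h2 (Or.inl hy1) (hp.mem_of_pow_mem 2 ?_)
        have := add_mem hmem (w.mul_mem_left β (Ideal.pow_mem_of_mem w hy1 2 two_pos))
        simpa using this
      have hβw : β ∉ w := fun hb => ideal_coprime_iff_forall_prime.mp ha'β w hp
        ((Ideal.span_singleton_le_iff_mem _).mpr h1) ((Ideal.span_singleton_le_iff_mem _).mpr hb)
      refine ⟨z₁, y₁, fun hz => ?_, hyw, ?_⟩
      · have : β * y₁ ^ 2 ∈ w := by
          have := sub_mem (Ideal.pow_mem_of_mem w hz 2 two_pos) hmem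
          simpa using this
        exact (hp.mem_or_mem this).elim hβw fun h => hyw (hp.mem_of_pow_mem _ h)
      · rw [← neg_sub]; exact neg_mem hmem
    · intro w hp h1
      rw [Ideal.span_singleton_le_iff_mem] at h1
      have h2 := hodd hβo w hp h1
      refine ⟨z₁, 2 ^ j, hw w hp h2 (Or.inr h1), fun h => h2 (hp.mem_of_pow_mem _ h), ?_⟩
      have : a' * (2 ^ j) ^ 2 - z₁ ^ 2 = - (β * y₁ ^ 2) := by
        rw [← pow_mul, mul_comm j, pow_mul]
        norm_num
        rw [mul_comm, ← hnorm]; ring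
      rw [this]
      exact neg_mem (w.mul_mem_right _ h1)
  have hsq : recSym (a' * a) β = 1 := by
    refine recSym_eq_one_of_sq htot hl (hpos.mul ha) hβ ?_ hβo ?_ (s := a) ?_
    · rw [← Ideal.span_singleton_mul_span_singleton]; exact ha'o.mul_left hao
    · rw [← Ideal.span_singleton_mul_span_singleton]; exact ha'β.mul_left haβ
    · rw [Ideal.mem_span_singleton, ha']
      exact ⟨t * a, by ring⟩
  rwa [recSym_mul_left (hpos.ne_zero htot) ha0, hR', one_mul] at hsq

section
open IsDedekindDomain WithZero

variable (v : HeightOneSpectrum (𝓞 K))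

lemma adicVal_integer_mul_le {x : v.adicCompletion K} {N : ℕ} (hx : Valued.v x ≤ exp (-(N : ℤ)))
    {y : v.adicCompletion K} (hy : Valued.v y ≤ 1) : Valued.v (x * y) ≤ exp (-(N : ℤ)) := by
  rw [map_mul]
  simpa using mul_le_mul' hx hy

lemma exists_norm_sub_mem_of_hilbSym_eq_one (h2 : (2 : 𝓞 K) ∈ v.asIdeal) {α β : 𝓞 K} (hβ : β ≠ 0)
    (h : hilbSym v (α : K) (β : K) = 1) :
    ∃ j : ℕ, ∀ M : ℕ, ∃ z y : 𝓞 K, z ^ 2 - β * y ^ 2 - 4 ^ j * α ∈ v.asIdeal ^ M := by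
  rw [hilbSym] at h
  split_ifs at h with hs
  obtain ⟨x, y, z, hne, hxyz⟩ := hs
  simp only [RingOfIntegers.coe_eq_algebraMap] at hxyz
  set ι : 𝓞 K → v.adicCompletion K := fun a => algebraMap K _ (algebraMap (𝓞 K) K a) with hι
  have hιβ : ι β ≠ 0 := by simpa [hι] using hβ
  have h20 : (2 : v.adicCompletion K) ≠ 0 := by
    rw [← map_ofNat (algebraMap K (v.adicCompletion K)) 2]
    exact (map_ne_zero _).mpr two_ne_zero
  change ι α * x ^ 2 + ι β * y ^ 2 = z ^ 2 at hxyz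
  obtain ⟨Z, Y, hZY⟩ : ∃ Z Y : v.adicCompletion K, Z ^ 2 - ι β * Y ^ 2 = ι α := by
    rcases eq_or_ne x 0 with rfl | hx
    · have hy : y ≠ 0 := by
        rintro rfl
        refine hne ⟨rfl, rfl, ?_⟩
        simpa using hxyz.symm
      have hz : z ≠ 0 := by
        rintro rfl
        simp [hy, hιβ] at hxyz
      have e : ι β * y ^ 2 = z ^ 2 := by simpa using hxyz
      refine ⟨(ι α + 1) / 2, (ι α - 1) * y / (2 * z), ?_⟩
      field_simp
      linear_combination (-(ι α - 1) ^ 2) * e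
    · refine ⟨z / x, y / x, ?_⟩
      field_simp
      linear_combination -hxyz
  obtain ⟨j₁, hj₁⟩ := exists_two_pow_mul_adicVal_le_one v h2 Z
  obtain ⟨j₂, hj₂⟩ := exists_two_pow_mul_adicVal_le_one v h2 Y
  set j := max j₁ j₂
  have hZ := hj₁ j (le_max_left _ _)
  have hY := hj₂ j (le_max_right _ _)
  refine ⟨j, fun M => ?_⟩
  obtain ⟨a, ha⟩ := exists_integer_adicVal_sub_le v hZ M
  obtain ⟨b, hb⟩ := exists_integer_adicVal_sub_le v hY M
  refine ⟨a, b, (adicVal_le_iff v _ M).mp ?_⟩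
  have e : algebraMap K (v.adicCompletion K) (algebraMap (𝓞 K) K (a ^ 2 - β * b ^ 2 - 4 ^ j * α)) =
      (2 ^ j * Y - ι b) * (ι β * (2 ^ j * Y + ι b)) - (2 ^ j * Z - ι a) * (2 ^ j * Z + ι a) := by
    have h4 : (4 : v.adicCompletion K) ^ j = 2 ^ j * 2 ^ j := by
      rw [← mul_pow]; norm_num
    simp only [map_sub, map_mul, map_pow, map_ofNat]
    change ι a ^ 2 - ι β * ι b ^ 2 - 4 ^ j * ι α = _
    rw [h4, ← hZY]
    ring
  rw [e]
  refine (Valuation.map_sub _ _ _).trans (max_le ?_ ?_)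
  · refine adicVal_integer_mul_le v hb ?_
    rw [map_mul]
    exact mul_le_one' (adicVal_integer_le_one v β)
      ((Valuation.map_add _ _ _).trans (max_le hY (adicVal_integer_le_one v b)))
  · exact adicVal_integer_mul_le v ha
      ((Valuation.map_add _ _ _).trans (max_le hZ (adicVal_integer_le_one v a)))

lemma exists_eq_pow_mul_isCoprime {I : Ideal (𝓞 K)} (hI : I ≠ ⊥) :
    ∃ (r : ℕ) (𝔠 : Ideal (𝓞 K)), I = v.asIdeal ^ r * 𝔠 ∧ IsCoprime v.asIdeal 𝔠 := by
  have hf : FiniteMultiplicity v.asIdeal I :=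
    FiniteMultiplicity.of_not_isUnit (Ideal.isUnit_iff.not.mpr v.isPrime.ne_top) hI
  obtain ⟨𝔠, h, hn⟩ := hf.exists_eq_pow_mul_and_not_dvd
  refine ⟨_, 𝔠, h, ?_⟩
  rw [Ideal.isCoprime_iff_sup_eq]
  by_contra hne
  have := v.isMaximal.eq_of_le hne le_sup_left
  exact hn (Ideal.dvd_iff_le.mpr (this ▸ le_sup_right))

lemma recSym_eq_one_of_hilbSym (htot : ∀ φ : K →+* ℂ, ComplexEmbedding.IsReal φ) {l : ℕ}
    (hl : 2 ≤ l) (h2 : (2 : 𝓞 K) ∈ v.asIdeal) {α β a : 𝓞 K} (hβ : TotPos β) (ha : TotPos a)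
    (hβo : OddIdeal (Ideal.span {β})) (hao : OddIdeal (Ideal.span {a}))
    (haβ : IsCoprime (Ideal.span {a}) (Ideal.span {β})) {k : ℕ} {𝔟 : Ideal (𝓞 K)}
    (hA : Ideal.span {(2 : 𝓞 K) ^ l} = v.asIdeal ^ k * 𝔟) (hc : IsCoprime v.asIdeal 𝔟)
    (haα : a - α ∈ v.asIdeal ^ k) (ha1 : a - 1 ∈ 𝔟)
    (h : hilbSym v (α : K) (β : K) = 1) : recSym a β = 1 := by
  obtain ⟨j, hj⟩ := exists_norm_sub_mem_of_hilbSym_eq_one v h2 (hβ.ne_zero htot) h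
  obtain ⟨r, 𝔠, hr, hrc⟩ := exists_eq_pow_mul_isCoprime v
    (I := Ideal.span {(2 : 𝓞 K) ^ (2 * j)}) (by simp)
  obtain ⟨z, y, hzy⟩ := hj (k + r)
  have hL : Ideal.span {(2 : 𝓞 K) ^ (l + 2 * j)} = v.asIdeal ^ (k + r) * (𝔟 * 𝔠) := by
    rw [pow_add, ← Ideal.span_singleton_mul_span_singleton, hA, hr, pow_add]
    ring
  have hcop : IsCoprime (v.asIdeal ^ (k + r)) (𝔟 * 𝔠) := (hc.mul_right hrc).pow_left
  obtain ⟨z₁, hz, hz'⟩ := exists_crt hcop z (2 ^ j)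
  obtain ⟨y₁, hy, hy'⟩ := exists_crt hcop y 0
  have h4 : (4 : 𝓞 K) ^ j = 2 ^ (2 * j) := by rw [pow_mul]; norm_num
  have h4m : (4 : 𝓞 K) ^ j ∈ v.asIdeal ^ r * 𝔠 := by
    rw [← hr, h4]; exact Ideal.mem_span_singleton_self _
  have h4r : (4 : 𝓞 K) ^ j ∈ v.asIdeal ^ r := Ideal.mul_le_left h4m
  have h4c : (4 : 𝓞 K) ^ j ∈ 𝔠 := Ideal.mul_le_right h4m
  refine recSym_eq_one_of_norm htot hl ha hβ hao hβo haβ (j := j) (z := z₁) (y := y₁) ?_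
  rw [hL, Ideal.mul_eq_inf_of_isCoprime hcop]
  refine ⟨?_, ?_⟩
  · have e : z₁ ^ 2 - β * y₁ ^ 2 - 4 ^ j * a = (z ^ 2 - β * y ^ 2 - 4 ^ j * α) +
        (z₁ + z) * (z₁ - z) - (β * (y₁ + y)) * (y₁ - y) - (a - α) * 4 ^ j := by ring
    rw [e]
    refine sub_mem (sub_mem (add_mem hzy (Ideal.mul_mem_left _ _ hz)) (Ideal.mul_mem_left _ _ hy)) ?_
    rw [pow_add]
    exact Ideal.mul_mem_mul haα h4r
  · have e : z₁ ^ 2 - β * y₁ ^ 2 - 4 ^ j * a =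
        (z₁ + 2 ^ j) * (z₁ - 2 ^ j) - (β * y₁) * (y₁ - 0) - (a - 1) * 4 ^ j := by
      rw [h4, pow_mul']; ring
    rw [e]
    exact sub_mem (sub_mem (Ideal.mul_mem_left _ _ hz') (Ideal.mul_mem_left _ _ hy'))
      (Ideal.mul_mem_mul ha1 h4c)

end

section
open IsDedekindDomain WithZero

variable (v : HeightOneSpectrum (𝓞 K))

lemma exists_forall_mem_of_anisotropic {ι : Type*} [Fintype ι] (c : ι → 𝓞 K)
    (h : ∀ x : ι → v.adicCompletion K,
      ∑ i, algebraMap K (v.adicCompletion K) (algebraMap (𝓞 K) K (c i)) * x i ^ 2 = 0 → x = 0) :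
    ∃ k : ℕ, ∀ x : ι → 𝓞 K, ∑ i, c i * x i ^ 2 ∈ v.asIdeal ^ k → ∀ i, x i ∈ v.asIdeal := by
  by_contra hcon
  push Not at hcon
  choose X hX hX' using hcon
  set U : Ultrafilter ℕ := Filter.hyperfilter ℕ
  have hr : ∀ (i : ι) (N : ℕ), ∃ r : 𝓞 K, ∀ᶠ n in U, X n i - r ∈ v.asIdeal ^ N := by
    intro i N
    have := Ideal.finiteQuotientOfFreeOfNeBot (v.asIdeal ^ N) (pow_ne_zero N v.ne_bot)
    obtain ⟨b, hb⟩ := Ultrafilter.eq_pure_of_finite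
      (U.map fun n => Ideal.Quotient.mk (v.asIdeal ^ N) (X n i))
    obtain ⟨r, rfl⟩ := Ideal.Quotient.mk_surjective b
    refine ⟨r, ?_⟩
    have h1 : {Ideal.Quotient.mk (v.asIdeal ^ N) r} ∈
        U.map fun n => Ideal.Quotient.mk (v.asIdeal ^ N) (X n i) := by
      rw [hb]; exact Ultrafilter.mem_pure.mpr rfl
    rw [Ultrafilter.mem_map] at h1
    filter_upwards [h1] with n hn
    exact Ideal.Quotient.eq.mp hn
  choose r hr using hr
  have hlim : ∀ i, ∃ x : v.adicCompletion K, ∀ N : ℕ,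
      Valued.v (x - algebraMap K (v.adicCompletion K) (algebraMap (𝓞 K) K (r i N))) ≤
        exp (-(N : ℤ)) := by
    refine fun i => exists_adicCompletion_limit v fun N => ?_
    obtain ⟨n, h1, h2⟩ := ((hr i (N + 1)).and (hr i N)).exists
    have := sub_mem h2 (Ideal.pow_le_pow_right N.le_succ h1)
    simpa using this
  choose x hx using hlim
  have hXx : ∀ N : ℕ, ∀ᶠ n in U, ∀ i,
      Valued.v (x i - algebraMap K (v.adicCompletion K) (algebraMap (𝓞 K) K (X n i))) ≤
        exp (-(N : ℤ)) := by
    intro N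
    rw [Filter.eventually_all]
    intro i
    filter_upwards [hr i N] with n hn
    rw [← sub_sub_sub_cancel_right _ _
      (algebraMap K (v.adicCompletion K) (algebraMap (𝓞 K) K (r i N))), ← map_sub, ← map_sub]
    exact (Valuation.map_sub _ _ _).trans (max_le (hx i N) ((adicVal_le_iff v _ N).mpr hn))
  have hx1 : ∀ i, Valued.v (x i) ≤ 1 := by
    intro i
    rw [← sub_add_cancel (x i) (algebraMap K (v.adicCompletion K) (algebraMap (𝓞 K) K (r i 0)))]
    exact (Valuation.map_add _ _ _).trans (max_le (by simpa using hx i 0)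
      (adicVal_integer_le_one v _))
  have hx0 : x = 0 := by
    refine h x (eq_zero_of_forall_adicVal_le v fun N => ?_)
    have hge : ∀ᶠ n in (U : Filter ℕ), N ≤ n := by
      have : (U : Filter ℕ) ≤ Filter.atTop := Nat.hyperfilter_le_atTop
      exact this (Filter.eventually_ge_atTop N)
    obtain ⟨n, h1, h2⟩ := ((hXx N).and hge).exists
    have h3 := (adicVal_le_iff v _ N).mpr (Ideal.pow_le_pow_right h2 (hX n))
    rw [← sub_add_cancel (∑ i, algebraMap K (v.adicCompletion K) (algebraMap (𝓞 K) K (c i)) * x i ^ 2)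
      (algebraMap K (v.adicCompletion K) (algebraMap (𝓞 K) K (∑ i, c i * X n i ^ 2)))]
    refine (Valuation.map_add _ _ _).trans (max_le ?_ h3)
    simp only [map_sum, map_mul, map_pow, ← Finset.sum_sub_distrib]
    refine Valuation.map_sum_le _ fun i _ => ?_
    rw [← mul_sub, sq_sub_sq, mul_comm, mul_comm (_ + _), mul_assoc]
    refine adicVal_integer_mul_le v (h1 i) ?_
    rw [map_mul]
    exact mul_le_one' ((Valuation.map_add _ _ _).trans (max_le (hx1 i) (adicVal_integer_le_one v _)))
      (adicVal_integer_le_one v _)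
  obtain ⟨n, hn⟩ := (hXx 1).exists
  obtain ⟨i, hi⟩ := hX' n
  have := hn i
  rw [hx0, Pi.zero_apply, zero_sub, Valuation.map_neg, adicVal_le_iff, pow_one] at this
  exact hi this

/-- The reduced norm form of the quaternion algebra `(α, β)`. -/
def quatForm {R : Type*} [CommRing R] (α β : R) : Fin 4 → R := ![1, -α, -β, α * β]

lemma exists_forall_mem_of_hilbSym {α β : 𝓞 K}
    (h : hilbSym v (α : K) (β : K) ≠ 1) :
    ∃ k : ℕ, ∀ x : Fin 4 → 𝓞 K, ∑ i, quatForm α β i * x i ^ 2 ∈ v.asIdeal ^ k →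
      ∀ i, x i ∈ v.asIdeal := by
  rw [hilbSym] at h
  simp only [RingOfIntegers.coe_eq_algebraMap] at h
  refine exists_forall_mem_of_anisotropic v _ fun x hx => ?_
  have hs : ∀ x y z : v.adicCompletion K,
      algebraMap K (v.adicCompletion K) (algebraMap (𝓞 K) K α) * x ^ 2 +
        algebraMap K (v.adicCompletion K) (algebraMap (𝓞 K) K β) * y ^ 2 = z ^ 2 →
      x = 0 ∧ y = 0 ∧ z = 0 := by
    intro x y z hxyz
    by_contra hne
    exact h (if_pos ⟨x, y, z, hne, hxyz⟩)
  simp only [Fin.sum_univ_four, quatForm, Matrix.cons_val, map_one, map_neg, map_mul] at hx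
  set A := algebraMap K (v.adicCompletion K) (algebraMap (𝓞 K) K α)
  set B := algebraMap K (v.adicCompletion K) (algebraMap (𝓞 K) K β)
  have hn : x 2 ^ 2 - A * x 3 ^ 2 = 0 :=
    (hs (x 1 * x 2 - x 0 * x 3) (x 2 ^ 2 - A * x 3 ^ 2) (x 0 * x 2 - A * x 1 * x 3)
      (by linear_combination (-(x 2 ^ 2 - A * x 3 ^ 2)) * hx)).2.1
  obtain ⟨h3, -, h2⟩ := hs (x 3) 0 (x 2) (by linear_combination -hn)
  obtain ⟨h1, -, h0⟩ := hs (x 1) 0 (x 0) (by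
    rw [h2, h3] at hx
    linear_combination -hx)
  funext i
  fin_cases i <;> assumption

end

section
variable {S : Type*} [CommRing S] [Finite S]

lemma quadW_neg (ψ : AddChar S ℂ) (c : S) : quadW ψ (-c) = (starRingEnd ℂ) (quadW ψ c) := by
  have := Fintype.ofFinite S
  rw [quadW_eq_sum, quadW_eq_sum, map_sum]
  refine Finset.sum_congr rfl fun z _ => ?_
  rw [neg_mul, AddChar.map_neg_eq_conj]

lemma sum_addChar_diagonal {ι : Type*} [Fintype ι] [DecidableEq ι] [Fintype S] (ψ : AddChar S ℂ) (c : ι → S)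
    (t : S) : ∑ x : ι → S, ψ (t * ∑ i, c i * x i ^ 2) = ∏ i, quadW ψ (t * c i) := by
  simp only [quadW_eq_sum]
  rw [Finset.prod_univ_sum, Fintype.piFinset_univ]
  refine Finset.sum_congr rfl fun x _ => ?_
  rw [Finset.mul_sum]
  simp only [mul_assoc]
  exact map_prod ψ.toMonoidHom (fun i => Multiplicative.ofAdd (t * (c i * x i ^ 2))) _

lemma sum_sum_addChar_mul [Fintype S] {X : Type*} [Fintype X] {ψ : AddChar S ℂ}
    (hψ : ψ.IsPrimitive) (f : X → S) :
    ∑ t : S, ∑ x, ψ (t * f x) = Fintype.card S * ∑ x, if f x = 0 then (1 : ℂ) else 0 := by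
  rw [Finset.sum_comm, Finset.mul_sum]
  refine Finset.sum_congr rfl fun x _ => ?_
  simp only [mul_comm _ (f x)]
  rw [sum_mulShift_eq_ite hψ]
  split_ifs <;> simp

lemma sum_mul_left_eq [Fintype S] (π : S) (F : S → ℂ) :
    ∑ s, F (π * s) = (Nat.card {d : S // π * d = 0} : ℂ) * ∑ s with π ∣ s, F s := by
  have h := sum_comp_addMonoidHom (AddMonoidHom.mulLeft π) F
  simp only [AddMonoidHom.coe_mulLeft] at h
  rw [h]
  congr 1
  refine Finset.sum_congr (Finset.filter_congr fun s _ => ?_) fun _ _ => rfl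
  rw [AddMonoidHom.mem_range]
  exact ⟨fun ⟨x, hx⟩ => ⟨x, hx.symm⟩, fun ⟨x, hx⟩ => ⟨x, hx.symm⟩⟩

lemma sum_mul_left_pi_eq {ι : Type*} [Fintype ι] [DecidableEq ι] [Fintype S] (π : S) (F : (ι → S) → ℂ) :
    ∑ x : ι → S, F (fun i => π * x i) = (Nat.card {d : S // π * d = 0} : ℂ) ^ Fintype.card ι *
      ∑ x with ∀ i, π ∣ x i, F x := by
  set f : (ι → S) →+ (ι → S) := (AddMonoidHom.mulLeft π).compLeft ι
  have hf : ∀ x i, f x i = π * x i := fun _ _ => rfl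
  have h := sum_comp_addMonoidHom f F
  have hk : Nat.card f.ker = Nat.card {d : S // π * d = 0} ^ Fintype.card ι := by
    rw [← Nat.card_eq_fintype_card, ← Nat.card_fun]
    refine Nat.card_congr ((Equiv.subtypeEquivRight fun x => ?_).trans
      (Equiv.subtypePiEquivPi (p := fun _ d => π * d = 0)))
    rw [AddMonoidHom.mem_ker, funext_iff]
    rfl
  rw [hk] at h
  rw [← Nat.cast_pow]
  refine h.trans (congrArg _ (Finset.sum_congr (Finset.ext fun x => ?_) fun _ _ => rfl))
  simp only [Finset.mem_filter, Finset.mem_univ, true_and, AddMonoidHom.mem_range]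
  refine ⟨fun ⟨y, hy⟩ i => ⟨y i, by rw [← hy]; rfl⟩, fun h => ?_⟩
  choose y hy using h
  exact ⟨y, funext fun i => (hy i).symm⟩

lemma norm_quadW_mul_sq {π : S} {ψ : AddChar S ℂ} (hψ : ψ.IsPrimitive)
    (h2 : ∀ d : S, 2 * d = 0 → π ∣ d) (h2π : ∀ d : S, 2 * (π * d) = 0 → π * d ^ 2 = 0)
    {c : S} (hc : IsUnit c) :
    ‖quadW ψ (π * c)‖ ^ 2 = Nat.card {d : S // π * d = 0} *
      (Nat.card S * Nat.card {d : S // 2 * d = 0}) := by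
  have := Fintype.ofFinite S
  have h := congrArg norm (quadW_mul_conj hψ (π * c))
  rw [norm_mul, RCLike.norm_conj, ← sq, norm_mul, Complex.norm_natCast] at h
  have hiff : ∀ d, 2 * (π * c) * d = 0 ↔ 2 * (π * d) = 0 := fun d => by
    rw [show 2 * (π * c) * d = c * (2 * (π * d)) by ring, hc.mul_right_eq_zero]
  have e : ∑ d with 2 * (π * c) * d = 0, ψ (π * c * d ^ 2) =
      Nat.card {d : S // π * d = 0} * Nat.card {d : S // 2 * d = 0} := by
    have h1 := sum_mul_left_eq π fun d => if 2 * d = 0 then (1 : ℂ) else 0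
    rw [Finset.sum_filter] at h1 ⊢
    rw [show (Nat.card {d : S // 2 * d = 0} : ℂ) = ∑ d : S, if π ∣ d then
      (if 2 * d = 0 then (1 : ℂ) else 0) else 0 from ?_, ← h1]
    · refine Finset.sum_congr rfl fun d _ => ?_
      by_cases hd : 2 * (π * d) = 0
      · rw [if_pos ((hiff d).mpr hd), if_pos hd, mul_right_comm, h2π d hd, zero_mul,
          AddChar.map_zero_eq_one]
      · rw [if_neg (fun h => hd ((hiff d).mp h)), if_neg hd]
    · rw [Nat.card_eq_fintype_card, Fintype.card_subtype, Finset.card_filter]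
      push_cast
      refine Finset.sum_congr rfl fun d _ => ?_
      by_cases hd : 2 * d = 0
      · rw [if_pos hd, if_pos (h2 d hd)]
      · simp [hd]
  rw [h, e, norm_mul, Complex.norm_natCast, Complex.norm_natCast, Nat.card_eq_fintype_card (α := S)]
  ring

lemma sum_eq_sum_isUnit_add [Fintype S] {π : S} (hπ : ¬ IsUnit π)
    (hloc : ∀ s : S, IsUnit s ∨ π ∣ s) (F : S → ℂ) :
    ∑ s, F s = ∑ s with IsUnit s, F s + ∑ s with π ∣ s, F s := by
  rw [← Finset.sum_filter_add_sum_filter_not _ (fun s => IsUnit s)]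
  congr 1
  refine Finset.sum_congr (Finset.filter_congr fun s _ => ?_) fun _ _ => rfl
  exact ⟨(hloc s).resolve_left, fun h hu => hπ (isUnit_of_dvd_unit h hu)⟩

lemma quatForm_isUnit {α β : S} (hα : IsUnit α) (hβ : IsUnit β) (i : Fin 4) :
    IsUnit (quatForm α β i) := by
  fin_cases i
  · exact isUnit_one
  · exact hα.neg
  · exact hβ.neg
  · exact hα.mul hβ

lemma PosEq.mul_conj_eq_norm {z w : ℂ} (h : PosEq z w) :
    z * (starRingEnd ℂ) w = (‖z * (starRingEnd ℂ) w‖ : ℝ) := by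
  obtain ⟨r, hr, rfl⟩ := h
  have : (r : ℂ) * w * (starRingEnd ℂ) w = ((r * ‖w‖ ^ 2 : ℝ) : ℂ) := by
    rw [mul_assoc, RCLike.mul_conj]; push_cast; rfl
  rw [this, Complex.norm_real, Real.norm_of_nonneg (by positivity)]

lemma exists_not_forall_dvd {π α β : S} (hπ : ¬ IsUnit π) (hloc : ∀ s : S, IsUnit s ∨ π ∣ s)
    (hq : 2 ≤ Nat.card {d : S // π * d = 0}) {ψ : AddChar S ℂ} (hψ : ψ.IsPrimitive)
    (h2 : ∀ d : S, 2 * d = 0 → π ∣ d) (h2π : ∀ d : S, 2 * (π * d) = 0 → π * d ^ 2 = 0)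
    (hα : IsUnit α) (hβ : IsUnit β)
    (hpos : ∀ s, IsUnit s → PosEq (quadW ψ (π * s) * quadW ψ (π * s * (α * β)))
      (quadW ψ (π * s * α) * quadW ψ (π * s * β))) :
    ∃ x : Fin 4 → S, ∑ i, quatForm α β i * x i ^ 2 = 0 ∧ ¬ ∀ i, π ∣ x i := by
  by_contra! hani
  have := Fintype.ofFinite S
  set q := Nat.card {d : S // π * d = 0} with hqdef
  set B : ℝ := Nat.card S * Nat.card {d : S // 2 * d = 0} with hB
  have hB0 : 0 < B := by
    have : Nonempty {d : S // 2 * d = 0} := ⟨⟨0, mul_zero _⟩⟩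
    have h4 : 0 < Nat.card S := Nat.card_pos
    have h5 : 0 < Nat.card {d : S // 2 * d = 0} := Nat.card_pos
    positivity
  set G : S → ℂ := fun t => ∏ i, quadW ψ (t * quatForm α β i) with hG
  set Z : ℂ := ∑ x : Fin 4 → S, if ∑ i, quatForm α β i * x i ^ 2 = 0 then (1 : ℂ) else 0 with hZ
  have hT0 : ∑ t, G t = Fintype.card S * Z := by
    simp only [hG, ← sum_addChar_diagonal]
    exact sum_sum_addChar_mul hψ _
  have hT2 : ∑ t, G (π * (π * t)) = Fintype.card S * (q ^ 4 * Z) := by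
    have h1 := sum_sum_addChar_mul (X := Fin 4 → S) hψ
      (fun x => ∑ i, quatForm α β i * (π * x i) ^ 2)
    have h3 : ∑ t, G (π * (π * t)) =
        ∑ t : S, ∑ x : Fin 4 → S, ψ (t * ∑ i, quatForm α β i * (π * x i) ^ 2) := by
      simp only [hG, ← sum_addChar_diagonal]
      refine Finset.sum_congr rfl fun t _ => Finset.sum_congr rfl fun x _ => ?_
      congr 1
      rw [Finset.mul_sum, Finset.mul_sum]
      exact Finset.sum_congr rfl fun i _ => by ring
    rw [h3, h1]
    congr 1
    have h4 := sum_mul_left_pi_eq π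
      (fun x : Fin 4 → S => if ∑ i, quatForm α β i * x i ^ 2 = 0 then (1 : ℂ) else 0)
    refine h4.trans ?_
    rw [Fintype.card_fin, Finset.sum_filter, hZ]
    congr 1
    refine Finset.sum_congr rfl fun x _ => ?_
    by_cases hx : ∑ i, quatForm α β i * x i ^ 2 = 0
    · rw [if_pos (hani x hx)]
    · simp [hx]
  have hE1 := sum_eq_sum_isUnit_add hπ hloc G
  have hE2 := sum_eq_sum_isUnit_add hπ hloc fun s => G (π * s)
  have hM1 := sum_mul_left_eq π G
  have hM2 := sum_mul_left_eq π fun s => G (π * s)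
  rw [← hqdef] at hM1 hM2
  have key : (q : ℂ) ^ 2 * ∑ s with IsUnit s, G s + q * ∑ s with IsUnit s, G (π * s) =
      Fintype.card S * (q ^ 2 - q ^ 4) * Z := by
    linear_combination (-(q : ℂ) ^ 2) * hE1 + (q : ℂ) ^ 2 * hT0 - q * hE2 + q * hM1 + hM2 - hT2
  have hGu : ∀ s, IsUnit s → -B ^ 2 ≤ (G s).re := by
    intro s hs
    have h1 : ‖G s‖ ^ 2 ≤ (B ^ 2) ^ 2 := by
      simp only [hG, norm_prod, ← Finset.prod_pow]
      calc _ ≤ ∏ _i : Fin 4, B := Finset.prod_le_prod (fun _ _ => by positivity)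
            fun i _ => norm_quadW_sq_le hψ (hs.mul (quatForm_isUnit hα hβ i))
        _ = _ := by simp; ring
    have h3 := abs_le_of_sq_le_sq' h1 (by positivity)
    have h4 := Complex.abs_re_le_norm (G s)
    linarith [abs_le.mp h4]
  have hGπ : ∀ s, IsUnit s → (G (π * s)).re = (q * B) ^ 2 := by
    intro s hs
    have h1 : ‖G (π * s)‖ ^ 2 = ((q * B) ^ 2) ^ 2 := by
      simp only [hG, norm_prod, ← Finset.prod_pow]
      calc _ = ∏ _i : Fin 4, (q * B) := Finset.prod_congr rfl fun i _ => by
            rw [mul_assoc, norm_quadW_mul_sq hψ h2 h2π (hs.mul (quatForm_isUnit hα hβ i))]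
        _ = _ := by simp; ring
    have h3 : ‖G (π * s)‖ = (q * B) ^ 2 :=
      (pow_left_inj₀ (norm_nonneg _) (by positivity) two_ne_zero).mp h1
    have h4 : G (π * s) = (quadW ψ (π * s) * quadW ψ (π * s * (α * β))) *
        (starRingEnd ℂ) (quadW ψ (π * s * α) * quadW ψ (π * s * β)) := by
      simp only [hG, Fin.prod_univ_four, quatForm, Matrix.cons_val, mul_one, mul_neg, quadW_neg,
        map_mul]
      ring
    rw [← h3, h4, (hpos s hs).mul_conj_eq_norm, Complex.ofReal_re, Complex.norm_real, norm_norm]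
  set U := Finset.univ.filter fun s : S => IsUnit s
  have hre := congrArg Complex.re key
  have hZn : Z = ((Finset.univ.filter fun x : Fin 4 → S =>
      ∑ i, quatForm α β i * x i ^ 2 = 0).card : ℝ) := by
    rw [hZ, Finset.card_filter]
    push_cast
    exact Finset.sum_congr rfl fun x _ => by split_ifs <;> simp
  have hZpos : 1 ≤ ((Finset.univ.filter fun x : Fin 4 → S =>
      ∑ i, quatForm α β i * x i ^ 2 = 0).card : ℝ) := by
    rw [Nat.one_le_cast, Nat.one_le_iff_ne_zero, ← Nat.pos_iff_ne_zero, Finset.card_pos]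
    exact ⟨0, by simp⟩
  set n : ℝ := ((Finset.univ.filter fun x : Fin 4 → S =>
      ∑ i, quatForm α β i * x i ^ 2 = 0).card : ℝ)
  have hA0 : -(U.card * B ^ 2) ≤ (∑ s with IsUnit s, G s).re := by
    rw [Complex.re_sum, ← mul_neg, ← nsmul_eq_mul]
    exact Finset.card_nsmul_le_sum _ _ _ fun s hs => hGu s (Finset.mem_filter.mp hs).2
  have hA1 : (∑ s with IsUnit s, G (π * s)).re = U.card * (q * B) ^ 2 := by
    rw [Complex.re_sum, Finset.sum_congr rfl fun s hs => hGπ s (Finset.mem_filter.mp hs).2,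
      Finset.sum_const, nsmul_eq_mul]
  have hre' : (q : ℝ) ^ 2 * (∑ s with IsUnit s, G s).re + q * (U.card * (q * B) ^ 2) =
      Fintype.card S * ((q : ℝ) ^ 2 - q ^ 4) * n := by
    rw [← hA1]
    have e1 : ((q : ℂ) ^ 2 * ∑ s with IsUnit s, G s).re =
        (q : ℝ) ^ 2 * (∑ s with IsUnit s, G s).re := by
      rw [← Complex.re_ofReal_mul]; push_cast; rfl
    have e2 : ((q : ℂ) * ∑ s with IsUnit s, G (π * s)).re =
        (q : ℝ) * (∑ s with IsUnit s, G (π * s)).re := by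
      rw [← Complex.re_ofReal_mul]; push_cast; rfl
    rw [← e1, ← e2, ← Complex.add_re, hre, hZn]
    have e3 : (Fintype.card S * ((q : ℂ) ^ 2 - q ^ 4) * (n : ℝ)) =
      ((Fintype.card S * ((q : ℝ) ^ 2 - q ^ 4) * n : ℝ) : ℂ) := by push_cast; rfl
    rw [e3, Complex.ofReal_re]
  have hq' : (2 : ℝ) ≤ q := by exact_mod_cast hq
  have hS : (1 : ℝ) ≤ Fintype.card S := by exact_mod_cast Fintype.card_pos (α := S)
  have hU : (0 : ℝ) ≤ U.card := Nat.cast_nonneg _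
  have l1 : (0 : ℝ) ≤ (q : ℝ) ^ 2 * (∑ s with IsUnit s, G s).re + q * (U.card * (q * B) ^ 2) := by
    have h5 := mul_le_mul_of_nonneg_left hA0 (sq_nonneg (q : ℝ))
    have h6 : 0 ≤ (q : ℝ) ^ 2 * (U.card * B ^ 2) * (q - 1) := by
      have : (0 : ℝ) ≤ q - 1 := by linarith
      positivity
    nlinarith
  have l2 : Fintype.card S * ((q : ℝ) ^ 2 - q ^ 4) * n < 0 := by
    have h5 : (q : ℝ) ^ 2 - q ^ 4 < 0 := by
      have : (1 : ℝ) < (q : ℝ) ^ 2 := by nlinarith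
      nlinarith
    have : (0 : ℝ) < Fintype.card S := by linarith
    exact mul_neg_of_neg_of_pos (mul_neg_of_pos_of_neg this h5) (by linarith)
  linarith

end

section
open IsDedekindDomain
variable (v : HeightOneSpectrum (𝓞 K))

lemma isCoprime_asIdeal_of_not_le {𝔟 : Ideal (𝓞 K)} (h : ¬ 𝔟 ≤ v.asIdeal) :
    IsCoprime 𝔟 v.asIdeal := by
  rw [Ideal.isCoprime_iff_sup_eq]
  by_contra hne
  have := v.isMaximal.eq_of_le hne (le_sup_right (a := 𝔟))
  exact h (le_sup_left.trans this.ge)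

lemma isUnit_mk_of_notMem {s : 𝓞 K} (hs : s ∉ v.asIdeal) (n : ℕ) :
    IsUnit (Ideal.Quotient.mk (v.asIdeal ^ n) s) := by
  refine isUnit_mk_iff.mpr (isCoprime_asIdeal_of_not_le v fun h => hs ?_).pow_right
  exact (Ideal.span_singleton_le_iff_mem _).mp h

variable {v} in
lemma mem_pow_of_mul_mem_pow_succ {π d : 𝓞 K} (hπ : π ∈ v.asIdeal) (hπ2 : π ∉ v.asIdeal ^ 2)
    {k : ℕ} (h : π * d ∈ v.asIdeal ^ (k + 1)) : d ∈ v.asIdeal ^ k := by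
  obtain ⟨𝔠, h𝔠⟩ := Ideal.dvd_span_singleton.mpr hπ
  have hc : IsCoprime 𝔠 v.asIdeal := by
    refine isCoprime_asIdeal_of_not_le v fun hle => hπ2 ?_
    rw [← Ideal.dvd_span_singleton, h𝔠, sq]
    exact mul_dvd_mul_left _ (Ideal.dvd_iff_le.mpr hle)
  rw [← Ideal.dvd_span_singleton, ← Ideal.span_singleton_mul_span_singleton, h𝔠, pow_succ',
    mul_assoc] at h
  exact Ideal.dvd_span_singleton.mp
    (hc.symm.pow_left.dvd_of_dvd_mul_left ((mul_dvd_mul_iff_left v.ne_bot).mp h))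

variable {v} in
lemma span_sup_pow_eq {π : 𝓞 K} (hπ : π ∈ v.asIdeal) (hπ2 : π ∉ v.asIdeal ^ 2) (k : ℕ) :
    Ideal.span {π} ⊔ v.asIdeal ^ (k + 1) = v.asIdeal := by
  obtain ⟨i, -, hi⟩ := (dvd_prime_pow v.prime (k + 1)).mp
    (Ideal.dvd_iff_le.mpr (le_sup_right (a := Ideal.span {π}) (b := v.asIdeal ^ (k + 1))))
  rw [associated_iff_eq] at hi
  have hle : Ideal.span {π} ⊔ v.asIdeal ^ (k + 1) ≤ v.asIdeal :=
    sup_le ((Ideal.span_singleton_le_iff_mem _).mpr hπ) (Ideal.pow_le_self k.succ_ne_zero)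
  have hmem : π ∈ v.asIdeal ^ i := hi ▸ Ideal.mem_sup_left (Ideal.mem_span_singleton_self π)
  have h1 : i ≠ 0 := by
    rintro rfl
    rw [hi, pow_zero, Ideal.one_eq_top] at hle
    exact v.isPrime.ne_top (top_le_iff.mp hle)
  have h2 : i < 2 := by
    by_contra! h
    exact hπ2 (Ideal.pow_le_pow_right h hmem)
  rw [hi, show i = 1 by omega, pow_one]

variable {v} in
lemma mk_dvd_mk_of_mem {π x : 𝓞 K} (hπ : π ∈ v.asIdeal) (hπ2 : π ∉ v.asIdeal ^ 2) (k : ℕ)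
    (hx : x ∈ v.asIdeal) :
    Ideal.Quotient.mk (v.asIdeal ^ (k + 1)) π ∣ Ideal.Quotient.mk (v.asIdeal ^ (k + 1)) x := by
  rw [← span_sup_pow_eq hπ hπ2 k] at hx
  obtain ⟨y, hy, z, hz, rfl⟩ := Submodule.mem_sup.mp hx
  rw [map_add, Ideal.Quotient.eq_zero_iff_mem.mpr hz, add_zero]
  exact map_dvd _ (Ideal.mem_span_singleton.mp hy)

variable {v} in
lemma charIdeal_liftChar_mulShift {k : ℕ} {ψ : AddChar (𝓞 K ⧸ v.asIdeal ^ (k + 1)) ℂ}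
    (hψ : ψ.IsPrimitive) {c : 𝓞 K} (hc : c ∈ v.asIdeal) (hc2 : c ∉ v.asIdeal ^ 2) :
    charIdeal ((liftChar ψ).mulShift c) = v.asIdeal ^ k := by
  ext x
  rw [mem_charIdeal_mulShift, charIdeal_liftChar hψ]
  refine ⟨mem_pow_of_mul_mem_pow_succ hc hc2, fun h => ?_⟩
  rw [pow_succ']
  exact Ideal.mul_mem_mul hc h

lemma le_of_span_two_pow_eq {l k : ℕ} {𝔟 : Ideal (𝓞 K)} (h2 : (2 : 𝓞 K) ∈ v.asIdeal)
    (hA : Ideal.span {(2 : 𝓞 K) ^ l} = v.asIdeal ^ k * 𝔟) (hc : IsCoprime v.asIdeal 𝔟) :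
    l ≤ k := by
  have h := Ideal.dvd_span_singleton.mpr (Ideal.pow_mem_pow h2 l)
  rw [hA] at h
  have h1 := Ideal.dvd_iff_le.mp (hc.pow_left.dvd_of_dvd_mul_right h)
  exact (Ideal.pow_right_strictAnti _ v.ne_bot v.isPrime.ne_top).le_iff_ge.mp h1

lemma two_notMem_pow_of_span_two_pow_eq {l k : ℕ} (hl : l ≠ 0) {𝔟 : Ideal (𝓞 K)}
    (hA : Ideal.span {(2 : 𝓞 K) ^ l} = v.asIdeal ^ k * 𝔟) (hc : IsCoprime v.asIdeal 𝔟) :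
    (2 : 𝓞 K) ∉ v.asIdeal ^ (k + 1) := by
  intro h
  have h1 : (2 : 𝓞 K) ^ l ∈ v.asIdeal ^ (k + 1) := Ideal.pow_mem_of_mem _ h _ (Nat.pos_of_ne_zero hl)
  rw [← Ideal.dvd_span_singleton, hA] at h1
  have h3 := Ideal.dvd_iff_le.mp (hc.pow_left.dvd_of_dvd_mul_right h1)
  have := (Ideal.pow_right_strictAnti _ v.ne_bot v.isPrime.ne_top).le_iff_ge.mp h3
  omega

variable {v} in
lemma posEq_quadW_mul {k : ℕ} {ψ : AddChar (𝓞 K ⧸ v.asIdeal ^ (k + 1)) ℂ} {c : 𝓞 K}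
    (hJ : v.asIdeal ^ k ≤ charIdeal ((liftChar ψ).mulShift c)) (d : 𝓞 K) :
    PosEq (quadW ψ (Ideal.Quotient.mk _ (c * d)))
      (quadW (quotChar ((liftChar ψ).mulShift c) _ hJ) (Ideal.Quotient.mk _ d)) := by
  have hfin : ∀ n, Finite (𝓞 K ⧸ v.asIdeal ^ n) := fun n =>
    Ring.HasFiniteQuotients.finiteQuotient (pow_ne_zero n v.ne_bot)
  have := hfin k
  have := hfin (k + 1)
  obtain ⟨N, hN, -, h⟩ := quadW_quotChar_mulShift (liftChar ψ) _ _
    (Ideal.pow_le_pow_right (Nat.le_succ k)) (le_charIdeal_liftChar ψ) c hJ d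
  rw [quotChar_liftChar] at h
  rw [h]
  exact posEq_natCast_mul hN _

variable {v} in
lemma mul_sq_eq_zero_of_two_mul {l k : ℕ} (hl : 2 ≤ l) {𝔟 : Ideal (𝓞 K)}
    (hA : Ideal.span {(2 : 𝓞 K) ^ l} = v.asIdeal ^ k * 𝔟) (hc : IsCoprime v.asIdeal 𝔟)
    {π : 𝓞 K} (hπ : π ∈ v.asIdeal) (hπ2 : π ∉ v.asIdeal ^ 2) (d : 𝓞 K ⧸ v.asIdeal ^ (k + 1))
    (h : 2 * (Ideal.Quotient.mk _ π * d) = 0) : Ideal.Quotient.mk _ π * d ^ 2 = 0 := by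
  obtain ⟨d, rfl⟩ := Ideal.Quotient.mk_surjective d
  have h1 : π * (2 * d) ∈ v.asIdeal ^ (k + 1) := by
    rw [← Ideal.Quotient.eq_zero_iff_mem, map_mul, map_mul, map_ofNat]
    linear_combination h
  have h2 := sq_eq_zero_of_two_mul_eq_zero hl hA hc.pow_left (Ideal.Quotient.mk _ d) (by
    rw [← map_ofNat (Ideal.Quotient.mk (v.asIdeal ^ k)) 2, ← map_mul,
      Ideal.Quotient.eq_zero_iff_mem]
    exact mem_pow_of_mul_mem_pow_succ hπ hπ2 h1)
  rw [← map_pow, Ideal.Quotient.eq_zero_iff_mem] at h2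
  rw [← map_pow, ← map_mul, Ideal.Quotient.eq_zero_iff_mem, pow_succ' _ k]
  exact Ideal.mul_mem_mul hπ h2

variable {v} in
lemma two_le_card_mul_eq_zero {π : 𝓞 K} (hπ : π ∈ v.asIdeal) (k : ℕ) :
    2 ≤ Nat.card {d : 𝓞 K ⧸ v.asIdeal ^ (k + 1) // Ideal.Quotient.mk _ π * d = 0} := by
  have : Finite (𝓞 K ⧸ v.asIdeal ^ (k + 1)) :=
    Ring.HasFiniteQuotients.finiteQuotient (pow_ne_zero _ v.ne_bot)
  obtain ⟨y, hy, hy'⟩ := Ideal.exists_mem_pow_notMem_pow_succ _ v.ne_bot v.isPrime.ne_top k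
  refine Finite.one_lt_card_iff_nontrivial.mpr ⟨⟨0, mul_zero _⟩, ⟨Ideal.Quotient.mk _ y, ?_⟩, ?_⟩
  · rw [← map_mul, Ideal.Quotient.eq_zero_iff_mem, pow_succ']
    exact Ideal.mul_mem_mul hπ hy
  · intro h
    exact hy' (Ideal.Quotient.eq_zero_iff_mem.mp (congrArg Subtype.val h).symm)

lemma exists_forall_recSym_ne_one (htot : ∀ φ : K →+* ℂ, ComplexEmbedding.IsReal φ)
    (h2 : (2 : 𝓞 K) ∈ v.asIdeal) {α β : 𝓞 K} (hβ : TotPos β) (hβo : OddIdeal (Ideal.span {β}))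
    (h : hilbSym v (α : K) (β : K) ≠ 1) :
    ∃ l₀, ∀ l, l₀ ≤ l → 2 ≤ l → ∀ (k : ℕ) (𝔟 : Ideal (𝓞 K)),
      Ideal.span {(2 : 𝓞 K) ^ l} = v.asIdeal ^ k * 𝔟 → IsCoprime v.asIdeal 𝔟 →
      ∀ a : 𝓞 K, TotPos a → OddIdeal (Ideal.span {a}) →
      IsCoprime (Ideal.span {a}) (Ideal.span {β}) → a - α ∈ v.asIdeal ^ k → a - 1 ∈ 𝔟 →
      recSym a β ≠ 1 := by
  obtain ⟨k₀, hk₀⟩ := exists_forall_mem_of_hilbSym v h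
  refine ⟨k₀, fun l hl0 hl k 𝔟 hA hc a ha hao haβ haα ha1 hR => ?_⟩
  have hlk := le_of_span_two_pow_eq v h2 hA hc
  have hnot : ∀ x : 𝓞 K, OddIdeal (Ideal.span {x}) → x ∉ v.asIdeal := fun x hx hxv => by
    have h3 := (isCoprime_two_pow_iff one_ne_zero).mpr hx
    rw [pow_one] at h3
    refine (ideal_coprime_iff_forall_prime.mp h3) v.asIdeal v.isPrime ?_ ?_
    · exact (Ideal.span_singleton_le_iff_mem _).mpr hxv
    · exact (Ideal.span_singleton_le_iff_mem _).mpr h2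
  have hα : α ∉ v.asIdeal := fun hα => hnot a hao (by
    have := v.asIdeal.add_mem (Ideal.pow_le_self (by omega) haα) hα
    rwa [sub_add_cancel] at this)
  obtain ⟨π, hπ, hπ2⟩ := Ideal.exists_mem_pow_notMem_pow_succ _ v.ne_bot v.isPrime.ne_top 1
  rw [pow_one] at hπ
  have : Finite (𝓞 K ⧸ v.asIdeal ^ (k + 1)) :=
    Ring.HasFiniteQuotients.finiteQuotient (pow_ne_zero _ v.ne_bot)
  obtain ⟨ψ, hψ⟩ := exists_isPrimitive_quotient (pow_ne_zero (k + 1) v.ne_bot) htot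
  have hunit : ∀ s : 𝓞 K, IsUnit (Ideal.Quotient.mk (v.asIdeal ^ (k + 1)) s) → s ∉ v.asIdeal := by
    intro s hs hsv
    have h3 := (isUnit_mk_iff.mp hs).of_isCoprime_of_dvd_right (dvd_pow_self _ k.succ_ne_zero)
    refine ideal_coprime_iff_forall_prime.mp h3 v.asIdeal v.isPrime ?_ le_rfl
    exact (Ideal.span_singleton_le_iff_mem _).mpr hsv
  obtain ⟨x, hx0, hx⟩ := exists_not_forall_dvd (π := Ideal.Quotient.mk (v.asIdeal ^ (k + 1)) π)
    (α := Ideal.Quotient.mk _ α) (β := Ideal.Quotient.mk _ β) (fun hu => hunit π hu hπ)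
    (fun s => by
      obtain ⟨s, rfl⟩ := Ideal.Quotient.mk_surjective s
      by_cases hs : s ∈ v.asIdeal
      · exact Or.inr (mk_dvd_mk_of_mem hπ hπ2 k hs)
      · exact Or.inl (isUnit_mk_of_notMem v hs _))
    (two_le_card_mul_eq_zero hπ k) hψ
    (fun d hd => by
      obtain ⟨d, rfl⟩ := Ideal.Quotient.mk_surjective d
      refine mk_dvd_mk_of_mem hπ hπ2 k ?_
      by_contra hdv
      rw [(isUnit_mk_of_notMem v hdv _).mul_left_eq_zero,
        ← map_ofNat (Ideal.Quotient.mk (v.asIdeal ^ (k + 1))) 2,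
        Ideal.Quotient.eq_zero_iff_mem] at hd
      exact two_notMem_pow_of_span_two_pow_eq v (by omega) hA hc hd)
    (mul_sq_eq_zero_of_two_mul hl hA hc hπ hπ2)
    (isUnit_mk_of_notMem v hα _) (isUnit_mk_of_notMem v (hnot β hβo) _)
    (fun s hs => by
      obtain ⟨s, rfl⟩ := Ideal.Quotient.mk_surjective s
      have hs' := hunit s hs
      have hc1 : π * s ∈ v.asIdeal := Ideal.mul_mem_right _ _ hπ
      have hc2 : π * s ∉ v.asIdeal ^ 2 := fun hm => hs' (by
        simpa using mem_pow_of_mul_mem_pow_succ hπ hπ2 (k := 1) hm)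
      have hJ := charIdeal_liftChar_mulShift hψ hc1 hc2
      have hprim := quotChar_isPrimitive _ _ hJ.symm
      have hW := posEq_quadW_mul hJ.ge
      have hloc := posEq_recSym_quadW_local htot hl ha hβ hao hβo haβ hA hc.pow_left ha1 hprim
      have haα' : Ideal.Quotient.mk (v.asIdeal ^ k) a = Ideal.Quotient.mk _ α :=
        Ideal.Quotient.eq.mpr haα
      rw [hR, map_mul, haα', ← map_mul, Int.cast_one, one_mul] at hloc
      have h1 := (hW 1).mul (hW (α * β))
      have h3 := (hW α).mul (hW β)
      rw [map_one] at h1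
      simp only [mul_one, map_mul] at h1 h3 hloc ⊢
      exact h1.trans (hloc.trans h3.symm))
  choose y hy using fun i => Ideal.Quotient.mk_surjective (x i)
  refine hx fun i => ?_
  rw [← hy i]
  refine mk_dvd_mk_of_mem hπ hπ2 k (hk₀ y (Ideal.pow_le_pow_right (show k₀ ≤ k + 1 by omega) ?_) i)
  rw [← Ideal.Quotient.eq_zero_iff_mem, map_sum, ← hx0]
  refine Finset.sum_congr rfl fun i _ => ?_
  rw [map_mul, map_pow, hy]
  congr 1
  fin_cases i <;> simp [quatForm]

lemma hilbSym_eq_one_or (a b : K) : hilbSym v a b = 1 ∨ hilbSym v a b = -1 := by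
  rw [hilbSym]
  split_ifs
  · exact Or.inl rfl
  · exact Or.inr rfl

lemma exists_forall_recSym_eq_hilbSym (htot : ∀ φ : K →+* ℂ, ComplexEmbedding.IsReal φ)
    (h2 : (2 : 𝓞 K) ∈ v.asIdeal) {α β : 𝓞 K} (hβ : TotPos β) (hβo : OddIdeal (Ideal.span {β})) :
    ∃ l₀, ∀ l, l₀ ≤ l → 2 ≤ l → ∀ (k : ℕ) (𝔟 : Ideal (𝓞 K)),
      Ideal.span {(2 : 𝓞 K) ^ l} = v.asIdeal ^ k * 𝔟 → IsCoprime v.asIdeal 𝔟 →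
      ∀ a : 𝓞 K, TotPos a → OddIdeal (Ideal.span {a}) →
      IsCoprime (Ideal.span {a}) (Ideal.span {β}) → a - α ∈ v.asIdeal ^ k → a - 1 ∈ 𝔟 →
      recSym a β = hilbSym v (α : K) (β : K) := by
  by_cases h : hilbSym v (α : K) (β : K) = 1
  · refine ⟨0, fun l _ hl k 𝔟 hA hc a ha hao haβ haα ha1 => ?_⟩
    rw [h]
    exact recSym_eq_one_of_hilbSym v htot hl h2 hβ ha hβo hao haβ hA hc haα ha1 h
  · obtain ⟨l₀, hl₀⟩ := exists_forall_recSym_ne_one v htot h2 hβ hβo h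
    refine ⟨l₀, fun l hl0 hl k 𝔟 hA hc a ha hao haβ haα ha1 => ?_⟩
    rw [(hilbSym_eq_one_or v _ _).resolve_left h]
    exact (sq_eq_one_iff.mp (recSym_sq haβ)).resolve_left
      (hl₀ l hl0 hl k 𝔟 hA hc a ha hao haβ haα ha1)

end

section
open IsDedekindDomain

lemma mem_of_forall_mem_pow {I : Ideal (𝓞 K)} (hI : I ≠ ⊥) {x : 𝓞 K}
    (h : ∀ v : HeightOneSpectrum (𝓞 K), I ≤ v.asIdeal → ∃ (k : ℕ) (𝔟 : Ideal (𝓞 K)),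
      I = v.asIdeal ^ k * 𝔟 ∧ IsCoprime v.asIdeal 𝔟 ∧ x ∈ v.asIdeal ^ k) : x ∈ I := by
  set J : Ideal (𝓞 K) := Submodule.comap (LinearMap.toSpanSingleton (𝓞 K) (𝓞 K) x) I
  have hJ : ∀ r, r ∈ J ↔ r * x ∈ I := fun _ => Iff.rfl
  suffices h1 : J = ⊤ by
    have := (hJ 1).mp (h1 ▸ Submodule.mem_top)
    rwa [one_mul] at this
  by_contra hne
  obtain ⟨𝔪, h𝔪, hJ𝔪⟩ := Ideal.exists_le_maximal J hne
  have hI𝔪 : I ≤ 𝔪 := fun r hr => hJ𝔪 ((hJ r).mpr (I.mul_mem_right x hr))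
  obtain ⟨k, 𝔟, h1, hc, hx⟩ := h ⟨𝔪, h𝔪.isPrime, fun h0 => hI (le_bot_iff.mp (h0 ▸ hI𝔪))⟩ hI𝔪
  have hb : 𝔟 ≤ 𝔪 := fun r hr => hJ𝔪 ((hJ r).mpr (by
    rw [h1, mul_comm r]
    exact Ideal.mul_mem_mul hx hr))
  rw [Ideal.isCoprime_iff_sup_eq] at hc
  exact h𝔪.ne_top (by rw [← hc]; exact (sup_eq_left.mpr hb).symm)

lemma recSym_mul_prod (htot : ∀ φ : K →+* ℂ, ComplexEmbedding.IsReal φ) {α β : 𝓞 K}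
    (hα : TotPos α) (hαo : OddIdeal (Ideal.span {α}))
    (hαβ : IsCoprime (Ideal.span {α}) (Ideal.span {β})) {ι : Type*} (s : Finset ι) (a : ι → 𝓞 K)
    (ha : ∀ i ∈ s, TotPos (a i) ∧ OddIdeal (Ideal.span {a i}) ∧
      IsCoprime (Ideal.span {a i}) (Ideal.span {β})) :
    TotPos (α * ∏ i ∈ s, a i) ∧ OddIdeal (Ideal.span {α * ∏ i ∈ s, a i}) ∧
      IsCoprime (Ideal.span {α * ∏ i ∈ s, a i}) (Ideal.span {β}) ∧
      recSym (α * ∏ i ∈ s, a i) β = recSym α β * ∏ i ∈ s, recSym (a i) β := by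
  induction s using Finset.induction_on with
  | empty => simpa using ⟨hα, hαo, hαβ⟩
  | insert i s his ih =>
    obtain ⟨h1, h2, h3, h4⟩ := ih fun j hj => ha j (Finset.mem_insert_of_mem hj)
    obtain ⟨g1, g2, g3⟩ := ha i (Finset.mem_insert_self i s)
    rw [Finset.prod_insert his, Finset.prod_insert his, mul_left_comm,
      recSym_mul_left (g1.ne_zero htot) (h1.ne_zero htot), h4, OddIdeal,
      ← Ideal.span_singleton_mul_span_singleton]
    exact ⟨g1.mul h1, g2.mul_left h2, g3.mul_left h3, by ring⟩

lemma isCoprime_span_of_isUnit {u : 𝓞 K} (hu : IsUnit u) (I : Ideal (𝓞 K)) :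
    IsCoprime (Ideal.span {u}) I := by
  rw [Ideal.span_singleton_eq_top.mpr hu, ← Ideal.one_eq_top]
  exact isCoprime_one_left

lemma exists_totPos_local_approx {A P 𝔟 : Ideal (𝓞 K)} (hA0 : A ≠ ⊥) (hA : A = P * 𝔟)
    (hc : IsCoprime P 𝔟) {α β : 𝓞 K} (hβ0 : β ≠ 0) (hαA : IsCoprime (Ideal.span {α}) A)
    (hβA : IsCoprime (Ideal.span {β}) A) :
    ∃ a, TotPos a ∧ IsCoprime (Ideal.span {a}) A ∧ IsCoprime (Ideal.span {a}) (Ideal.span {β}) ∧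
      a - α ∈ P ∧ a - 1 ∈ 𝔟 := by
  obtain ⟨g, hg1, hg2⟩ := exists_crt hc α 1
  have hβ0' : Ideal.span {β} ≠ ⊥ := by simpa using hβ0
  obtain ⟨a, ha, ha1, ha2⟩ := exists_totPos_crt hA0 hβ0' hβA.symm g 1
  have h1 := isCoprime_span_of_isUnit (isUnit_one (M := 𝓞 K)) 𝔟
  have h2 := isCoprime_span_of_isUnit (isUnit_one (M := 𝓞 K)) (Ideal.span {β})
  rw [hA] at ha1 hαA
  have haP : a - α ∈ P := by
    have h3 : a - g ∈ P := Ideal.mul_le_left ha1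
    simpa using add_mem h3 hg1
  have hab : a - 1 ∈ 𝔟 := by
    have h3 : a - g ∈ 𝔟 := Ideal.mul_le_right ha1
    simpa using add_mem h3 hg2
  refine ⟨a, ha, ?_, isCoprime_span_of_sub_mem ha2 h2, haP, hab⟩
  rw [hA]
  exact (isCoprime_span_of_sub_mem haP hαA.of_mul_right_left).mul_right
    (isCoprime_span_of_sub_mem hab h1)

lemma recSym_eq_mu2 (htot : ∀ φ : K →+* ℂ, ComplexEmbedding.IsReal φ) {α β : 𝓞 K}
    (hα : TotPos α) (hβ : TotPos β) (hαo : OddIdeal (Ideal.span {α}))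
    (hβo : OddIdeal (Ideal.span {β})) (hαβ : IsCoprime (Ideal.span {α}) (Ideal.span {β})) :
    recSym α β = mu2 (α : K) (β : K) := by
  have hfin : {v : HeightOneSpectrum (𝓞 K) | (2 : 𝓞 K) ∈ v.asIdeal}.Finite := by
    have h := Ideal.finite_factors (I := Ideal.span {(2 : 𝓞 K)}) (by simp)
    simpa only [Ideal.dvd_span_singleton] using h
  set T := hfin.toFinset
  have hT : ∀ v, v ∈ T ↔ (2 : 𝓞 K) ∈ v.asIdeal := fun v => by simp [T]
  have hmu : mu2 (α : K) (β : K) = ∏ v ∈ T, hilbSym v (α : K) (β : K) := by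
    rw [mu2, finprod_eq_prod_of_mulSupport_subset (s := T)]
    · exact Finset.prod_congr rfl fun v hv => if_pos ((hT v).mp hv)
    · intro v hv
      by_contra hn
      exact hv (if_neg fun h => hn ((hT v).mpr h))
  choose! l₀ hl₀ using fun (v : HeightOneSpectrum (𝓞 K)) (hv : (2 : 𝓞 K) ∈ v.asIdeal) =>
    exists_forall_recSym_eq_hilbSym v htot hv (α := α) hβ hβo
  set l := max 2 (T.sup l₀)
  have hl : 2 ≤ l := le_max_left _ _
  have hlv : ∀ v ∈ T, l₀ v ≤ l := fun v hv => (Finset.le_sup hv).trans (le_max_right _ _)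
  have hA0 : Ideal.span {(2 : 𝓞 K) ^ l} ≠ ⊥ := by simp
  choose k 𝔟 hA hc using fun v : HeightOneSpectrum (𝓞 K) => exists_eq_pow_mul_isCoprime v hA0
  have hodd := fun (x : 𝓞 K) => isCoprime_two_pow_iff (𝔪 := Ideal.span {x}) (l := l) (by omega)
  choose a ha hao haβ haα ha1 using fun v => exists_totPos_local_approx hA0 (hA v)
    (hc v).pow_left (hβ.ne_zero htot) ((hodd α).mpr hαo) ((hodd β).mpr hβo)
  obtain ⟨h1, h2, h3, h4⟩ := recSym_mul_prod htot hα hαo hαβ T a fun v _ =>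
    ⟨ha v, (hodd _).mp (hao v), haβ v⟩
  have hsq : α * ∏ v ∈ T, a v - α ^ 2 ∈ Ideal.span {(2 : 𝓞 K) ^ l} := by
    refine mem_of_forall_mem_pow hA0 fun w hw => ⟨k w, 𝔟 w, hA w, hc w, ?_⟩
    have hwT : w ∈ T := (hT w).mpr
      (w.isPrime.mem_of_pow_mem l (hw (Ideal.mem_span_singleton_self _)))
    have hne : ∀ v ∈ T, v ≠ w → Ideal.Quotient.mk (w.asIdeal ^ k w) (a v) = 1 := by
      intro v _ hvw
      have hd : w.asIdeal ^ k w ∣ v.asIdeal ^ k v * 𝔟 v := by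
        rw [← hA v, hA w]
        exact dvd_mul_right _ _
      have hcop := HeightOneSpectrum.isCoprime_pow_of_ne w v hvw.symm (k w) (k v)
      rw [← map_one (Ideal.Quotient.mk _)]
      exact Ideal.Quotient.eq.mpr (Ideal.dvd_iff_le.mp (hcop.dvd_of_dvd_mul_left hd) (ha1 v))
    rw [← Ideal.Quotient.eq, map_mul, map_prod,
      Finset.prod_eq_single_of_mem w hwT hne, Ideal.Quotient.eq.mpr (haα w), map_pow, sq]
  have h5 := recSym_eq_one_of_sq htot hl h1 hβ h2 hβo h3 hsq
  have h6 : ∏ v ∈ T, recSym (a v) β = ∏ v ∈ T, hilbSym v (α : K) (β : K) :=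
    Finset.prod_congr rfl fun v hv => hl₀ v ((hT v).mp hv) l (hlv v hv) hl (k v) (𝔟 v) (hA v)
      (hc v) (a v) (ha v) ((hodd _).mp (hao v)) (haβ v) (haα v) (ha1 v)
  rw [hmu, ← h6]
  linear_combination (∏ v ∈ T, recSym (a v) β) * recSym_sq hαβ -
    (recSym α β) * (h5.symm.trans h4).symm

end

/-- The action of a field automorphism on the ring of integers. -/
def galEquiv (σ : K ≃ₐ[ℚ] K) : 𝓞 K ≃+* 𝓞 K := RingOfIntegers.mapRingEquiv (σ : K ≃+* K)

lemma coe_galEquiv (σ : K ≃ₐ[ℚ] K) (x : 𝓞 K) : ((galEquiv σ x : 𝓞 K) : K) = σ (x : K) := rfl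

lemma galMap_span (σ : K ≃ₐ[ℚ] K) (x : 𝓞 K) :
    galMap σ (Ideal.span {x}) = Ideal.span {galEquiv σ x} := by
  rw [galMap, Ideal.map_span, Set.image_singleton]
  rfl

lemma galEquiv_symm_apply (σ : K ≃ₐ[ℚ] K) (x : 𝓞 K) :
    galEquiv σ (galEquiv σ⁻¹ x) = x := by
  ext
  exact σ.apply_symm_apply _

lemma TotPos.galEquiv {x : 𝓞 K} (h : TotPos x) (σ : K ≃ₐ[ℚ] K) : TotPos (galEquiv σ x) :=
  fun v => h (v.comp (σ : K →+* K))

lemma legSym_map (e : 𝓞 K ≃+* 𝓞 K) (𝔭 : Ideal (𝓞 K)) (x : 𝓞 K) :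
    legSym (𝔭.map (e : 𝓞 K →+* 𝓞 K)) (e x) = legSym 𝔭 x := by
  set f := Ideal.quotientEquiv 𝔭 (𝔭.map (e : 𝓞 K →+* 𝓞 K)) e rfl
  have hf : Ideal.Quotient.mk (𝔭.map (e : 𝓞 K →+* 𝓞 K)) (e x) = f (Ideal.Quotient.mk 𝔭 x) := rfl
  rw [legSym, legSym, hf]
  have h1 : f (Ideal.Quotient.mk 𝔭 x) = 0 ↔ Ideal.Quotient.mk 𝔭 x = 0 := f.map_eq_zero_iff
  have h2 : IsSquare (f (Ideal.Quotient.mk 𝔭 x)) ↔ IsSquare (Ideal.Quotient.mk 𝔭 x) :=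
    ⟨fun h => by simpa using h.map f.symm, fun h => h.map f⟩
  simp only [h1, h2]

lemma quadSym_map (e : 𝓞 K ≃+* 𝓞 K) {𝔞 : Ideal (𝓞 K)} (h𝔞 : 𝔞 ≠ ⊥) (x : 𝓞 K) :
    quadSym (𝔞.map (e : 𝓞 K →+* 𝓞 K)) (e x) = quadSym 𝔞 x := by
  have hbot : ∀ I : Ideal (𝓞 K), I ≠ ⊥ → I.map (e : 𝓞 K →+* 𝓞 K) ≠ ⊥ := fun I hI h =>
    hI ((Ideal.map_eq_bot_iff_of_injective e.injective).mp h)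
  induction 𝔞 using UniqueFactorizationMonoid.induction_on_prime with
  | h₁ => exact absurd rfl h𝔞
  | h₂ I hI =>
    rw [Ideal.isUnit_iff] at hI
    rw [hI, Ideal.map_top, ← Ideal.one_eq_top, quadSym_one, quadSym_one]
  | h₃ I 𝔭 hI h𝔭 ih =>
    have h𝔭0 : 𝔭 ≠ ⊥ := h𝔭.ne_zero
    have := Ideal.isPrime_of_prime h𝔭
    have h𝔭' : Prime (𝔭.map (e : 𝓞 K →+* 𝓞 K)) :=
      Ideal.prime_of_isPrime (hbot _ h𝔭0) (Ideal.map_isPrime_of_equiv e)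
    rw [Ideal.map_mul, quadSym_mul_left (hbot _ h𝔭0) (hbot _ hI), quadSym_mul_left h𝔭0 hI, ih hI,
      quadSym_of_prime h𝔭, quadSym_of_prime h𝔭', legSym_map]

lemma TotPos.of_mul_left {x y : 𝓞 K} (hx : TotPos x) (h : TotPos (x * y)) : TotPos y := fun v => by
  have := h v
  simp only [map_mul] at this
  exact (pos_iff_pos_of_mul_pos this).mp (hx v)

lemma spin_span (hunits : ∀ u : (𝓞 K)ˣ, TotPos (u : 𝓞 K) → ∃ w : (𝓞 K)ˣ, u = w ^ 2)
    (σ : K ≃ₐ[ℚ] K) {α : 𝓞 K} (hα : TotPos α) :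
    spin σ (Ideal.span {α}) = quadSym (Ideal.span {galEquiv σ α}) α := by
  have hex : ∃ x : 𝓞 K, Ideal.span {x} = Ideal.span {α} ∧ TotPos x := ⟨α, rfl, hα⟩
  rw [spin, dif_pos hex, galMap_span]
  obtain ⟨h1, h2⟩ := hex.choose_spec
  obtain ⟨u, hu⟩ := Ideal.span_singleton_eq_span_singleton.mp h1.symm
  rw [← hu] at h2 ⊢
  obtain ⟨w, rfl⟩ := hunits u (hα.of_mul_left h2)
  have hw := isCoprime_span_of_isUnit w.isUnit (Ideal.span {galEquiv σ α})
  rw [quadSym_mul_right, Units.val_pow_eq_pow_val, sq, quadSym_mul_right, ← sq, quadSym_sq hw,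
    mul_one]

lemma spin_inv_span (htot : ∀ φ : K →+* ℂ, ComplexEmbedding.IsReal φ)
    (hunits : ∀ u : (𝓞 K)ˣ, TotPos (u : 𝓞 K) → ∃ w : (𝓞 K)ˣ, u = w ^ 2)
    (σ : K ≃ₐ[ℚ] K) {α : 𝓞 K} (hα : TotPos α) :
    spin σ⁻¹ (Ideal.span {α}) = quadSym (Ideal.span {α}) (galEquiv σ α) := by
  have h0 : Ideal.span {galEquiv σ⁻¹ α} ≠ ⊥ := by
    simpa using (hα.galEquiv σ⁻¹).ne_zero htot
  rw [spin_span hunits _ hα, ← quadSym_map (galEquiv σ) h0, Ideal.map_span, Set.image_singleton]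
  congr 3
  exact galEquiv_symm_apply σ α

lemma OddIdeal.galEquiv {α : 𝓞 K} (h : OddIdeal (Ideal.span {α})) (σ : K ≃ₐ[ℚ] K) :
    OddIdeal (Ideal.span {galEquiv σ α}) := by
  obtain ⟨x, hx, y, hy, hxy⟩ := Ideal.isCoprime_iff_exists.mp h
  obtain ⟨x, rfl⟩ := Ideal.mem_span_singleton.mp hx
  obtain ⟨y, rfl⟩ := Ideal.mem_span_singleton.mp hy
  have h1 := congrArg (_root_.galEquiv σ) hxy
  simp only [map_add, map_mul, map_one, map_ofNat] at h1
  exact Ideal.isCoprime_iff_exists.mpr ⟨_, Ideal.mem_span_singleton.mpr ⟨_, rfl⟩, _,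
    Ideal.mem_span_singleton.mpr ⟨_, rfl⟩, h1⟩

/-- **Lemma 9.1** (Friedlander–Iwaniec–Mazur–Rubin, "The spin of prime ideals").
In the standing setting, for `σ` in the Galois group and `𝔞 = (α)` an odd principal ideal
with totally positive generator `α`, one has
`spin(σ,𝔞) = spin(σ⁻¹,𝔞) · μ₂(α, σα)`; in particular `spin(σ,𝔞) = spin(σ⁻¹,𝔞)` whenever
`α ≡ 1 (mod 4)`. -/
theorem spins_of_prime_ideals_stmt11
    (n : ℕ) (hn : 3 ≤ n)
    (K : Type*) [Field K] [NumberField K] [IsGalois ℚ K]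
    (hdeg : Module.finrank ℚ K = n)
    (htotreal : ∀ φ : K →+* ℂ, ComplexEmbedding.IsReal φ)
    (hcyc : IsCyclic (K ≃ₐ[ℚ] K))
    (hunits : ∀ u : (𝓞 K)ˣ, TotPos (u : 𝓞 K) → ∃ w : (𝓞 K)ˣ, u = w ^ 2)
    (σ : K ≃ₐ[ℚ] K)
    (α : 𝓞 K) (hαpos : TotPos α)
    (hαodd : OddIdeal (Ideal.span {α})) :
    spin σ (Ideal.span {α}) =
      spin σ⁻¹ (Ideal.span {α}) * mu2 (α : K) (σ (α : K)) ∧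
    (α - 1 ∈ Ideal.span {(4 : 𝓞 K)} →
      spin σ (Ideal.span {α}) = spin σ⁻¹ (Ideal.span {α})) := by
  have hσpos := hαpos.galEquiv σ
  have hσodd := hαodd.galEquiv σ
  rw [spin_span hunits σ hαpos, spin_inv_span htotreal hunits σ hαpos]
  by_cases hcop : IsCoprime (Ideal.span {α}) (Ideal.span {galEquiv σ α})
  · have hsq := quadSym_sq hcop.symm
    constructor
    · rw [← coe_galEquiv, ← recSym_eq_mu2 htotreal hαpos hσpos hαodd hσodd hcop, recSym]
      linear_combination -quadSym (Ideal.span {galEquiv σ α}) α * hsq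
    · intro h
      have h1 := recSym_eq_one_of_sq htotreal le_rfl hαpos hσpos hαodd hσodd hcop (s := 1)
        (by norm_num; exact h)
      rw [recSym] at h1
      linear_combination quadSym (Ideal.span {α}) (galEquiv σ α) * h1 -
        quadSym (Ideal.span {galEquiv σ α}) α * hsq
  · rw [quadSym_eq_zero (by simpa using hσpos.ne_zero htotreal) hcop,
      quadSym_eq_zero (by simpa using hαpos.ne_zero htotreal) fun h => hcop h.symm]
    simp

end
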